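/- For every integer n ≥ 10, every planar simple graph G on n vertices that contains no member of Θ₆ as a subgraph satisfies e(G) < 18(n−2)/7. That is, ex_P(n, Θ₆) < 18(n−2)/7 for all n ≥ 10 (the bound of 18(n−2)/7 is never attained for n ≥ 10). -/

import Mathlib

open SimpleGraph

/-- `G` has a planar embedding (drawing in the plane): vertices are mapped to distinct
points of `ℝ²`, each edge `uv` is drawn as a simple continuous arc from the point of `u`
to the point of `v`, arcs traversed in opposite directions coincide, the interior of an
arc passes through no vertex point, and the interiors of arcs of distinct edges are
disjoint. -/
def SimpleGraph.HasPlanarEmbedding {V : Type*} (G : SimpleGraph V) : Prop :=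
  ∃ (pos : V → ℝ × ℝ) (arc : V → V → ℝ → ℝ × ℝ),
    Function.Injective pos ∧
    (∀ u v : V, G.Adj u v →
      ContinuousOn (arc u v) (Set.Icc (0 : ℝ) 1) ∧
      Set.InjOn (arc u v) (Set.Icc (0 : ℝ) 1) ∧
      arc u v 0 = pos u ∧
      arc u v 1 = pos v ∧
      (∀ t : ℝ, arc u v t = arc v u (1 - t)) ∧
      (∀ w : V, ∀ t ∈ Set.Ioo (0 : ℝ) 1, arc u v t ≠ pos w)) ∧
    (∀ u v x y : V, G.Adj u v → G.Adj x y → s(u, v) ≠ s(x, y) →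
      ∀ t₁ ∈ Set.Ioo (0 : ℝ) 1, ∀ t₂ ∈ Set.Ioo (0 : ℝ) 1, arc u v t₁ ≠ arc x y t₂)

/-- `G` contains a subgraph isomorphic to `F`, i.e. there is an injective graph
homomorphism from `F` to `G`. -/
def ContainsCopy {α β : Type*} (F : SimpleGraph α) (G : SimpleGraph β) : Prop :=
  ∃ f : F →g G, Function.Injective f

/-- The Theta graph on 4 vertices: the 4-cycle 0-1-2-3-0 plus the chord 02,
i.e. `K₄` minus one edge. -/
def theta4 : SimpleGraph (Fin 4) :=
  SimpleGraph.fromEdgeSet {s(0, 1), s(1, 2), s(2, 3), s(0, 3), s(0, 2)}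

/-- The Theta graph on 5 vertices: the 5-cycle 0-1-2-3-4-0 plus the chord 02. -/
def theta5 : SimpleGraph (Fin 5) :=
  SimpleGraph.fromEdgeSet {s(0, 1), s(1, 2), s(2, 3), s(3, 4), s(0, 4), s(0, 2)}

/-- The cycle on 6 vertices: 0-1-2-3-4-5-0. -/
def cycle6 : SimpleGraph (Fin 6) :=
  SimpleGraph.fromEdgeSet {s(0, 1), s(1, 2), s(2, 3), s(3, 4), s(4, 5), s(0, 5)}

/-- `G` contains no member of `Θ₆` as a subgraph: for each pair of distinct
non-consecutive vertices `a`, `b` of the 6-cycle, `G` contains no copy of the Theta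
graph obtained from the 6-cycle by adding the chord `ab`. -/
def Theta6Free {β : Type*} (G : SimpleGraph β) : Prop :=
  ∀ a b : Fin 6, a ≠ b → ¬ cycle6.Adj a b →
    ¬ ContainsCopy (cycle6 ⊔ SimpleGraph.fromEdgeSet {s(a, b)}) G

/-- `K₅⁻`: the complete graph on 5 vertices minus one edge. -/
def K5minus : SimpleGraph (Fin 5) :=
  (⊤ : SimpleGraph (Fin 5)).deleteEdges {s(0, 1)}

/-- Adjacency in the square grid `ℤ × ℤ`. -/
def GridAdj (p q : ℤ × ℤ) : Prop :=
  (p.1 = q.1 ∧ (q.2 = p.2 + 1 ∨ p.2 = q.2 + 1)) ∨ (p.2 = q.2 ∧ (q.1 = p.1 + 1 ∨ p.1 = q.1 + 1))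

theorem GridAdj.symm {p q : ℤ × ℤ} (h : GridAdj p q) : GridAdj q p := by
  unfold GridAdj at *; omega

/-- A grid step inside the set `S`. -/
def GridStep (S : Set (ℤ × ℤ)) (p q : ℤ × ℤ) : Prop := p ∈ S ∧ q ∈ S ∧ GridAdj p q

/-- `q` can be reached from `p` by grid steps inside `S`. -/
def GridReach (S : Set (ℤ × ℤ)) (p q : ℤ × ℤ) : Prop := Relation.ReflTransGen (GridStep S) p q

/-- `S` is connected in the square grid. -/
def GridConn (S : Set (ℤ × ℤ)) : Prop := ∀ p ∈ S, ∀ q ∈ S, GridReach S p q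

/-- `G` is a minor of the square grid: vertices have disjoint finite connected branch sets,
and adjacent vertices have adjacent branch sets. -/
def GridMinor {V : Type*} (G : SimpleGraph V) : Prop :=
  ∃ A : V → Finset (ℤ × ℤ),
    (∀ u v p, p ∈ A u → p ∈ A v → u = v) ∧
    (∀ v, GridConn (A v : Set (ℤ × ℤ))) ∧
    (∀ u v, G.Adj u v → ∃ p ∈ A u, ∃ q ∈ A v, GridAdj p q)

theorem GridStep.symm {S : Set (ℤ × ℤ)} {p q : ℤ × ℤ} (h : GridStep S p q) : GridStep S q p :=
  ⟨h.2.1, h.1, h.2.2.symm⟩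

theorem GridReach.symm {S : Set (ℤ × ℤ)} {p q : ℤ × ℤ} (h : GridReach S p q) :
    GridReach S q p := by
  induction h with
  | refl => exact Relation.ReflTransGen.refl
  | tail _ h2 ih => exact Relation.ReflTransGen.head h2.symm ih

theorem GridReach.trans {S : Set (ℤ × ℤ)} {p q r : ℤ × ℤ} (h : GridReach S p q)
    (h' : GridReach S q r) : GridReach S p r :=
  Relation.ReflTransGen.trans h h'

theorem GridReach.mono {S T : Set (ℤ × ℤ)} (hST : S ⊆ T) {p q : ℤ × ℤ} (h : GridReach S p q) :
    GridReach T p q :=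
  Relation.ReflTransGen.mono (fun _ _ h => ⟨hST h.1, hST h.2.1, h.2.2⟩) _ _ h

theorem GridMinor.comap {V W : Type*} {G : SimpleGraph V} {H : SimpleGraph W} (h : GridMinor G)
    (f : W → V) (hf : Function.Injective f) (hadj : ∀ u v, H.Adj u v → G.Adj (f u) (f v)) :
    GridMinor H := by
  obtain ⟨A, h1, h2, h3⟩ := h
  exact ⟨fun w => A (f w), fun u v p hu hv => hf (h1 _ _ p hu hv), fun v => h2 _,
    fun u v huv => h3 _ _ (hadj _ _ huv)⟩

/-- Branch sets for vertices and connecting sets for edges that only meet when incident. -/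
structure GridClusters {V : Type*} (G : SimpleGraph V) (A : V → Set (ℤ × ℤ))
    (C : V → V → Set (ℤ × ℤ)) : Prop where
  finA : ∀ v, (A v).Finite
  finC : ∀ u v, G.Adj u v → (C u v).Finite
  connA : ∀ v, GridConn (A v)
  connC : ∀ u v, G.Adj u v → GridConn (C u v)
  disjA : ∀ u v p, p ∈ A u → p ∈ A v → u = v
  disjAC : ∀ u v w p, G.Adj v w → p ∈ A u → p ∈ C v w → u = v ∨ u = w
  disjC : ∀ u v x y p, G.Adj u v → G.Adj x y → p ∈ C u v → p ∈ C x y → s(u, v) = s(x, y)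
  left : ∀ u v, G.Adj u v → ∃ p, p ∈ A u ∧ p ∈ C u v
  right : ∀ u v, G.Adj u v → ∃ p, p ∈ A v ∧ p ∈ C u v

theorem GridClusters.gridMinor {V : Type*} [Finite V] {G : SimpleGraph V} {A : V → Set (ℤ × ℤ)}
    {C : V → V → Set (ℤ × ℤ)} (h : GridClusters G A C) : GridMinor G := by
  classical
  obtain ⟨r, hr⟩ : ∃ r : V → ℕ, Function.Injective r := by
    obtain ⟨n, ⟨e⟩⟩ := Finite.exists_equiv_fin V
    exact ⟨fun v => (e v : ℕ), fun a b hab => e.injective (Fin.ext hab)⟩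
  set R : V → V → Set (ℤ × ℤ) := fun u w =>
    {p | ∃ a, a ∈ A u ∧ a ∈ C u w ∧ GridReach (C u w \ A w) a p} with hR
  have hRsub : ∀ u w p, p ∈ R u w → p ∈ A u ∨ p ∈ C u w \ A w := by
    rintro u w p ⟨a, ha, -, hp⟩
    rcases Relation.ReflTransGen.cases_tail hp with h1 | ⟨c, -, h2⟩
    · left; rw [h1]; exact ha
    · right; exact h2.2.1
  set B : V → Set (ℤ × ℤ) := fun u => A u ∪ ⋃ w ∈ {w | G.Adj u w ∧ r u < r w}, R u w with hB
  have memB : ∀ u p, p ∈ B u ↔ p ∈ A u ∨ ∃ w, G.Adj u w ∧ r u < r w ∧ p ∈ R u w := by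
    intro u p
    simp only [hB, Set.mem_union, Set.mem_iUnion, Set.mem_ofPred_eq, exists_prop, and_assoc]
  have memB' : ∀ u p, p ∈ B u → p ∈ A u ∨ ∃ w, G.Adj u w ∧ r u < r w ∧ p ∈ C u w \ A w := by
    intro u p hp
    rcases (memB u p).1 hp with h1 | ⟨w, h1, h2, h3⟩
    · exact Or.inl h1
    · rcases hRsub _ _ _ h3 with h4 | h4
      · exact Or.inl h4
      · exact Or.inr ⟨w, h1, h2, h4⟩
  have finB : ∀ u, (B u).Finite := by
    intro u
    refine Set.Finite.subset ((h.finA u).union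
      (Set.Finite.biUnion (Set.toFinite {w | G.Adj u w}) (fun w hw => h.finC u w hw))) ?_
    intro p hp
    rcases memB' u p hp with h1 | ⟨w, h1, -, h3⟩
    · exact Or.inl h1
    · exact Or.inr (Set.mem_biUnion h1 h3.1)
  refine ⟨fun u => (finB u).toFinset, ?_, ?_, ?_⟩
  · intro u v p hu hv
    rw [Set.Finite.mem_toFinset] at hu hv
    rcases memB' u p hu with h1 | ⟨w, h1, h2, h3⟩ <;>
      rcases memB' v p hv with h1' | ⟨w', h1', h2', h3'⟩
    · exact h.disjA _ _ _ h1 h1'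
    · rcases h.disjAC _ _ _ _ h1' h1 h3'.1 with e | e
      · exact e
      · subst e; exact absurd h1 h3'.2
    · rcases h.disjAC _ _ _ _ h1 h1' h3.1 with e | e
      · exact e.symm
      · subst e; exact absurd h1' h3.2
    · have := h.disjC _ _ _ _ _ h1 h1' h3.1 h3'.1
      rcases Sym2.eq_iff.1 this with ⟨e, -⟩ | ⟨e1, e2⟩
      · exact e
      · subst e1; subst e2; omega
  · intro u
    rw [Set.Finite.coe_toFinset]
    have key : ∀ p ∈ B u, ∃ a ∈ A u, GridReach (B u) a p := by
      intro p hp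
      rcases (memB u p).1 hp with h1 | ⟨w, h1, h2, a, ha, haC, h3⟩
      · exact ⟨p, h1, Relation.ReflTransGen.refl⟩
      · refine ⟨a, ha, ?_⟩
        clear hp
        induction h3 with
        | refl => exact Relation.ReflTransGen.refl
        | tail h4 h5 ih =>
          refine Relation.ReflTransGen.tail ih ⟨?_, ?_, h5.2.2⟩
          · exact (memB _ _).2 (Or.inr ⟨w, h1, h2, a, ha, haC, h4⟩)
          · exact (memB _ _).2 (Or.inr ⟨w, h1, h2, a, ha, haC, h4.tail h5⟩)
    intro p hp q hq
    obtain ⟨a, ha, hap⟩ := key p hp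
    obtain ⟨b, hb, hbq⟩ := key q hq
    exact hap.symm.trans (((h.connA u a ha b hb).mono Set.subset_union_left).trans hbq)
  · have key : ∀ u v, G.Adj u v → r u < r v → ∃ p ∈ B u, ∃ q ∈ B v, GridAdj p q := by
      intro u v huv hlt
      obtain ⟨a, ha, haC⟩ := h.left u v huv
      obtain ⟨b, hb, hbC⟩ := h.right u v huv
      have claim : ∀ q, GridReach (C u v) a q →
          (GridReach (C u v \ A v) a q ∧ q ∉ A v) ∨ ∃ p ∈ R u v, ∃ q ∈ A v, GridAdj p q := by
        intro q hq
        induction hq with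
        | refl => exact Or.inl ⟨Relation.ReflTransGen.refl, fun h' => huv.ne (h.disjA _ _ _ ha h')⟩
        | @tail x y h4 h5 ih =>
          rcases ih with ⟨ih, hx⟩ | ih
          · by_cases hy : y ∈ A v
            · exact Or.inr ⟨x, ⟨a, ha, haC, ih⟩, y, hy, h5.2.2⟩
            · exact Or.inl ⟨ih.tail ⟨⟨h5.1, hx⟩, ⟨h5.2.1, hy⟩, h5.2.2⟩, hy⟩
          · exact Or.inr ih
      rcases claim b (h.connC u v huv a haC b hbC) with ⟨-, h1⟩ | ⟨p, hp, q, hq, hpq⟩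
      · exact absurd hb h1
      · exact ⟨p, (memB _ _).2 (Or.inr ⟨v, huv, hlt, hp⟩), q, (memB _ _).2 (Or.inl hq), hpq⟩
    intro u v huv
    simp only [Set.Finite.mem_toFinset]
    rcases lt_trichotomy (r u) (r v) with h1 | h1 | h1
    · exact key u v huv h1
    · exact absurd (hr h1) huv.ne
    · obtain ⟨p, hp, q, hq, hpq⟩ := key v u huv.symm h1
      exact ⟨q, hq, p, hp, hpq.symm⟩

/-- The grid points whose `η`-scaled copy is `η`-close (in each coordinate) to `K`. -/
def latticeHull (η : ℝ) (K : Set (ℝ × ℝ)) : Set (ℤ × ℤ) :=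
  {p | ∃ k ∈ K, |η * p.1 - k.1| ≤ η ∧ |η * p.2 - k.2| ≤ η}

theorem latticeHull_mono {η : ℝ} {K L : Set (ℝ × ℝ)} (h : K ⊆ L) :
    latticeHull η K ⊆ latticeHull η L := fun _ ⟨k, hk, hp⟩ => ⟨k, h hk, hp⟩

theorem gridReach_row {S : Set (ℤ × ℤ)} (a c : ℤ) (n : ℕ)
    (h : ∀ x, a ≤ x → x ≤ a + n → (x, c) ∈ S) : GridReach S (a, c) (a + n, c) := by
  induction n with
  | zero => simp only [Nat.cast_zero, add_zero]; exact Relation.ReflTransGen.refl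
  | succ n ih =>
    refine Relation.ReflTransGen.tail (ih fun x h1 h2 => h x h1 (by push_cast; omega)) ⟨?_, ?_, ?_⟩
    · exact h _ (by omega) (by push_cast; omega)
    · exact h _ (by omega) (by push_cast; omega)
    · unfold GridAdj; push_cast; right; exact ⟨rfl, Or.inl (by ring)⟩

theorem gridReach_col {S : Set (ℤ × ℤ)} (a c : ℤ) (n : ℕ)
    (h : ∀ x, c ≤ x → x ≤ c + n → (a, x) ∈ S) : GridReach S (a, c) (a, c + n) := by
  induction n with
  | zero => simp only [Nat.cast_zero, add_zero]; exact Relation.ReflTransGen.refl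
  | succ n ih =>
    refine Relation.ReflTransGen.tail (ih fun x h1 h2 => h x h1 (by push_cast; omega)) ⟨?_, ?_, ?_⟩
    · exact h _ (by omega) (by push_cast; omega)
    · exact h _ (by omega) (by push_cast; omega)
    · unfold GridAdj; push_cast; left; exact ⟨rfl, Or.inl (by ring)⟩

theorem gridConn_of_convex {S T : Set (ℤ × ℤ)} (hST : T ⊆ S)
    (hT : ∀ p ∈ T, ∀ q ∈ T, ∀ x y, min p.1 q.1 ≤ x → x ≤ max p.1 q.1 → min p.2 q.2 ≤ y →
      y ≤ max p.2 q.2 → (x, y) ∈ T) : ∀ p ∈ T, ∀ q ∈ T, GridReach S p q := by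
  rintro ⟨a, c⟩ hp ⟨b, d⟩ hq
  have key := hT _ hp _ hq
  simp only at key
  have h1 : GridReach S (a, c) (b, c) := by
    rcases le_total a b with h | h
    · have := gridReach_row (S := S) a c (b - a).toNat
        (fun x h1 h2 => hST (key x c (by omega) (by omega) (by omega) (by omega)))
      rwa [show a + ((b - a).toNat : ℤ) = b by omega] at this
    · have := gridReach_row (S := S) b c (a - b).toNat
        (fun x h1 h2 => hST (key x c (by omega) (by omega) (by omega) (by omega)))
      rw [show b + ((a - b).toNat : ℤ) = a by omega] at this
      exact this.symm
  have h2 : GridReach S (b, c) (b, d) := by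
    rcases le_total c d with h | h
    · have := gridReach_col (S := S) b c (d - c).toNat
        (fun x h1 h2 => hST (key b x (by omega) (by omega) (by omega) (by omega)))
      rwa [show c + ((d - c).toNat : ℤ) = d by omega] at this
    · have := gridReach_col (S := S) b d (c - d).toNat
        (fun x h1 h2 => hST (key b x (by omega) (by omega) (by omega) (by omega)))
      rw [show d + ((c - d).toNat : ℤ) = c by omega] at this
      exact this.symm
  exact h1.trans h2

theorem gridReach_latticeHull_point {η : ℝ} (hη : 0 < η) {S : Set (ℤ × ℤ)} (k : ℝ × ℝ)
    (hS : latticeHull η {k} ⊆ S) :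
    ∀ p ∈ latticeHull η {k}, ∀ q ∈ latticeHull η {k}, GridReach S p q := by
  refine gridConn_of_convex hS ?_
  rintro p ⟨k', rfl, hp1, hp2⟩ q ⟨k'', h, hq1, hq2⟩ x y h1 h2 h3 h4
  rw [Set.mem_singleton_iff] at h
  subst h
  have aux : ∀ (a b x : ℤ) (t : ℝ), |η * a - t| ≤ η → |η * b - t| ≤ η → min a b ≤ x → x ≤ max a b →
      |η * x - t| ≤ η := by
    intro a b x t ha hb h1 h2
    rw [abs_le] at ha hb ⊢
    have h1' : (min a b : ℝ) ≤ x := by exact_mod_cast h1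
    have h2' : (x : ℝ) ≤ max (a : ℝ) (b : ℝ) := by exact_mod_cast h2
    rcases le_total (a : ℝ) b with h | h
    · rw [min_eq_left h] at h1'; rw [max_eq_right h] at h2'
      constructor <;> nlinarith
    · rw [min_eq_right h] at h1'; rw [max_eq_left h] at h2'
      constructor <;> nlinarith
  exact ⟨_, rfl, aux _ _ _ _ hp1 hq1 h1 h2, aux _ _ _ _ hp2 hq2 h3 h4⟩

theorem exists_int_close {η : ℝ} (hη : 0 < η) (s t : ℝ) (h : |s - t| ≤ η) :
    ∃ a : ℤ, |η * a - s| ≤ η ∧ |η * a - t| ≤ η := by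
  obtain ⟨m, hm⟩ : ∃ m, m = min s t := ⟨_, rfl⟩
  have h0 := Int.ceil_lt_add_one (m / η)
  have h0' := Int.le_ceil (m / η)
  refine ⟨⌈m / η⌉, ?_⟩
  rw [div_le_iff₀ hη] at h0'
  have h1 : (⌈m / η⌉ : ℝ) * η < m + η := by
    have := mul_lt_mul_of_pos_right h0 hη
    rwa [add_mul, div_mul_cancel₀ _ hη.ne', one_mul] at this
  rw [abs_le] at h
  simp only [abs_le]
  rcases le_total s t with h2 | h2
  · rw [min_eq_left h2] at hm
    subst hm
    refine ⟨⟨?_, ?_⟩, ?_, ?_⟩ <;> linarith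
  · rw [min_eq_right h2] at hm
    subst hm
    refine ⟨⟨?_, ?_⟩, ?_, ?_⟩ <;> linarith

theorem latticeHull_inter_nonempty {η : ℝ} (hη : 0 < η) (k l : ℝ × ℝ) (h : dist k l ≤ η) :
    ∃ p, p ∈ latticeHull η {k} ∧ p ∈ latticeHull η {l} := by
  rw [Prod.dist_eq, max_le_iff, Real.dist_eq, Real.dist_eq] at h
  obtain ⟨a, ha, ha'⟩ := exists_int_close hη _ _ h.1
  obtain ⟨b, hb, hb'⟩ := exists_int_close hη _ _ h.2
  exact ⟨(a, b), ⟨k, rfl, ha, hb⟩, ⟨l, rfl, ha', hb'⟩⟩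

theorem mem_latticeHull_iff {η : ℝ} {K : Set (ℝ × ℝ)} {p : ℤ × ℤ} :
    p ∈ latticeHull η K ↔ ∃ k ∈ K, p ∈ latticeHull η {k} := by
  simp only [latticeHull, Set.mem_ofPred_eq, Set.mem_singleton_iff, exists_eq_left]

/-- The lattice hull of a path image is connected. -/
theorem gridConn_latticeHull_path {η : ℝ} (hη : 0 < η) (γ : ℝ → ℝ × ℝ) (a b : ℝ)
    (hγ : ContinuousOn γ (Set.Icc a b)) : GridConn (latticeHull η (γ '' Set.Icc a b)) := by
  set S := latticeHull η (γ '' Set.Icc a b) with hS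
  have hsub : ∀ s ∈ Set.Icc a b, latticeHull η {γ s} ⊆ S := fun s hs =>
    latticeHull_mono (by rintro _ rfl; exact ⟨s, hs, rfl⟩)
  have key : ∀ s ∈ Set.Icc a b, ∀ t ∈ Set.Icc a b,
      ∀ p ∈ latticeHull η {γ s}, ∀ q ∈ latticeHull η {γ t}, GridReach S p q := by
    intro s hs t ht
    refine isPreconnected_Icc.induction₂ (s := Set.Icc a b) (fun s t => s ∈ Set.Icc a b →
      t ∈ Set.Icc a b → ∀ p ∈ latticeHull η {γ s}, ∀ q ∈ latticeHull η {γ t}, GridReach S p q)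
      ?_ ?_ ?_ hs ht hs ht
    · intro x hx
      have := (hγ x hx).eventually (Metric.closedBall_mem_nhds (γ x) hη)
      filter_upwards [this] with y hy hx' hy' p hp q hq
      obtain ⟨r, hr, hr'⟩ := latticeHull_inter_nonempty hη (γ y) (γ x) hy
      exact (gridReach_latticeHull_point hη _ (hsub x hx) p hp r hr').trans
        (gridReach_latticeHull_point hη _ (hsub y hy') r hr q hq)
    · intro x y z hx hy hz h1 h2 _ _ p hp q hq
      obtain ⟨r, hr, hr'⟩ := latticeHull_inter_nonempty hη (γ y) (γ y) (by simpa using hη.le)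
      exact (h1 hx hy p hp r hr).trans (h2 hy hz r hr q hq)
    · intro x y hx hy h1 _ _ p hp q hq
      exact (h1 hx hy q hq p hp).symm
  intro p hp q hq
  obtain ⟨_, ⟨s, hs, rfl⟩, hp⟩ := mem_latticeHull_iff.1 hp
  obtain ⟨_, ⟨t, ht, rfl⟩, hq⟩ := mem_latticeHull_iff.1 hq
  exact key s hs t ht p hp q hq

theorem latticeHull_finite {η : ℝ} (hη : 0 < η) {K : Set (ℝ × ℝ)} (hK : Bornology.IsBounded K) :
    (latticeHull η K).Finite := by
  obtain ⟨R, hR⟩ := hK.subset_closedBall 0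
  obtain ⟨N, hN⟩ := exists_nat_gt ((R + η) / η)
  rw [div_lt_iff₀ hη] at hN
  refine Set.Finite.subset (Set.finite_Icc ((-N : ℤ), (-N : ℤ)) ((N : ℤ), (N : ℤ))) ?_
  rintro p ⟨k, hk, h1, h2⟩
  have h3 := hR hk
  rw [mem_closedBall_zero_iff, Prod.norm_def, max_le_iff, Real.norm_eq_abs, Real.norm_eq_abs] at h3
  have aux : ∀ (a : ℤ) (t : ℝ), |η * a - t| ≤ η → |t| ≤ R → -N ≤ a ∧ a ≤ N := by
    intro a t h1 h2
    rw [abs_le] at h1 h2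
    constructor
    · have : (-N : ℝ) ≤ a := by
        by_contra hc
        push Not at hc
        nlinarith
      exact_mod_cast this
    · have : (a : ℝ) ≤ N := by
        by_contra hc
        push Not at hc
        nlinarith
      exact_mod_cast this
  have ha := aux _ _ h1 h3.1
  have hb := aux _ _ h2 h3.2
  exact ⟨⟨ha.1, hb.1⟩, ⟨ha.2, hb.2⟩⟩

theorem dist_le_of_mem_latticeHull {η : ℝ} {K L : Set (ℝ × ℝ)} {p : ℤ × ℤ}
    (hK : p ∈ latticeHull η K) (hL : p ∈ latticeHull η L) : ∃ k ∈ K, ∃ l ∈ L, dist k l ≤ 2 * η := by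
  obtain ⟨k, hk, h1, h2⟩ := hK
  obtain ⟨l, hl, h3, h4⟩ := hL
  refine ⟨k, hk, l, hl, ?_⟩
  rw [Prod.dist_eq, max_le_iff, Real.dist_eq, Real.dist_eq]
  rw [abs_le] at *
  rw [abs_le]
  refine ⟨⟨?_, ?_⟩, ?_, ?_⟩ <;> linarith

theorem exists_uniform_separation {I X : Type*} [Finite I] [MetricSpace X] (K : I → Set X)
    (hK : ∀ i, IsCompact (K i)) :
    ∃ δ > 0, ∀ i j, Disjoint (K i) (K j) → ∀ k ∈ K i, ∀ l ∈ K j, δ ≤ dist k l := by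
  classical
  have h1 : ∀ p : I × I, ∃ δ > 0, Disjoint (K p.1) (K p.2) →
      ∀ k ∈ K p.1, ∀ l ∈ K p.2, δ ≤ dist k l := by
    rintro ⟨i, j⟩
    by_cases hd : Disjoint (K i) (K j)
    · obtain ⟨r, hr, h⟩ := Metric.exists_pos_forall_lt_edist (hK i) (hK j).isClosed hd
      refine ⟨r, by exact_mod_cast hr, fun _ k hk l hl => ?_⟩
      have := (h k hk l hl).le
      rw [edist_nndist] at this
      exact_mod_cast this
    · exact ⟨1, one_pos, fun h => absurd h hd⟩
  choose δ hδ h using h1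
  rcases isEmpty_or_nonempty (I × I) with he | he
  · exact ⟨1, one_pos, fun i j => (he.false (i, j)).elim⟩
  · obtain ⟨p, hp⟩ := Finite.exists_min δ
    exact ⟨δ p, hδ p, fun i j hd k hk l hl => (hp (i, j)).trans (h (i, j) hd k hk l hl)⟩

theorem SimpleGraph.HasPlanarEmbedding.gridMinor {V : Type*} [Finite V] {G : SimpleGraph V}
    (h : G.HasPlanarEmbedding) : GridMinor G := by
  classical
  obtain ⟨pos, arc, hpos, harc, hcross⟩ := h
  have sub1 : Set.Icc (0 : ℝ) (1 / 3) ⊆ Set.Icc 0 1 := Set.Icc_subset_Icc le_rfl (by norm_num)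
  have sub2 : Set.Icc (1 / 3 : ℝ) (2 / 3) ⊆ Set.Icc 0 1 :=
    Set.Icc_subset_Icc (by norm_num) (by norm_num)
  have hcont : ∀ u v, G.Adj u v → ContinuousOn (arc u v) (Set.Icc 0 1) :=
    fun u v huv => (harc u v huv).1
  set K : V → Set (ℝ × ℝ) := fun v =>
    {pos v} ∪ ⋃ w ∈ {w | G.Adj v w}, arc v w '' Set.Icc (0 : ℝ) (1 / 3) with hKdef
  set L : V → V → Set (ℝ × ℝ) := fun u v => arc u v '' Set.Icc (1 / 3 : ℝ) (2 / 3) with hLdef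
  have hKc : ∀ v, IsCompact (K v) := fun v => isCompact_singleton.union
    ((Set.toFinite {w | G.Adj v w}).isCompact_biUnion fun w hw =>
      isCompact_Icc.image_of_continuousOn ((hcont v w hw).mono sub1))
  have hLc : ∀ u v, G.Adj u v → IsCompact (L u v) := fun u v huv =>
    isCompact_Icc.image_of_continuousOn ((hcont u v huv).mono sub2)
  have memK : ∀ v p, p ∈ K v → p = pos v ∨
      ∃ w, G.Adj v w ∧ ∃ t, 0 < t ∧ t ≤ 1 / 3 ∧ arc v w t = p := by
    intro v p hp
    simp only [hKdef, Set.mem_union, Set.mem_singleton_iff, Set.mem_iUnion] at hp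
    rcases hp with hp | ⟨w, hw, t, ht, rfl⟩
    · exact Or.inl hp
    · rcases ht.1.eq_or_lt with h0 | h0
      · subst h0; exact Or.inl (harc v w hw).2.2.1
      · exact Or.inr ⟨w, hw, t, h0, ht.2, rfl⟩
  have avoid : ∀ u v, G.Adj u v → ∀ w, ∀ t, 0 < t → t < 1 → arc u v t ≠ pos w :=
    fun u v huv w t h0 h1 => (harc u v huv).2.2.2.2.2 w t ⟨h0, h1⟩
  have meet : ∀ u v x y, G.Adj u v → G.Adj x y → ∀ s t, 0 < s → s < 1 → 0 < t → t < 1 →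
      arc u v s = arc x y t → (u = x ∧ v = y ∧ s = t) ∨ (u = y ∧ v = x ∧ s = 1 - t) := by
    intro u v x y huv hxy s t hs0 hs1 ht0 ht1 he
    by_cases hne : s(u, v) = s(x, y)
    · rcases Sym2.eq_iff.1 hne with ⟨rfl, rfl⟩ | ⟨rfl, rfl⟩
      · exact Or.inl ⟨rfl, rfl, (harc u v huv).2.1 ⟨hs0.le, hs1.le⟩ ⟨ht0.le, ht1.le⟩ he⟩
      · refine Or.inr ⟨rfl, rfl, ?_⟩
        rw [(harc v u hxy).2.2.2.2.1 t] at he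
        exact (harc u v huv).2.1 ⟨hs0.le, hs1.le⟩ ⟨by linarith, by linarith⟩ he
    · exact absurd he (hcross u v x y huv hxy hne s ⟨hs0, hs1⟩ t ⟨ht0, ht1⟩)
  have dK : ∀ u v, u ≠ v → Disjoint (K u) (K v) := by
    intro u v huv
    rw [Set.disjoint_left]
    intro p hp hq
    rcases memK _ _ hp with h1 | ⟨w, hw, t, ht0, ht1, ht⟩ <;>
      rcases memK _ _ hq with h2 | ⟨w', hw', t', ht0', ht1', ht'⟩
    · exact huv (hpos (h1.symm.trans h2))
    · exact avoid _ _ hw' u t' ht0' (by linarith) (ht'.trans h1)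
    · exact avoid _ _ hw v t ht0 (by linarith) (ht.trans h2)
    · rcases meet _ _ _ _ hw hw' t t' ht0 (by linarith) ht0' (by linarith) (ht.trans ht'.symm) with
        ⟨h, -⟩ | ⟨-, -, h⟩
      · exact huv h
      · linarith
  have dKL : ∀ u v w, G.Adj v w → u ≠ v → u ≠ w → Disjoint (K u) (L v w) := by
    intro u v w hvw h1 h2
    rw [Set.disjoint_left]
    rintro p hp ⟨t', ht', rfl⟩
    rcases memK _ _ hp with h3 | ⟨x, hx, t, ht0, ht1, ht⟩
    · exact avoid _ _ hvw u t' (by linarith [ht'.1]) (by linarith [ht'.2]) h3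
    · rcases meet _ _ _ _ hx hvw t t' ht0 (by linarith) (by linarith [ht'.1])
        (by linarith [ht'.2]) ht with ⟨h, -⟩ | ⟨h, -⟩
      · exact h1 h
      · exact h2 h
  have dL : ∀ u v x y, G.Adj u v → G.Adj x y → s(u, v) ≠ s(x, y) → Disjoint (L u v) (L x y) := by
    intro u v x y huv hxy hne
    rw [Set.disjoint_left]
    rintro p ⟨t, ht, rfl⟩ ⟨t', ht', h⟩
    rcases meet _ _ _ _ hxy huv t' t (by linarith [ht'.1]) (by linarith [ht'.2])
      (by linarith [ht.1]) (by linarith [ht.2]) h with ⟨rfl, rfl, -⟩ | ⟨rfl, rfl, -⟩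
    · exact hne rfl
    · exact hne Sym2.eq_swap
  obtain ⟨δ, hδ, hsep⟩ := exists_uniform_separation (I := V ⊕ V × V)
    (fun i => Sum.elim K (fun p => if G.Adj p.1 p.2 then L p.1 p.2 else ∅) i) (by
      rintro (v | ⟨u, v⟩)
      · exact hKc v
      · by_cases huv : G.Adj u v
        · simpa [huv] using hLc u v huv
        · simp [huv])
  set η := δ / 3 with hηdef
  have hη : 0 < η := by positivity
  have sep : ∀ i j : V ⊕ V × V,
      Disjoint (Sum.elim K (fun p => if G.Adj p.1 p.2 then L p.1 p.2 else ∅) i)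
        (Sum.elim K (fun p => if G.Adj p.1 p.2 then L p.1 p.2 else ∅) j) →
      ∀ p, p ∈ latticeHull η (Sum.elim K (fun p => if G.Adj p.1 p.2 then L p.1 p.2 else ∅) i) →
        p ∈ latticeHull η (Sum.elim K (fun p => if G.Adj p.1 p.2 then L p.1 p.2 else ∅) j) →
        False := by
    intro i j hij p hp hq
    obtain ⟨k, hk, l, hl, hkl⟩ := dist_le_of_mem_latticeHull hp hq
    have := hsep i j hij k hk l hl
    linarith
  have hullne : ∀ k : ℝ × ℝ, ∃ p, p ∈ latticeHull η {k} := fun k =>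
    let ⟨p, hp, _⟩ := latticeHull_inter_nonempty hη k k (by simpa using hη.le)
    ⟨p, hp⟩
  refine GridClusters.gridMinor (G := G) (A := fun v => latticeHull η (K v))
    (C := fun u v => latticeHull η (L u v)) ⟨?_, ?_, ?_, ?_, ?_, ?_, ?_, ?_, ?_⟩
  · exact fun v => latticeHull_finite hη (hKc v).isBounded
  · exact fun u v huv => latticeHull_finite hη (hLc u v huv).isBounded
  · intro v
    obtain ⟨a, ha⟩ := hullne (pos v)
    have key : ∀ p ∈ latticeHull η (K v), GridReach (latticeHull η (K v)) a p := by
      intro p hp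
      obtain ⟨k, hk, hp⟩ := mem_latticeHull_iff.1 hp
      simp only [hKdef, Set.mem_union, Set.mem_singleton_iff, Set.mem_iUnion] at hk
      rcases hk with hk | ⟨w, hw, hk⟩
      · subst hk
        exact gridReach_latticeHull_point hη (pos v)
          (latticeHull_mono (by intro x hx; exact Or.inl hx)) a ha p hp
      · refine (gridConn_latticeHull_path hη (arc v w) 0 (1 / 3) ((hcont v w hw).mono sub1) a ?_
          p ?_).mono (latticeHull_mono ?_)
        · refine latticeHull_mono ?_ ha
          rintro _ rfl
          exact ⟨0, ⟨le_rfl, by norm_num⟩, (harc v w hw).2.2.1⟩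
        · exact latticeHull_mono (by rintro _ rfl; exact hk) hp
        · intro x hx
          exact Or.inr (Set.mem_biUnion (show w ∈ {w | G.Adj v w} from hw) hx)
    exact fun p hp q hq => (key p hp).symm.trans (key q hq)
  · exact fun u v huv => gridConn_latticeHull_path hη _ _ _ ((hcont u v huv).mono sub2)
  · intro u v p hp hq
    by_contra hne
    exact sep (Sum.inl u) (Sum.inl v) (dK u v hne) p hp hq
  · intro u v w p hvw hp hq
    by_contra hne
    push Not at hne
    refine sep (Sum.inl u) (Sum.inr (v, w)) ?_ p hp ?_
    · simpa [hvw] using dKL u v w hvw hne.1 hne.2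
    · simpa [hvw] using hq
  · intro u v x y p huv hxy hp hq
    by_contra hne
    refine sep (Sum.inr (u, v)) (Sum.inr (x, y)) ?_ p ?_ ?_
    · simpa [huv, hxy] using dL u v x y huv hxy hne
    · simpa [huv] using hp
    · simpa [hxy] using hq
  · intro u v huv
    obtain ⟨p, hp⟩ := hullne (arc u v (1 / 3))
    refine ⟨p, latticeHull_mono ?_ hp, latticeHull_mono ?_ hp⟩
    · rintro _ rfl
      exact Or.inr (Set.mem_biUnion (show v ∈ {w | G.Adj u w} from huv)
        ⟨1 / 3, ⟨by norm_num, le_rfl⟩, rfl⟩)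
    · rintro _ rfl
      exact ⟨1 / 3, ⟨le_rfl, by norm_num⟩, rfl⟩
  · intro u v huv
    obtain ⟨p, hp⟩ := hullne (arc u v (2 / 3))
    refine ⟨p, latticeHull_mono ?_ hp, latticeHull_mono ?_ hp⟩
    · rintro _ rfl
      refine Or.inr (Set.mem_biUnion (show u ∈ {w | G.Adj v w} from huv.symm)
        ⟨1 / 3, ⟨by norm_num, le_rfl⟩, ?_⟩)
      rw [(harc v u huv.symm).2.2.2.2.1]
      norm_num
    · rintro _ rfl
      exact ⟨2 / 3, ⟨by norm_num, le_rfl⟩, rfl⟩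

/-- The unit square to the left of the directed grid edge from `x` to `y`, indexed by its lower
left corner. -/
def leftSquare (x y : ℤ × ℤ) : ℤ × ℤ :=
  if y = (x.1 + 1, x.2) then x
  else if y = (x.1 - 1, x.2) then (x.1 - 1, x.2 - 1)
  else if y = (x.1, x.2 + 1) then (x.1 - 1, x.2)
  else (x.1, x.2 - 1)

theorem leftSquare_east (a b : ℤ) : leftSquare (a, b) (a + 1, b) = (a, b) := by
  simp [leftSquare]

theorem leftSquare_west (a b : ℤ) : leftSquare (a, b) (a - 1, b) = (a - 1, b - 1) := by
  have : ¬ (a - 1 = a + 1) := by omega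
  simp [leftSquare, this]

theorem leftSquare_north (a b : ℤ) : leftSquare (a, b) (a, b + 1) = (a - 1, b) := by
  simp [leftSquare]

theorem leftSquare_south (a b : ℤ) : leftSquare (a, b) (a, b - 1) = (a, b - 1) := by
  have h1 : ¬ (b - 1 = b + 1) := by omega
  simp [leftSquare, h1]

/-- The four grid neighbours of a point. -/
def gridNbrs (x : ℤ × ℤ) : Finset (ℤ × ℤ) :=
  {(x.1 + 1, x.2), (x.1 - 1, x.2), (x.1, x.2 + 1), (x.1, x.2 - 1)}

theorem mem_gridNbrs {x y : ℤ × ℤ} : y ∈ gridNbrs x ↔ GridAdj x y := by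
  obtain ⟨a, b⟩ := x
  obtain ⟨c, d⟩ := y
  simp only [gridNbrs, GridAdj, Finset.mem_insert, Finset.mem_singleton, Prod.mk.injEq]
  omega

theorem sum_gridNbrs {M : Type*} [AddCommMonoid M] (a b : ℤ) (f : ℤ × ℤ → M) :
    ∑ y ∈ gridNbrs (a, b), f y = f (a + 1, b) + (f (a - 1, b) + (f (a, b + 1) + f (a, b - 1))) := by
  rw [gridNbrs, Finset.sum_insert, Finset.sum_insert, Finset.sum_insert, Finset.sum_singleton]
  all_goals
    simp only [Finset.mem_insert, Finset.mem_singleton, Prod.mk.injEq]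
    omega

theorem ZMod.two_add_self (a : ZMod 2) : a + a = 0 := CharTwo.add_self_eq_zero a

theorem sum_leftSquare (φ : ℤ × ℤ → ZMod 2) (x : ℤ × ℤ) :
    ∑ y ∈ gridNbrs x, (φ (leftSquare x y) + φ (leftSquare y x)) = 0 := by
  obtain ⟨a, b⟩ := x
  rw [sum_gridNbrs, leftSquare_east, leftSquare_west, leftSquare_north, leftSquare_south]
  have e1 := leftSquare_west (a + 1) b
  have e2 := leftSquare_east (a - 1) b
  have e3 := leftSquare_south a (b + 1)
  have e4 := leftSquare_north a (b - 1)
  rw [show a - 1 + 1 = a by ring] at e2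
  rw [show b - 1 + 1 = b by ring] at e4
  rw [show a + 1 - 1 = a by ring] at e1
  rw [show b + 1 - 1 = b by ring] at e3
  rw [e1, e2, e3, e4]
  have : ∀ p q r s : ZMod 2, p + q + (r + s + (s + p + (q + r))) = 0 := by decide
  exact this _ _ _ _

/-- Every even chain of grid edges is a boundary. -/
theorem exists_grid_potential (c : ℤ × ℤ → ℤ × ℤ → ZMod 2) (hsymm : ∀ x y, c x y = c y x)
    (M : ℤ) (hM : ∀ x y, x.2 < M → c x y = 0) (heven : ∀ x, ∑ y ∈ gridNbrs x, c x y = 0) :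
    ∃ w : ℤ × ℤ → ZMod 2, ∀ x y, GridAdj x y → c x y = w (leftSquare x y) + w (leftSquare y x) := by
  set w : ℤ × ℤ → ZMod 2 := fun s => ∑ k ∈ Finset.Icc M s.2, c (s.1, k) (s.1 + 1, k) with hw
  have hlow : ∀ i j, j < M → w (i, j) = 0 := by
    intro i j hj
    simp only [hw]
    rw [Finset.Icc_eq_empty (by simpa using hj), Finset.sum_empty]
  have hstep : ∀ i j, w (i, j) = w (i, j - 1) + c (i, j) (i + 1, j) := by
    intro i j
    rcases lt_or_ge j M with hj | hj
    · rw [hlow _ _ hj, hlow _ _ (by omega), hM _ _ hj, add_zero]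
    · simp only [hw]
      rw [← Finset.insert_Icc_sub_one_right_eq_Icc hj, Finset.sum_insert (by simp), add_comm]
  have hvert' : ∀ (n : ℕ) i, w (i, M - 1 + n) + w (i - 1, M - 1 + n) =
      c (i, M - 1 + n) (i, M - 1 + n + 1) := by
    intro n
    induction n with
    | zero =>
      intro i
      rw [hlow _ _ (by simp), hlow _ _ (by simp), hM _ _ (by simp), add_zero]
    | succ n ih =>
      intro i
      have e : M - 1 + ((n + 1 : ℕ) : ℤ) - 1 = M - 1 + n := by push_cast; ring
      have h1 := heven (i, M - 1 + ((n + 1 : ℕ) : ℤ))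
      rw [sum_gridNbrs] at h1
      rw [hstep i, hstep (i - 1), e]
      rw [e] at h1
      have h2 := ih i
      rw [hsymm (i, M - 1 + (n : ℤ))] at h2
      rw [show M - 1 + (n : ℤ) + 1 = M - 1 + ((n + 1 : ℕ) : ℤ) by push_cast; ring] at h2
      rw [show i - 1 + 1 = i by ring]
      rw [hsymm (i, M - 1 + ((n + 1 : ℕ) : ℤ)) (i - 1, _)] at h1
      generalize c (i, M - 1 + ((n + 1 : ℕ) : ℤ)) (i + 1, _) = p1 at *
      generalize c (i - 1, M - 1 + ((n + 1 : ℕ) : ℤ)) (i, _) = p2 at *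
      generalize c (i, M - 1 + ((n + 1 : ℕ) : ℤ)) (i, M - 1 + (n : ℤ)) = p3 at *
      generalize c (i, M - 1 + ((n + 1 : ℕ) : ℤ)) _ = p4 at *
      generalize w (i, M - 1 + (n : ℤ)) = p5 at *
      generalize w (i - 1, M - 1 + (n : ℤ)) = p6 at *
      revert h1 h2
      revert p1 p2 p3 p4 p5 p6
      decide
  have hvert : ∀ i j, w (i, j) + w (i - 1, j) = c (i, j) (i, j + 1) := by
    intro i j
    rcases lt_or_ge j (M - 1) with hj | hj
    · rw [hlow _ _ (by omega), hlow _ _ (by omega), hM _ _ (by simpa using by omega), add_zero]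
    · have := hvert' (j - (M - 1)).toNat i
      rwa [show M - 1 + ((j - (M - 1)).toNat : ℤ) = j by omega] at this
  have heast : ∀ i j, c (i, j) (i + 1, j) = w (leftSquare (i, j) (i + 1, j)) +
      w (leftSquare (i + 1, j) (i, j)) := by
    intro i j
    have e1 := leftSquare_west (i + 1) j
    rw [show i + 1 - 1 = i by ring] at e1
    rw [leftSquare_east, e1, hstep i j]
    generalize w (i, j - 1) = p
    generalize c (i, j) (i + 1, j) = q
    revert p q; decide
  have hnorth : ∀ i j, c (i, j) (i, j + 1) = w (leftSquare (i, j) (i, j + 1)) +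
      w (leftSquare (i, j + 1) (i, j)) := by
    intro i j
    have e1 := leftSquare_south i (j + 1)
    rw [show j + 1 - 1 = j by ring] at e1
    rw [leftSquare_north, e1, ← hvert i j, add_comm]
  refine ⟨w, ?_⟩
  rintro ⟨a, b⟩ ⟨a', b'⟩ h
  unfold GridAdj at h
  simp only at h
  rcases h with ⟨rfl, rfl | rfl⟩ | ⟨rfl, rfl | rfl⟩
  · exact hnorth _ _
  · rw [hsymm, hnorth, add_comm]
  · exact heast _ _
  · rw [hsymm, heast, add_comm]

/-- In a connected set, any two points bound a chain. -/
theorem exists_chain_of_gridReach (S : Finset (ℤ × ℤ)) (p q : ℤ × ℤ)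
    (h : GridReach (S : Set (ℤ × ℤ)) p q) :
    ∃ c : ℤ × ℤ → ℤ × ℤ → ZMod 2, (∀ x y, c x y = c y x) ∧
      (∀ x y, c x y ≠ 0 → x ∈ S ∧ y ∈ S ∧ GridAdj x y) ∧
      ∀ x, ∑ y ∈ gridNbrs x, c x y = (if x = p then 1 else 0) + (if x = q then 1 else 0) := by
  induction h with
  | refl =>
    exact ⟨fun _ _ => 0, fun _ _ => rfl, fun x y h => absurd rfl h, fun x => by
      rw [Finset.sum_const_zero, ZMod.two_add_self]⟩
  | @tail b d h1 h2 ih =>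
    obtain ⟨c, hc1, hc2, hc3⟩ := ih
    have hne : b ≠ d := by
      rintro rfl
      have := h2.2.2
      unfold GridAdj at this
      omega
    refine ⟨fun x y => c x y + ((if x = b ∧ y = d then 1 else 0) + if x = d ∧ y = b then 1 else 0),
      ?_, ?_, ?_⟩
    · intro x y
      simp only
      rw [hc1 x y, add_comm (if x = b ∧ y = d then (1 : ZMod 2) else 0)]
      simp only [and_comm]
    · intro x y hxy
      by_cases h0 : c x y = 0
      · by_cases h3 : x = b ∧ y = d
        · rw [h3.1, h3.2]; exact ⟨h2.1, h2.2.1, h2.2.2⟩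
        · by_cases h4 : x = d ∧ y = b
          · rw [h4.1, h4.2]; exact ⟨h2.2.1, h2.1, h2.2.2.symm⟩
          · simp [h0, h3, h4] at hxy
      · exact hc2 x y h0
    · intro x
      rw [Finset.sum_add_distrib, Finset.sum_add_distrib, hc3]
      have e1 : ∑ y ∈ gridNbrs x, (if x = b ∧ y = d then (1 : ZMod 2) else 0) =
          if x = b then 1 else 0 := by
        by_cases hx : x = b
        · subst hx
          simp only [true_and, if_true]
          rw [Finset.sum_ite_eq', if_pos (mem_gridNbrs.2 h2.2.2)]
        · simp [hx]
      have e2 : ∑ y ∈ gridNbrs x, (if x = d ∧ y = b then (1 : ZMod 2) else 0) =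
          if x = d then 1 else 0 := by
        by_cases hx : x = d
        · subst hx
          simp only [true_and, if_true]
          rw [Finset.sum_ite_eq', if_pos (mem_gridNbrs.2 h2.2.2.symm)]
        · simp [hx]
      rw [e1, e2]
      generalize (if x = p then (1 : ZMod 2) else 0) = p1
      generalize (if x = b then (1 : ZMod 2) else 0) = p2
      generalize (if x = d then (1 : ZMod 2) else 0) = p3
      revert p1 p2 p3; decide

open scoped Classical in
/-- `L u v` is the face to the left of the dart `(u, v)`: face boundaries are even, and every even
set of edges is a sum of face boundaries. -/
structure FaceSystem {V ι : Type*} [Fintype V] (G : SimpleGraph V) (L : V → V → ι) : Prop where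
  even : ∀ i v, ∑ w, (if G.Adj v w then
    ((if L v w = i then 1 else 0) + (if L w v = i then 1 else 0) : ZMod 2) else 0) = 0
  span : ∀ z : V → V → ZMod 2, (∀ u v, z u v = z v u) → (∀ u v, ¬ G.Adj u v → z u v = 0) →
    (∀ v, ∑ w, z v w = 0) → ∃ g : ι → ZMod 2, ∀ u v, G.Adj u v → z u v = g (L u v) + g (L v u)

theorem sum_symm_eq_zero {α : Type*} (s : Finset α) (F : α → α → ZMod 2)
    (h1 : ∀ x y, F x y = F y x) (h2 : ∀ x, F x x = 0) : ∑ x ∈ s, ∑ y ∈ s, F x y = 0 := by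
  rw [← Finset.sum_product']
  refine Finset.sum_involution (fun p _ => (p.2, p.1)) ?_ ?_ ?_ ?_
  · intro p _
    simp only
    rw [h1 p.2 p.1, ZMod.two_add_self]
  · intro p _ hp he
    have : p.2 = p.1 := congrArg Prod.fst he
    rw [this] at hp
    exact hp (h2 _)
  · intro p hp
    rw [Finset.mem_product] at hp ⊢
    exact ⟨hp.2, hp.1⟩
  · intro p _
    rfl

open scoped Classical in
theorem GridMinor.exists_faceSystem {V : Type*} [Fintype V] {G : SimpleGraph V}
    (h : GridMinor G) : ∃ (ι : Type) (_ : Fintype ι) (L : V → V → ι), FaceSystem G L := by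
  obtain ⟨A, hdisj, hconn, hadj⟩ := h
  have hX : ∃ X : V → V → ℤ × ℤ, ∀ u v, G.Adj u v →
      X u v ∈ A u ∧ X v u ∈ A v ∧ GridAdj (X u v) (X v u) := by
    obtain ⟨r, hr⟩ : ∃ r : V → ℕ, Function.Injective r := by
      obtain ⟨n, ⟨e⟩⟩ := Finite.exists_equiv_fin V
      exact ⟨fun v => (e v : ℕ), fun a b hab => e.injective (Fin.ext hab)⟩
    have : ∀ u v, ∃ p : (ℤ × ℤ) × (ℤ × ℤ), G.Adj u v → p.1 ∈ A u ∧ p.2 ∈ A v ∧ GridAdj p.1 p.2 := by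
      intro u v
      by_cases huv : G.Adj u v
      · obtain ⟨p, hp, q, hq, hpq⟩ := hadj u v huv
        exact ⟨(p, q), fun _ => ⟨hp, hq, hpq⟩⟩
      · exact ⟨default, fun h => absurd h huv⟩
    choose P hP using this
    refine ⟨fun u v => if r u < r v then (P u v).1 else (P v u).2, ?_⟩
    intro u v huv
    have hne : r u ≠ r v := fun h => huv.ne (hr h)
    rcases lt_or_gt_of_ne hne with h | h
    · simp only [h, if_true, not_lt_of_gt h, if_false]
      exact hP u v huv
    · simp only [h, if_true, not_lt_of_gt h, if_false]
      obtain ⟨h1, h2, h3⟩ := hP v u huv.symm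
      exact ⟨h2, h1, h3.symm⟩
  obtain ⟨X, hX⟩ := hX
  set kept : ℤ × ℤ → ℤ × ℤ → Prop := fun x y =>
    (∃ v, x ∈ A v ∧ y ∈ A v) ∨ ∃ u v, G.Adj u v ∧ x = X u v ∧ y = X v u with hkept
  set R : ℤ × ℤ → ℤ × ℤ → Prop := fun s t =>
    ∃ x y, GridAdj x y ∧ ¬ kept x y ∧ s = leftSquare x y ∧ t = leftSquare y x with hR
  set cl : ℤ × ℤ → Quot R := Quot.mk R with hcl
  set L0 : V → V → Quot R := fun u v => cl (leftSquare (X u v) (X v u)) with hL0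
  refine ⟨Set.range (fun p : V × V => L0 p.1 p.2), Fintype.ofFinite _,
    fun u v => ⟨L0 u v, Set.mem_range.2 ⟨(u, v), rfl⟩⟩, ⟨?_, ?_⟩⟩
  · rintro ⟨i, hi⟩ v
    simp only [Subtype.mk.injEq]
    set φ : ℤ × ℤ → ZMod 2 := fun s => if cl s = i then 1 else 0 with hφ
    set F : ℤ × ℤ → ℤ × ℤ → ZMod 2 := fun x y =>
      if GridAdj x y then φ (leftSquare x y) + φ (leftSquare y x) else 0 with hF
    have hFs : ∀ x y, F x y = F y x := by
      intro x y
      simp only [hF]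
      rw [add_comm]
      exact if_congr ⟨GridAdj.symm, GridAdj.symm⟩ rfl rfl
    have hF0 : ∀ x, F x x = 0 := by
      intro x
      simp only [hF]
      rw [if_neg]
      unfold GridAdj
      omega
    set T : Finset (ℤ × ℤ) := A v ∪ (A v).biUnion gridNbrs with hT
    have hsum : ∀ x ∈ A v, ∑ y ∈ T, F x y = 0 := by
      intro x hx
      rw [← sum_leftSquare φ x]
      have hsub : gridNbrs x ⊆ T := fun y hy =>
        Finset.mem_union_right _ (Finset.mem_biUnion.2 ⟨x, hx, hy⟩)
      rw [← Finset.sum_subset hsub]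
      · refine Finset.sum_congr rfl fun y hy => ?_
        simp only [hF]
        rw [if_pos (mem_gridNbrs.1 hy)]
      · intro y _ hy
        simp only [hF]
        rw [if_neg (fun h => hy (mem_gridNbrs.2 h))]
    have hpt : ∀ x ∈ A v, ∀ y, F x y = (if y ∈ A v then F x y else 0) +
        ∑ w, if G.Adj v w then (if x = X v w ∧ y = X w v then F x y else 0) else 0 := by
      intro x hx y
      by_cases hy : y ∈ A v
      · rw [if_pos hy, Finset.sum_eq_zero, add_zero]
        intro w _
        split_ifs with h1 h2
        · exact absurd (hdisj _ _ y hy (h2.2 ▸ (hX v w h1).2.1)) h1.ne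
        · rfl
        · rfl
      · rw [if_neg hy, zero_add]
        by_cases hk : ∃ w, G.Adj v w ∧ x = X v w ∧ y = X w v
        · obtain ⟨w, hw, h1, h2⟩ := hk
          rw [Finset.sum_eq_single w]
          · rw [if_pos hw, if_pos ⟨h1, h2⟩]
          · intro w' _ hne
            split_ifs with h3 h4
            · exact absurd (hdisj _ _ y (h4.2 ▸ (hX v w' h3).2.1) (h2 ▸ (hX v w hw).2.1)) hne
            · rfl
            · rfl
          · intro h3; exact absurd (Finset.mem_univ _) h3
        · rw [Finset.sum_eq_zero]
          · by_cases hg : GridAdj x y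
            · simp only [hF]
              rw [if_pos hg]
              have hnk : ¬ kept x y := by
                rintro (⟨u, h1, h2⟩ | ⟨u, w, h1, h2, h3⟩)
                · rw [hdisj _ _ x h1 hx] at h2
                  exact hy h2
                · have := hdisj _ _ x hx (h2 ▸ (hX u w h1).1)
                  subst this
                  exact hk ⟨w, h1, h2, h3⟩
              have : cl (leftSquare x y) = cl (leftSquare y x) :=
                Quot.sound ⟨x, y, hg, hnk, rfl, rfl⟩
              simp only [hφ]
              rw [this, ZMod.two_add_self]
            · simp only [hF]
              rw [if_neg hg]
          · intro w _
            split_ifs with h1 h2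
            · exact absurd ⟨w, h1, h2⟩ hk
            · rfl
            · rfl
    have htot : ∑ x ∈ A v, ∑ y ∈ T, F x y = 0 := Finset.sum_eq_zero hsum
    rw [Finset.sum_congr rfl (fun x hx => Finset.sum_congr rfl fun y _ => hpt x hx y)] at htot
    simp only [Finset.sum_add_distrib] at htot
    have hin : ∑ x ∈ A v, ∑ y ∈ T, (if y ∈ A v then F x y else 0) = 0 := by
      refine Eq.trans ?_ (sum_symm_eq_zero (A v) F hFs hF0)
      refine Finset.sum_congr rfl fun x _ => ?_
      rw [← Finset.sum_filter]
      refine Finset.sum_congr ?_ fun _ _ => rfl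
      ext y
      simp [hT]
    rw [hin, zero_add] at htot
    have hswap : ∀ x, ∑ y ∈ T, ∑ w, (if G.Adj v w then
        (if x = X v w ∧ y = X w v then F x y else 0) else 0) = ∑ w, ∑ y ∈ T, (if G.Adj v w then
        (if x = X v w ∧ y = X w v then F x y else 0) else 0) := fun x => Finset.sum_comm
    simp only [hswap] at htot
    rw [Finset.sum_comm] at htot
    refine Eq.trans ?_ htot
    refine Finset.sum_congr rfl fun w _ => ?_
    by_cases hw : G.Adj v w
    · simp only [hw, if_true]
      have hx := hX v w hw
      rw [Finset.sum_eq_single (X v w), Finset.sum_eq_single (X w v)]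
      · simp only [hF, hφ, hL0]
        simp [hx.2.2]
      · intro y _ hne
        rw [if_neg (fun h => hne h.2)]
      · intro hn
        exact absurd (Finset.mem_union_right _
          (Finset.mem_biUnion.2 ⟨X v w, hx.1, mem_gridNbrs.2 hx.2.2⟩)) hn
      · intro x _ hne
        exact Finset.sum_eq_zero fun y _ => if_neg (fun h => hne h.1)
      · intro hn
        exact absurd hx.1 hn
    · simp [hw]
  · intro z hz1 hz2 hz3
    have hroot : ∃ r : V → ℤ × ℤ, ∀ v w, G.Adj v w → r v ∈ A v := by
      have : ∀ v, ∃ r : ℤ × ℤ, ∀ w, G.Adj v w → r ∈ A v := by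
        intro v
        by_cases hv : ∃ w, G.Adj v w
        · obtain ⟨w, hw⟩ := hv
          exact ⟨X v w, fun _ _ => (hX v w hw).1⟩
        · exact ⟨0, fun w hw => absurd ⟨w, hw⟩ hv⟩
      exact ⟨fun v => (this v).choose, fun v => (this v).choose_spec⟩
    obtain ⟨r, hr⟩ := hroot
    have hq : ∀ v w, ∃ c : ℤ × ℤ → ℤ × ℤ → ZMod 2, (∀ x y, c x y = c y x) ∧
        (∀ x y, c x y ≠ 0 → x ∈ A v ∧ y ∈ A v ∧ GridAdj x y) ∧
        (G.Adj v w → ∀ x, ∑ y ∈ gridNbrs x, c x y =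
          (if x = X v w then 1 else 0) + (if x = r v then 1 else 0)) := by
      intro v w
      by_cases hvw : G.Adj v w
      · obtain ⟨c, h1, h2, h3⟩ := exists_chain_of_gridReach (A v) (X v w) (r v)
          (hconn v _ (hX v w hvw).1 _ (hr v w hvw))
        exact ⟨c, h1, h2, fun _ => h3⟩
      · exact ⟨fun _ _ => 0, fun _ _ => rfl, fun _ _ h => absurd rfl h, fun h => absurd h hvw⟩
    choose q hq1 hq2 hq3 using hq
    set e : V → V → ℤ × ℤ → ℤ × ℤ → ZMod 2 := fun v w x y =>
      if x = X v w ∧ y = X w v then 1 else 0 with he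
    set c : ℤ × ℤ → ℤ × ℤ → ZMod 2 := fun x y =>
      ∑ v, ∑ w, z v w * (q v w x y + e v w x y) with hc
    have hzadj : ∀ v w, z v w ≠ 0 → G.Adj v w := fun v w h => by
      by_contra hn; exact h (hz2 _ _ hn)
    have hcsymm : ∀ x y, c x y = c y x := by
      intro x y
      simp only [hc, mul_add, Finset.sum_add_distrib]
      congr 1
      · exact Finset.sum_congr rfl fun v _ => Finset.sum_congr rfl fun w _ => by rw [hq1]
      · rw [Finset.sum_comm]
        refine Finset.sum_congr rfl fun v _ => Finset.sum_congr rfl fun w _ => ?_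
        rw [hz1]
        simp only [he, and_comm]
    have hcsupp : ∀ x y, c x y ≠ 0 → kept x y ∧ ∃ v, x ∈ A v := by
      intro x y h
      obtain ⟨v, -, h⟩ := Finset.exists_ne_zero_of_sum_ne_zero h
      obtain ⟨w, -, h⟩ := Finset.exists_ne_zero_of_sum_ne_zero h
      have hvw := hzadj v w (left_ne_zero_of_mul h)
      by_cases h1 : q v w x y = 0
      · have h2 : e v w x y ≠ 0 := by
          intro h2; rw [h1, h2] at h; simp at h
        have h3 : x = X v w ∧ y = X w v := by
          by_contra h3; exact h2 (if_neg h3)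
        exact ⟨Or.inr ⟨v, w, hvw, h3⟩, v, h3.1 ▸ (hX v w hvw).1⟩
      · have := hq2 _ _ _ _ h1
        exact ⟨Or.inl ⟨v, this.1, this.2.1⟩, v, this.1⟩
    have hceven : ∀ x, ∑ y ∈ gridNbrs x, c x y = 0 := by
      intro x
      simp only [hc]
      rw [Finset.sum_comm]
      have h1 : ∀ v, ∑ y ∈ gridNbrs x, ∑ w, z v w * (q v w x y + e v w x y) =
          ∑ w, z v w * (if x = r v then 1 else 0) := by
        intro v
        rw [Finset.sum_comm]
        refine Finset.sum_congr rfl fun w _ => ?_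
        rw [← Finset.mul_sum]
        by_cases hvw : z v w = 0
        · rw [hvw, zero_mul, zero_mul]
        · congr 1
          have hvw := hzadj v w hvw
          rw [Finset.sum_add_distrib, hq3 v w hvw]
          have : ∑ y ∈ gridNbrs x, e v w x y = if x = X v w then 1 else 0 := by
            simp only [he]
            by_cases hx : x = X v w
            · subst hx
              simp only [true_and, if_true]
              rw [Finset.sum_ite_eq', if_pos (mem_gridNbrs.2 (hX v w hvw).2.2)]
            · simp [hx]
          rw [this]
          generalize (if x = X v w then (1 : ZMod 2) else 0) = p1
          generalize (if x = r v then (1 : ZMod 2) else 0) = p2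
          revert p1 p2; decide
      refine Finset.sum_eq_zero fun v _ => ?_
      rw [h1, ← Finset.sum_mul, hz3, zero_mul]
    obtain ⟨M, hM⟩ : ∃ M : ℤ, ∀ v, ∀ x ∈ A v, M ≤ x.2 := by
      have hb : BddBelow ((Finset.univ.biUnion A).image Prod.snd : Set ℤ) := Finset.bddBelow _
      obtain ⟨M, hM⟩ := hb
      exact ⟨M, fun v x hx => hM (Finset.mem_coe.2 (Finset.mem_image_of_mem _
        (Finset.mem_biUnion.2 ⟨v, Finset.mem_univ _, hx⟩)))⟩
    obtain ⟨w, hw⟩ := exists_grid_potential c hcsymm M (by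
      intro x y hx
      by_contra hn
      obtain ⟨-, v, hv⟩ := hcsupp x y hn
      have := hM v x hv
      omega) hceven
    have hwR : ∀ s t, R s t → w s = w t := by
      rintro s t ⟨x, y, hxy, hk, rfl, rfl⟩
      have h0 : c x y = 0 := by
        by_contra hn; exact hk (hcsupp x y hn).1
      rw [hw x y hxy] at h0
      generalize w (leftSquare x y) = p1 at *
      generalize w (leftSquare y x) = p2 at *
      revert p1 p2; decide
    refine ⟨fun i => Quot.lift w hwR i.1, ?_⟩
    intro u v huv
    have hx := hX u v huv
    have h1 : c (X u v) (X v u) = z u v := by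
      simp only [hc]
      rw [Finset.sum_eq_single u, Finset.sum_eq_single v]
      · have h2 : q u v (X u v) (X v u) = 0 := by
          by_contra hn
          exact huv.ne (hdisj _ _ _ (hq2 _ _ _ _ hn).2.1 hx.2.1)
        simp [he, h2]
      · intro v' _ hne
        by_cases hz : z u v' = 0
        · rw [hz, zero_mul]
        have huv' := hzadj _ _ hz
        have h2 : q u v' (X u v) (X v u) = 0 := by
          by_contra hn
          exact huv.ne (hdisj _ _ _ (hq2 _ _ _ _ hn).2.1 hx.2.1)
        simp only [he]
        rw [h2, if_neg, zero_add, mul_zero]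
        rintro ⟨-, h3⟩
        exact hne (hdisj _ _ _ (hX u v' huv').2.1 (h3 ▸ hx.2.1))
      · intro hn; exact absurd (Finset.mem_univ _) hn
      · intro u' _ hne
        refine Finset.sum_eq_zero fun v' _ => ?_
        by_cases hz : z u' v' = 0
        · rw [hz, zero_mul]
        have huv' := hzadj _ _ hz
        have h2 : q u' v' (X u v) (X v u) = 0 := by
          by_contra hn
          exact hne (hdisj _ _ _ (hq2 _ _ _ _ hn).1 hx.1)
        simp only [he]
        rw [h2, if_neg, zero_add, mul_zero]
        rintro ⟨h3, -⟩
        exact hne (hdisj _ _ _ (hX u' v' huv').1 (h3 ▸ hx.1))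
      · intro hn; exact absurd (Finset.mem_univ _) hn
    rw [← h1, hw _ _ hx.2.2]

section faces
open scoped Classical

/-- The face `i` has the edge `uv` on its boundary. -/
def Borders {V ι : Type*} (G : SimpleGraph V) (L : V → V → ι) (i : ι) (u v : V) : Prop :=
  G.Adj u v ∧ L u v ≠ L v u ∧ (L u v = i ∨ L v u = i)

/-- The faces with a nonempty boundary. -/
noncomputable def usedFaces {V ι : Type*} [Fintype ι] (G : SimpleGraph V) (L : V → V → ι) :
    Finset ι :=
  Finset.univ.filter fun i => ∃ u v, Borders G L i u v

theorem mem_usedFaces {V ι : Type*} [Fintype ι] {G : SimpleGraph V} {L : V → V → ι} {i : ι} :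
    i ∈ usedFaces G L ↔ ∃ u v, Borders G L i u v := by
  simp [usedFaces]

theorem card_edgeFinset_add_two_le {V ι : Type*} [Fintype V] [Fintype ι] {G : SimpleGraph V}
    {L : V → V → ι} (hF : FaceSystem G L) (hne : ∃ u v, G.Adj u v ∧ L u v ≠ L v u) :
    Fintype.card G.edgeSet + 2 ≤ (usedFaces G L).card + Fintype.card V := by
  obtain ⟨u0, v0, huv0, hL0⟩ := hne
  set U := usedFaces G L with hU
  have memU : ∀ u v, G.Adj u v → L u v ≠ L v u → L u v ∈ U := fun u v h1 h2 =>
    mem_usedFaces.2 ⟨u, v, h1, h2, Or.inl rfl⟩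
  set ex : (G.edgeSet → ZMod 2) →ₗ[ZMod 2] (V → V → ZMod 2) :=
    { toFun := fun z u v => ∑ e : G.edgeSet, if (e : Sym2 V) = s(u, v) then z e else 0
      map_add' := by
        intro x y
        funext u v
        simp only [Pi.add_apply]
        rw [← Finset.sum_add_distrib]
        exact Finset.sum_congr rfl fun e _ => by split_ifs <;> simp
      map_smul' := by
        intro c x
        funext u v
        simp only [Pi.smul_apply, smul_eq_mul, RingHom.id_apply]
        rw [Finset.mul_sum]
        exact Finset.sum_congr rfl fun e _ => by split_ifs <;> simp } with hex
  have hex_apply : ∀ z u v, ex z u v = ∑ e : G.edgeSet, if (e : Sym2 V) = s(u, v) then z e else 0 :=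
    fun _ _ _ => rfl
  have hex1 : ∀ z u v, ex z u v = ex z v u := by
    intro z u v
    rw [hex_apply, hex_apply, Sym2.eq_swap]
  have hex2 : ∀ z u v, ¬ G.Adj u v → ex z u v = 0 := by
    intro z u v h
    rw [hex_apply]
    refine Finset.sum_eq_zero fun e _ => if_neg ?_
    intro he
    exact h (by have := e.2; rwa [he] at this)
  have hex3 : ∀ z (e : G.edgeSet) u v, (e : Sym2 V) = s(u, v) → ex z u v = z e := by
    intro z e u v he
    rw [hex_apply, Finset.sum_eq_single e]
    · rw [if_pos he]
    · intro e' _ hne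
      exact if_neg fun h => hne (Subtype.ext (h.trans he.symm))
    · intro h; exact absurd (Finset.mem_univ _) h
  set bd : (G.edgeSet → ZMod 2) →ₗ[ZMod 2] (V → ZMod 2) :=
    { toFun := fun z v => ∑ w, ex z v w
      map_add' := by
        intro x y
        funext v
        simp only [map_add, Pi.add_apply, Finset.sum_add_distrib]
      map_smul' := by
        intro c x
        funext v
        simp only [map_smul, Pi.smul_apply, smul_eq_mul, RingHom.id_apply,
          Finset.mul_sum] } with hbd
  set tot : (V → ZMod 2) →ₗ[ZMod 2] ZMod 2 :=
    { toFun := fun f => ∑ v, f v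
      map_add' := fun x y => by simp only [Pi.add_apply, Finset.sum_add_distrib]
      map_smul' := fun c x => by
        simp only [Pi.smul_apply, smul_eq_mul, RingHom.id_apply, Finset.mul_sum] } with htot
  have h1 : LinearMap.range bd ≤ LinearMap.ker tot := by
    rintro _ ⟨z, rfl⟩
    rw [LinearMap.mem_ker]
    exact sum_symm_eq_zero Finset.univ (ex z) (hex1 z) (fun x => hex2 z x x (G.loopless.irrefl x))
  have h2 : LinearMap.range tot = ⊤ := by
    rw [LinearMap.range_eq_top]
    intro c
    refine ⟨Pi.single u0 c, ?_⟩
    simp [htot]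
  have e1 := LinearMap.finrank_range_add_finrank_ker bd
  have e2 := LinearMap.finrank_range_add_finrank_ker tot
  rw [h2, finrank_top, Module.finrank_self, Module.finrank_fintype_fun_eq_card] at e2
  rw [Module.finrank_fintype_fun_eq_card] at e1
  have e3 := Submodule.finrank_mono h1
  set xt : (U → ZMod 2) →ₗ[ZMod 2] (ι → ZMod 2) :=
    { toFun := fun g i => if h : i ∈ U then g ⟨i, h⟩ else 0
      map_add' := by
        intro x y
        funext i
        simp only [Pi.add_apply]
        split_ifs <;> simp
      map_smul' := by
        intro c x
        funext i
        simp only [Pi.smul_apply, smul_eq_mul, RingHom.id_apply]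
        split_ifs <;> simp } with hxt
  have hxt_apply : ∀ g i (h : i ∈ U), xt g i = g ⟨i, h⟩ := fun g i h => dif_pos h
  have hout : ∀ e : G.edgeSet, (e : Sym2 V) = s((Quot.out e.1).1, (Quot.out e.1).2) :=
    fun e => (Quot.out_eq e.1).symm
  have hadj : ∀ e : G.edgeSet, G.Adj (Quot.out e.1).1 (Quot.out e.1).2 := by
    intro e
    have := e.2
    rw [hout e] at this
    exact this
  set Γ : (U → ZMod 2) →ₗ[ZMod 2] (G.edgeSet → ZMod 2) :=
    { toFun := fun g e => xt g (L (Quot.out e.1).1 (Quot.out e.1).2) +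
        xt g (L (Quot.out e.1).2 (Quot.out e.1).1)
      map_add' := by
        intro x y
        funext e
        simp only [map_add, Pi.add_apply]
        ring
      map_smul' := by
        intro c x
        funext i
        simp only [map_smul, Pi.smul_apply, smul_eq_mul, RingHom.id_apply, mul_add] } with hΓ
  have hΓ_apply : ∀ g e, Γ g e = xt g (L (Quot.out e.1).1 (Quot.out e.1).2) +
        xt g (L (Quot.out e.1).2 (Quot.out e.1).1) := fun _ _ => rfl
  have h3 : LinearMap.ker bd ≤ LinearMap.range Γ := by
    intro z hz
    rw [LinearMap.mem_ker] at hz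
    obtain ⟨g, hg⟩ := hF.span (ex z) (hex1 z) (hex2 z) (fun v => congrFun hz v)
    refine ⟨fun i => g i, ?_⟩
    funext e
    rw [hΓ_apply, ← hex3 z e _ _ (hout e), hg _ _ (hadj e)]
    by_cases hc : L (Quot.out e.1).1 (Quot.out e.1).2 = L (Quot.out e.1).2 (Quot.out e.1).1
    · rw [hc, ZMod.two_add_self, ZMod.two_add_self]
    · rw [hxt_apply _ _ (memU _ _ (hadj e) hc),
        hxt_apply _ _ (memU _ _ (hadj e).symm (Ne.symm hc))]
  have e4 := Submodule.finrank_mono h3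
  have e5 := LinearMap.finrank_range_add_finrank_ker Γ
  rw [Module.finrank_fintype_fun_eq_card, Fintype.card_coe] at e5
  have h4 : (fun _ => 1 : U → ZMod 2) ∈ LinearMap.ker Γ := by
    rw [LinearMap.mem_ker]
    funext e
    rw [hΓ_apply]
    by_cases hc : L (Quot.out e.1).1 (Quot.out e.1).2 = L (Quot.out e.1).2 (Quot.out e.1).1
    · rw [hc, ZMod.two_add_self]; rfl
    · rw [hxt_apply _ _ (memU _ _ (hadj e) hc),
        hxt_apply _ _ (memU _ _ (hadj e).symm (Ne.symm hc))]
      rfl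
  have e6 : 1 ≤ Module.finrank (ZMod 2) (LinearMap.ker Γ) := by
    rw [Nat.one_le_iff_ne_zero, Ne, Submodule.finrank_eq_zero]
    intro hbot
    rw [hbot, Submodule.mem_bot] at h4
    have := congrFun h4 ⟨L u0 v0, memU u0 v0 huv0 hL0⟩
    exact absurd this one_ne_zero
  omega
end faces

section hexagons

theorem Theta6Free.no_hexagon_of_chord {V : Type*} {G : SimpleGraph V} (hG : Theta6Free G)
    (p : Fin 6 → V) (hp : Function.Injective p) (hc : ∀ i : Fin 6, G.Adj (p i) (p (i + 1)))
    (i j : Fin 6) (hij : i ≠ j) (hij' : ¬ cycle6.Adj i j) : ¬ G.Adj (p i) (p j) := by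
  intro hadj
  refine hG i j hij hij' ⟨⟨p, ?_⟩, hp⟩
  intro a b hab
  rw [SimpleGraph.sup_adj, SimpleGraph.fromEdgeSet_adj] at hab
  rcases hab with hab | ⟨hab, -⟩
  · have key : ∀ a b : Fin 6, cycle6.Adj a b → b = a + 1 ∨ a = b + 1 := by
      unfold cycle6
      simp only [SimpleGraph.fromEdgeSet_adj, Set.mem_insert_iff, Set.mem_singleton_iff]
      decide
    rcases key a b hab with rfl | rfl
    · exact hc a
    · exact (hc b).symm
  · rcases Sym2.eq_iff.1 (Set.mem_singleton_iff.1 hab) with ⟨rfl, rfl⟩ | ⟨rfl, rfl⟩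
    · exact hadj
    · exact hadj.symm

theorem Theta6Free.hex {V : Type*} {G : SimpleGraph V} (hG : Theta6Free G) {a b c d e f : V}
    (hn : [a, b, c, d, e, f].Nodup) (h1 : G.Adj a b) (h2 : G.Adj b c) (h3 : G.Adj c d)
    (h4 : G.Adj d e) (h5 : G.Adj e f) (h6 : G.Adj f a) : ¬ G.Adj a c ∧ ¬ G.Adj a d := by
  have hp : Function.Injective ![a, b, c, d, e, f] := by
    have := List.nodup_iff_injective_get.1 hn
    intro i j hij
    refine this (a₁ := i) (a₂ := j) ?_
    fin_cases i <;> fin_cases j <;> exact hij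
  have hc : ∀ i : Fin 6, G.Adj (![a, b, c, d, e, f] i) (![a, b, c, d, e, f] (i + 1)) := by
    intro i
    fin_cases i
    exacts [h1, h2, h3, h4, h5, h6]
  have key : ¬ cycle6.Adj 0 2 ∧ ¬ cycle6.Adj 0 3 := by
    unfold cycle6
    simp only [SimpleGraph.fromEdgeSet_adj, Set.mem_insert_iff, Set.mem_singleton_iff]
    decide
  exact ⟨hG.no_hexagon_of_chord _ hp hc 0 2 (by decide) key.1,
    hG.no_hexagon_of_chord _ hp hc 0 3 (by decide) key.2⟩

/-- A hexagon with a short chord. -/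
theorem Theta6Free.hex2 {V : Type*} {G : SimpleGraph V} (hG : Theta6Free G) {a b c d e f : V}
    (h1 : G.Adj a b) (h2 : G.Adj b c) (h3 : G.Adj c d)
    (h4 : G.Adj d e) (h5 : G.Adj e f) (h6 : G.Adj f a) (h7 : G.Adj a c)
    (hn : [a, b, c, d, e, f].Nodup) : False := (hG.hex hn h1 h2 h3 h4 h5 h6).1 h7

/-- A hexagon with a long chord. -/
theorem Theta6Free.hex3 {V : Type*} {G : SimpleGraph V} (hG : Theta6Free G) {a b c d e f : V}
    (h1 : G.Adj a b) (h2 : G.Adj b c) (h3 : G.Adj c d)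
    (h4 : G.Adj d e) (h5 : G.Adj e f) (h6 : G.Adj f a) (h7 : G.Adj a d)
    (hn : [a, b, c, d, e, f].Nodup) : False := (hG.hex hn h1 h2 h3 h4 h5 h6).2 h7

theorem Theta6Free.comap {V W : Type*} {G : SimpleGraph V} {H : SimpleGraph W} (hG : Theta6Free G)
    (f : W → V) (hf : Function.Injective f) (hadj : ∀ u v, H.Adj u v → G.Adj (f u) (f v)) :
    Theta6Free H := by
  rintro a b hab hab' ⟨g, hg⟩
  exact hG a b hab hab' ⟨(⟨f, fun h => hadj _ _ h⟩ : H →g G).comp g, hf.comp hg⟩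

end hexagons

section faces
open scoped Classical

/-- `G - v` is connected. -/
def NoCut {V : Type*} (G : SimpleGraph V) (v : V) : Prop :=
  ∀ a b, a ≠ v → b ≠ v → Relation.ReflTransGen (fun x y => G.Adj x y ∧ x ≠ v ∧ y ≠ v) a b

theorem exists_chain_of_reflTransGen {V : Type*} [Fintype V] (r : V → V → Prop)
    (hirr : ∀ x, ¬ r x x) (p q : V) (h : Relation.ReflTransGen r p q) :
    ∃ c : V → V → ZMod 2, (∀ x y, c x y = c y x) ∧
      (∀ x y, c x y ≠ 0 → r x y ∨ r y x) ∧
      ∀ x, ∑ y, c x y = (if x = p then 1 else 0) + (if x = q then 1 else 0) := by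
  induction h with
  | refl =>
    exact ⟨fun _ _ => 0, fun _ _ => rfl, fun x y h => absurd rfl h, fun x => by
      rw [Finset.sum_const_zero, ZMod.two_add_self]⟩
  | @tail b d h1 h2 ih =>
    obtain ⟨c, hc1, hc2, hc3⟩ := ih
    have hne : b ≠ d := by
      rintro rfl
      exact hirr _ h2
    refine ⟨fun x y => c x y + ((if x = b ∧ y = d then 1 else 0) + if x = d ∧ y = b then 1 else 0),
      ?_, ?_, ?_⟩
    · intro x y
      simp only
      rw [hc1 x y, add_comm (if x = b ∧ y = d then (1 : ZMod 2) else 0)]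
      simp only [and_comm]
    · intro x y hxy
      by_cases h0 : c x y = 0
      · by_cases h3 : x = b ∧ y = d
        · rw [h3.1, h3.2]; exact Or.inl h2
        · by_cases h4 : x = d ∧ y = b
          · rw [h4.1, h4.2]; exact Or.inr h2
          · simp [h0, h3, h4] at hxy
      · exact hc2 x y h0
    · intro x
      rw [Finset.sum_add_distrib, Finset.sum_add_distrib, hc3]
      have e1 : ∑ y, (if x = b ∧ y = d then (1 : ZMod 2) else 0) = if x = b then 1 else 0 := by
        by_cases hx : x = b <;> simp [hx]
      have e2 : ∑ y, (if x = d ∧ y = b then (1 : ZMod 2) else 0) = if x = d then 1 else 0 := by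
        by_cases hx : x = d <;> simp [hx]
      rw [e1, e2]
      generalize (if x = p then (1 : ZMod 2) else 0) = p1
      generalize (if x = b then (1 : ZMod 2) else 0) = p2
      generalize (if x = d then (1 : ZMod 2) else 0) = p3
      revert p1 p2 p3; decide

theorem NoCut.exists_cycle {V : Type*} [Fintype V] {G : SimpleGraph V} {v : V} (h : NoCut G v)
    {a b : V} (ha : G.Adj v a) (hb : G.Adj v b) (hab : a ≠ b) :
    ∃ z : V → V → ZMod 2, (∀ x y, z x y = z y x) ∧ (∀ x y, ¬ G.Adj x y → z x y = 0) ∧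
      (∀ x, ∑ y, z x y = 0) ∧ z v a = 1 ∧ ∀ w, w ≠ a → w ≠ b → z v w = 0 := by
  obtain ⟨c, hc1, hc2, hc3⟩ := exists_chain_of_reflTransGen _ (fun x hx => hx.1.ne rfl) a b
    (h a b ha.ne' hb.ne')
  have hcv : ∀ y, c v y = 0 := by
    intro y
    by_contra hn
    rcases hc2 v y hn with h1 | h1
    · exact h1.2.1 rfl
    · exact h1.2.2 rfl
  set d : V → ZMod 2 := fun w => if w = a ∨ w = b then 1 else 0 with hd
  refine ⟨fun x y => c x y + ((if x = v then d y else 0) + (if y = v then d x else 0)),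
    ?_, ?_, ?_, ?_, ?_⟩
  · intro x y
    simp only
    rw [hc1 x y]
    ring
  · intro x y hxy
    have h1 : c x y = 0 := by
      by_contra hn
      rcases hc2 x y hn with h1 | h1
      · exact hxy h1.1
      · exact hxy h1.1.symm
    have h2 : (if x = v then d y else 0) = 0 := by
      split_ifs with h3
      · subst h3
        refine if_neg ?_
        rintro (rfl | rfl)
        · exact hxy ha
        · exact hxy hb
      · rfl
    have h3 : (if y = v then d x else 0) = 0 := by
      split_ifs with h3
      · subst h3
        refine if_neg ?_
        rintro (rfl | rfl)
        · exact hxy ha.symm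
        · exact hxy hb.symm
      · rfl
    simp only [h1, h2, h3, add_zero]
  · intro x
    rw [Finset.sum_add_distrib, Finset.sum_add_distrib, hc3, Finset.sum_ite_eq' Finset.univ v,
      if_pos (Finset.mem_univ _)]
    have hdx : d x = (if x = a then 1 else 0) + (if x = b then 1 else 0) := by
      simp only [hd]
      by_cases h1 : x = a
      · subst h1; simp [hab]
      · by_cases h2 : x = b <;> simp [h1, h2, hab.symm]
    rw [← hdx]
    have h0 : ∑ y, (if x = v then d y else 0) = 0 := by
      by_cases hx : x = v
      · simp only [hx, if_true]
        rw [Finset.sum_eq_add a b hab]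
        · simp only [hd]
          simp [ZMod.two_add_self]
        · intro w _ hw
          exact if_neg (by tauto)
        · intro hn; exact absurd (Finset.mem_univ _) hn
        · intro hn; exact absurd (Finset.mem_univ _) hn
      · simp [hx]
    rw [h0, zero_add, ZMod.two_add_self]
  · simp [hcv, ha.ne', hd]
  · intro w hwa hwb
    have hdv : d v = 0 := if_neg (by rintro (h | h); exacts [ha.ne h, hb.ne h])
    simp [hcv, hd, hwa, hwb]
    intro _
    exact ⟨ha.ne, hb.ne⟩

/-- A nonempty set of edges at `v` which every face meets evenly consists of all edges at `v`. -/
theorem FaceSystem.closure {V ι : Type*} [Fintype V] [Fintype ι] {G : SimpleGraph V}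
    {L : V → V → ι} (hF : FaceSystem G L) {v : V} (hv : NoCut G v) (D : Finset V)
    (hD : ∀ w ∈ D, G.Adj v w) (hne : D.Nonempty)
    (heven : ∀ i, ∑ w ∈ D, ((if L v w = i then 1 else 0) + (if L w v = i then 1 else 0) : ZMod 2)
      = 0) : ∀ w, G.Adj v w → w ∈ D := by
  intro b hb
  by_contra hbD
  obtain ⟨a, ha⟩ := hne
  have hab : a ≠ b := by rintro rfl; exact hbD ha
  obtain ⟨z, hz1, hz2, hz3, hza, hz4⟩ := hv.exists_cycle (hD a ha) hb hab
  obtain ⟨g, hg⟩ := hF.span z hz1 hz2 hz3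
  have h1 : ∑ w ∈ D, z v w = 1 := by
    rw [Finset.sum_eq_single a _ (fun h => absurd ha h), hza]
    intro w hw hwa
    exact hz4 w hwa (by rintro rfl; exact hbD hw)
  have h2 : ∑ w ∈ D, z v w = 0 := by
    rw [Finset.sum_congr rfl (fun w hw => hg v w (hD w hw))]
    have h3 : ∀ w, g (L v w) + g (L w v) =
        ∑ i, g i * ((if L v w = i then 1 else 0) + (if L w v = i then 1 else 0)) := by
      intro w
      simp only [mul_add, Finset.sum_add_distrib, mul_ite, mul_one, mul_zero]
      simp
    simp only [h3]
    rw [Finset.sum_comm]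
    refine Finset.sum_eq_zero fun i _ => ?_
    rw [← Finset.mul_sum, heven, mul_zero]
  rw [h1] at h2
  exact one_ne_zero h2

end faces

section evensets
open scoped Classical

/-- A finite set of edges meeting every vertex an even number of times. -/
def EvenEdges {V : Type*} (S : Finset (Sym2 V)) : Prop :=
  (∀ e ∈ S, ¬ e.IsDiag) ∧ ∀ v, Even (S.filter (fun e => v ∈ e)).card

variable {V : Type*} {S C : Finset (Sym2 V)}

theorem EvenEdges.ne (h : EvenEdges S) {a b : V} (hab : s(a, b) ∈ S) : a ≠ b :=
  fun he => h.1 _ hab (Sym2.mk_isDiag_iff.2 he)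

theorem EvenEdges.exists_next (h : EvenEdges S) {a b : V} (hab : s(a, b) ∈ S) :
    ∃ c, c ≠ a ∧ s(b, c) ∈ S := by
  have h1 : s(a, b) ∈ S.filter (fun e => b ∈ e) :=
    Finset.mem_filter.2 ⟨hab, Sym2.mem_mk_right a b⟩
  have h2 : 1 < (S.filter (fun e => b ∈ e)).card := by
    have h3 := Finset.card_pos.2 ⟨_, h1⟩
    obtain ⟨k, hk⟩ := h.2 b
    omega
  obtain ⟨e, he, hne⟩ := Finset.exists_mem_ne h2 s(a, b)
  rw [Finset.mem_filter] at he
  obtain ⟨c, rfl⟩ := he.2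
  refine ⟨c, ?_, he.1⟩
  rintro rfl
  exact hne Sym2.eq_swap

theorem EvenEdges.sdiff (hS : EvenEdges S) (hC : EvenEdges C) (hCS : C ⊆ S) :
    EvenEdges (S \ C) := by
  refine ⟨fun e he => hS.1 e (Finset.mem_sdiff.1 he).1, fun v => ?_⟩
  have h0 : (S \ C).filter (fun e => v ∈ e) =
      S.filter (fun e => v ∈ e) \ C.filter (fun e => v ∈ e) := by
    ext e
    simp only [Finset.mem_filter, Finset.mem_sdiff]
    tauto
  rw [h0, Finset.card_sdiff_of_subset (Finset.filter_subset_filter _ hCS)]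
  have := Finset.card_le_card (Finset.filter_subset_filter (fun e => v ∈ e) hCS)
  exact (Nat.even_sub this).2 ⟨fun _ => hC.2 v, fun _ => hS.2 v⟩

theorem EvenEdges.three_le_card (h : EvenEdges S) (hne : S.Nonempty) : 3 ≤ S.card := by
  obtain ⟨e, he⟩ := hne
  induction e with
  | _ a b =>
    obtain ⟨c, hca, hbc⟩ := h.exists_next he
    obtain ⟨d, hdb, hcd⟩ := h.exists_next hbc
    have h1 := h.ne he
    have h2 := h.ne hbc
    have h3 := h.ne hcd
    have hsub : ({s(a, b), s(b, c), s(c, d)} : Finset (Sym2 V)) ⊆ S := by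
      intro e
      simp only [Finset.mem_insert, Finset.mem_singleton]
      rintro (rfl | rfl | rfl) <;> assumption
    have hcard : ({s(a, b), s(b, c), s(c, d)} : Finset (Sym2 V)).card = 3 := by
      rw [Finset.card_insert_of_notMem, Finset.card_insert_of_notMem, Finset.card_singleton]
      · simp only [Finset.mem_singleton, Sym2.eq_iff]; grind
      · simp only [Finset.mem_singleton, Finset.mem_insert, Sym2.eq_iff]; grind
    rw [← hcard]
    exact Finset.card_le_card hsub

theorem EvenEdges.eq_of_subset (hS : EvenEdges S) (hC : EvenEdges C) (hCS : C ⊆ S)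
    (h : S.card ≤ C.card + 2) : S = C := by
  by_contra hne
  have h1 : (S \ C).Nonempty := by
    rw [Finset.sdiff_nonempty]
    exact fun h2 => hne (Finset.Subset.antisymm h2 hCS)
  have h2 := (hS.sdiff hC hCS).three_le_card h1
  rw [Finset.card_sdiff_of_subset hCS] at h2
  omega

theorem card_filter_mem_sym2 {a b : V} (hab : a ≠ b) (v : V) :
    (if v ∈ s(a, b) then 1 else 0) = (if v = a then 1 else 0) + (if v = b then 1 else 0) := by
  simp only [Sym2.mem_iff]
  split_ifs <;> grind

theorem evenEdges_tri {a b c : V} (hn : [a, b, c].Nodup) :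
    EvenEdges ({s(a, b), s(b, c), s(c, a)} : Finset (Sym2 V)) ∧
      ({s(a, b), s(b, c), s(c, a)} : Finset (Sym2 V)).card = 3 := by
  simp only [List.nodup_cons, List.mem_cons, List.not_mem_nil, or_false, not_or] at hn
  have n1 : s(a, b) ∉ ({s(b, c), s(c, a)} : Finset (Sym2 V)) := by
    simp only [Finset.mem_singleton, Finset.mem_insert, Sym2.eq_iff]; grind
  have n2 : s(b, c) ∉ ({s(c, a)} : Finset (Sym2 V)) := by
    simp only [Finset.mem_singleton, Sym2.eq_iff]; grind
  refine ⟨⟨?_, ?_⟩, ?_⟩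
  · simp only [Finset.mem_insert, Finset.mem_singleton]
    rintro e (rfl | rfl | rfl) <;> rw [Sym2.mk_isDiag_iff] <;> grind
  · intro v
    rw [Finset.card_filter, Finset.sum_insert n1, Finset.sum_insert n2, Finset.sum_singleton,
      card_filter_mem_sym2 (by grind), card_filter_mem_sym2 (by grind),
      card_filter_mem_sym2 (by grind)]
    refine ⟨(if v = a then 1 else 0) + (if v = b then 1 else 0) + (if v = c then 1 else 0), ?_⟩
    ring
  · rw [Finset.card_insert_of_notMem n1, Finset.card_insert_of_notMem n2, Finset.card_singleton]

theorem evenEdges_quad {a b c d : V} (hn : [a, b, c, d].Nodup) :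
    EvenEdges ({s(a, b), s(b, c), s(c, d), s(d, a)} : Finset (Sym2 V)) ∧
      ({s(a, b), s(b, c), s(c, d), s(d, a)} : Finset (Sym2 V)).card = 4 := by
  simp only [List.nodup_cons, List.mem_cons, List.not_mem_nil, or_false, not_or] at hn
  have n1 : s(a, b) ∉ ({s(b, c), s(c, d), s(d, a)} : Finset (Sym2 V)) := by
    simp only [Finset.mem_singleton, Finset.mem_insert, Sym2.eq_iff]; grind
  have n2 : s(b, c) ∉ ({s(c, d), s(d, a)} : Finset (Sym2 V)) := by
    simp only [Finset.mem_singleton, Finset.mem_insert, Sym2.eq_iff]; grind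
  have n3 : s(c, d) ∉ ({s(d, a)} : Finset (Sym2 V)) := by
    simp only [Finset.mem_singleton, Sym2.eq_iff]; grind
  refine ⟨⟨?_, ?_⟩, ?_⟩
  · simp only [Finset.mem_insert, Finset.mem_singleton]
    rintro e (rfl | rfl | rfl | rfl) <;> rw [Sym2.mk_isDiag_iff] <;> grind
  · intro v
    rw [Finset.card_filter, Finset.sum_insert n1, Finset.sum_insert n2, Finset.sum_insert n3,
      Finset.sum_singleton, card_filter_mem_sym2 (by grind), card_filter_mem_sym2 (by grind),
      card_filter_mem_sym2 (by grind), card_filter_mem_sym2 (by grind)]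
    refine ⟨(if v = a then 1 else 0) + (if v = b then 1 else 0) + (if v = c then 1 else 0) +
      (if v = d then 1 else 0), ?_⟩
    ring
  · rw [Finset.card_insert_of_notMem n1, Finset.card_insert_of_notMem n2,
      Finset.card_insert_of_notMem n3, Finset.card_singleton]

theorem evenEdges_pent {a b c d e : V} (hn : [a, b, c, d, e].Nodup) :
    EvenEdges ({s(a, b), s(b, c), s(c, d), s(d, e), s(e, a)} : Finset (Sym2 V)) ∧
      ({s(a, b), s(b, c), s(c, d), s(d, e), s(e, a)} : Finset (Sym2 V)).card = 5 := by
  simp only [List.nodup_cons, List.mem_cons, List.not_mem_nil, or_false, not_or] at hn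
  have n1 : s(a, b) ∉ ({s(b, c), s(c, d), s(d, e), s(e, a)} : Finset (Sym2 V)) := by
    simp only [Finset.mem_singleton, Finset.mem_insert, Sym2.eq_iff]; grind
  have n2 : s(b, c) ∉ ({s(c, d), s(d, e), s(e, a)} : Finset (Sym2 V)) := by
    simp only [Finset.mem_singleton, Finset.mem_insert, Sym2.eq_iff]; grind
  have n3 : s(c, d) ∉ ({s(d, e), s(e, a)} : Finset (Sym2 V)) := by
    simp only [Finset.mem_singleton, Finset.mem_insert, Sym2.eq_iff]; grind
  have n4 : s(d, e) ∉ ({s(e, a)} : Finset (Sym2 V)) := by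
    simp only [Finset.mem_singleton, Sym2.eq_iff]; grind
  refine ⟨⟨?_, ?_⟩, ?_⟩
  · simp only [Finset.mem_insert, Finset.mem_singleton]
    rintro e (rfl | rfl | rfl | rfl | rfl) <;> rw [Sym2.mk_isDiag_iff] <;> grind
  · intro v
    rw [Finset.card_filter, Finset.sum_insert n1, Finset.sum_insert n2, Finset.sum_insert n3,
      Finset.sum_insert n4, Finset.sum_singleton, card_filter_mem_sym2 (by grind),
      card_filter_mem_sym2 (by grind), card_filter_mem_sym2 (by grind),
      card_filter_mem_sym2 (by grind), card_filter_mem_sym2 (by grind)]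
    refine ⟨(if v = a then 1 else 0) + (if v = b then 1 else 0) + (if v = c then 1 else 0) +
      (if v = d then 1 else 0) + (if v = e then 1 else 0), ?_⟩
    ring
  · rw [Finset.card_insert_of_notMem n1, Finset.card_insert_of_notMem n2,
      Finset.card_insert_of_notMem n3, Finset.card_insert_of_notMem n4, Finset.card_singleton]

/-- A nonempty even set of at most five edges is a cycle of length three, four or five. -/
theorem EvenEdges.classify (h : EvenEdges S) (hne : S.Nonempty) (hcard : S.card ≤ 5) :
    (S.card = 3 ∧ ∃ a b c, [a, b, c].Nodup ∧ S = {s(a, b), s(b, c), s(c, a)}) ∨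
    (S.card = 4 ∧ ∃ a b c d, [a, b, c, d].Nodup ∧ S = {s(a, b), s(b, c), s(c, d), s(d, a)}) ∨
    (S.card = 5 ∧ ∃ a b c d e, [a, b, c, d, e].Nodup ∧
      S = {s(a, b), s(b, c), s(c, d), s(d, e), s(e, a)}) := by
  have tri : ∀ a b c, a ≠ c → s(a, b) ∈ S → s(b, c) ∈ S → s(c, a) ∈ S →
      (S.card = 3 ∧ ∃ a b c, [a, b, c].Nodup ∧ S = {s(a, b), s(b, c), s(c, a)}) := by
    intro a b c hac h1 h2 h3
    have hn : [a, b, c].Nodup := by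
      have := h.ne h1
      have := h.ne h2
      simp only [List.nodup_cons, List.mem_cons, List.not_mem_nil]; grind
    obtain ⟨hC, hc⟩ := evenEdges_tri hn
    have := h.eq_of_subset hC (by
      intro e
      simp only [Finset.mem_insert, Finset.mem_singleton]
      rintro (rfl | rfl | rfl) <;> assumption) (by omega)
    exact ⟨by rw [this]; exact hc, a, b, c, hn, this⟩
  have quad : ∀ a b c d, [a, b, c, d].Nodup → s(a, b) ∈ S → s(b, c) ∈ S → s(c, d) ∈ S →
      s(d, a) ∈ S → (S.card = 4 ∧ ∃ a b c d, [a, b, c, d].Nodup ∧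
        S = {s(a, b), s(b, c), s(c, d), s(d, a)}) := by
    intro a b c d hn h1 h2 h3 h4
    obtain ⟨hC, hc⟩ := evenEdges_quad hn
    have := h.eq_of_subset hC (by
      intro e
      simp only [Finset.mem_insert, Finset.mem_singleton]
      rintro (rfl | rfl | rfl | rfl) <;> assumption) (by omega)
    exact ⟨by rw [this]; exact hc, a, b, c, d, hn, this⟩
  obtain ⟨x, hx⟩ := hne
  induction x with
  | _ a b =>
    obtain ⟨c, hca, hbc⟩ := h.exists_next hx
    obtain ⟨d, hdb, hcd⟩ := h.exists_next hbc
    by_cases hda : d = a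
    · subst hda
      exact Or.inl (tri _ _ _ hca.symm hx hbc hcd)
    obtain ⟨e, hec, hde⟩ := h.exists_next hcd
    by_cases heb : e = b
    · subst heb
      exact Or.inl (tri _ _ _ hdb.symm hbc hcd hde)
    have n1 := h.ne hx
    have n2 := h.ne hbc
    have n3 := h.ne hcd
    have n4 := h.ne hde
    by_cases hea : e = a
    · subst hea
      refine Or.inr (Or.inl (quad e b c d ?_ hx hbc hcd hde))
      simp only [List.nodup_cons, List.mem_cons, List.not_mem_nil]; grind
    obtain ⟨f, hfd, hef⟩ := h.exists_next hde
    have n5 := h.ne hef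
    by_cases hfc : f = c
    · subst hfc
      exact Or.inl (tri _ _ _ hec.symm hcd hde hef)
    by_cases hfb : f = b
    · subst hfb
      refine Or.inr (Or.inl (quad f c d e ?_ hbc hcd hde hef))
      simp only [List.nodup_cons, List.mem_cons, List.not_mem_nil]; grind
    by_cases hfa : f = a
    · subst hfa
      have hn : [f, b, c, d, e].Nodup := by
        simp only [List.nodup_cons, List.mem_cons, List.not_mem_nil]; grind
      obtain ⟨hC, hc⟩ := evenEdges_pent hn
      have := h.eq_of_subset hC (by
        intro e
        simp only [Finset.mem_insert, Finset.mem_singleton]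
        rintro (rfl | rfl | rfl | rfl | rfl) <;> assumption) (by omega)
      exact Or.inr (Or.inr ⟨by rw [this]; exact hc, f, b, c, d, e, hn, this⟩)
    exfalso
    obtain ⟨x, hxb, hax⟩ := h.exists_next (show s(b, a) ∈ S by rwa [Sym2.eq_swap])
    have hsub : ({s(a, x), s(a, b), s(b, c), s(c, d), s(d, e), s(e, f)} : Finset (Sym2 V)) ⊆ S := by
      intro e
      simp only [Finset.mem_insert, Finset.mem_singleton]
      rintro (rfl | rfl | rfl | rfl | rfl | rfl) <;> assumption
    have := Finset.card_le_card hsub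
    rw [Finset.card_insert_of_notMem, Finset.card_insert_of_notMem, Finset.card_insert_of_notMem,
      Finset.card_insert_of_notMem, Finset.card_insert_of_notMem, Finset.card_singleton] at this
    · omega
    all_goals
      simp only [Finset.mem_singleton, Finset.mem_insert, Sym2.eq_iff]
      grind

end evensets

section facelen
open scoped Classical

theorem Borders.symm {V ι : Type*} {G : SimpleGraph V} {L : V → V → ι} {i : ι}
    {u v : V} (h : Borders G L i u v) : Borders G L i v u :=
  ⟨h.1.symm, h.2.1.symm, h.2.2.symm⟩

variable {V ι : Type*} [Fintype V] {G : SimpleGraph V} {L : V → V → ι}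

variable (G L) in
/-- The edges on the boundary of a face. -/
noncomputable def faceEdges (i : ι) : Finset (Sym2 V) :=
  Finset.univ.filter fun e => ∃ u v, e = s(u, v) ∧ Borders G L i u v

variable (G L) in
/-- The length of a face. -/
noncomputable def faceLen (i : ι) : ℕ := (faceEdges G L i).card

theorem mem_faceEdges {i : ι} {u v : V} : s(u, v) ∈ faceEdges G L i ↔ Borders G L i u v := by
  simp only [faceEdges, Finset.mem_filter, Finset.mem_univ, true_and]
  constructor
  · rintro ⟨x, y, hxy, h⟩
    rcases Sym2.eq_iff.1 hxy with ⟨rfl, rfl⟩ | ⟨rfl, rfl⟩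
    · exact h
    · exact h.symm
  · exact fun h => ⟨u, v, rfl, h⟩

theorem FaceSystem.evenEdges (hF : FaceSystem G L) (i : ι) : EvenEdges (faceEdges G L i) := by
  constructor
  · intro e
    induction e with
    | _ a b =>
      rw [mem_faceEdges, Sym2.mk_isDiag_iff]
      exact fun h => h.1.ne
  · intro v
    have h1 : (faceEdges G L i).filter (fun e => v ∈ e) =
        (Finset.univ.filter fun w => Borders G L i v w).image fun w => s(v, w) := by
      ext e
      simp only [Finset.mem_filter, Finset.mem_image, Finset.mem_univ, true_and]
      constructor
      · rintro ⟨h, w, rfl⟩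
        exact ⟨w, mem_faceEdges.1 h, rfl⟩
      · rintro ⟨w, hw, rfl⟩
        exact ⟨mem_faceEdges.2 hw, Sym2.mem_mk_left v w⟩
    rw [h1, Finset.card_image_of_injective _ (fun x y h => Sym2.congr_right.1 h),
      ← ZMod.natCast_eq_zero_iff_even, Finset.card_filter, Nat.cast_sum, ← hF.even i v]
    refine Finset.sum_congr rfl fun w _ => ?_
    unfold Borders
    by_cases ha : G.Adj v w
    · by_cases hl : L v w = L w v
      · rw [hl]
        simp [ZMod.two_add_self]
      · by_cases h2 : L v w = i <;> by_cases h3 : L w v = i <;> simp_all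
    · simp [ha]

theorem FaceSystem.three_le_faceLen (hF : FaceSystem G L) {i : ι} {u v : V}
    (h : Borders G L i u v) : 3 ≤ faceLen G L i :=
  (hF.evenEdges i).three_le_card ⟨_, mem_faceEdges.2 h⟩

theorem FaceSystem.even_card_borders (hF : FaceSystem G L) (i : ι) {v a : V}
    (h : Borders G L i v a) : ∃ b, b ≠ a ∧ Borders G L i v b := by
  obtain ⟨b, hb, hm⟩ := (hF.evenEdges i).exists_next (mem_faceEdges.2 h.symm)
  exact ⟨b, hb, mem_faceEdges.1 hm⟩

theorem card_darts_face (i : ι) :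
    ((Finset.univ : Finset (V × V)).filter fun p => G.Adj p.1 p.2 ∧ L p.1 p.2 ≠ L p.2 p.1 ∧
      L p.1 p.2 = i).card = faceLen G L i := by
  refine Finset.card_bij (fun p _ => s(p.1, p.2)) ?_ ?_ ?_
  · rintro ⟨u, v⟩ h
    rw [Finset.mem_filter] at h
    exact mem_faceEdges.2 ⟨h.2.1, h.2.2.1, Or.inl h.2.2.2⟩
  · rintro ⟨u, v⟩ h ⟨x, y⟩ h' he
    rw [Finset.mem_filter] at h h'
    rcases Sym2.eq_iff.1 he with ⟨h1, h2⟩ | ⟨h1, h2⟩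
    · exact Prod.ext h1 h2
    · simp only at h1 h2 h h'
      subst h1 h2
      exact absurd (h'.2.2.2.trans h.2.2.2.symm) h'.2.2.1
  · intro e he
    induction e with
    | _ a b =>
      obtain ⟨h1, h2, h3⟩ := mem_faceEdges.1 he
      rcases h3 with h3 | h3
      · exact ⟨(a, b), Finset.mem_filter.2 ⟨Finset.mem_univ _, h1, h2, h3⟩, rfl⟩
      · exact ⟨(b, a), Finset.mem_filter.2 ⟨Finset.mem_univ _, h1.symm, h2.symm, h3⟩,
          Sym2.eq_swap⟩

variable (G) in
/-- The darts of `G`, as ordered pairs. -/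
noncomputable def dartPairs : Finset (V × V) := Finset.univ.filter fun p => G.Adj p.1 p.2

theorem mem_dartPairs {u v : V} : (u, v) ∈ dartPairs G ↔ G.Adj u v := by
  simp [dartPairs]

theorem card_dartPairs : (dartPairs G).card = 2 * Fintype.card G.edgeSet := by
  rw [← SimpleGraph.edgeFinset_card, ← SimpleGraph.dart_card_eq_twice_card_edges,
    ← Finset.card_univ]
  symm
  refine Finset.card_bij (fun d _ => d.toProd) ?_ ?_ ?_
  · intro d _
    exact mem_dartPairs.2 d.adj
  · intro d _ d' _ h
    exact SimpleGraph.Dart.ext _ _ h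
  · rintro ⟨u, v⟩ h
    exact ⟨⟨(u, v), mem_dartPairs.1 h⟩, Finset.mem_univ _, rfl⟩

theorem sum_faceLen_le [Fintype ι] :
    ∑ i ∈ usedFaces G L, faceLen G L i ≤ 2 * Fintype.card G.edgeSet := by
  simp_rw [← card_darts_face]
  rw [← Finset.card_biUnion, ← card_dartPairs]
  · refine Finset.card_le_card fun p hp => ?_
    obtain ⟨i, -, h⟩ := Finset.mem_biUnion.1 hp
    exact mem_dartPairs.2 (Finset.mem_filter.1 h).2.1
  · intro i _ j _ hij
    rw [Function.onFun, Finset.disjoint_left]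
    intro p hp hp'
    rw [Finset.mem_filter] at hp hp'
    exact hij (hp.2.2.2.symm.trans hp'.2.2.2)

end facelen

section nice
open scoped Classical

/-- The graphs and face systems to which discharging applies: those left once vertices of degree at
most two, adjacent vertices of degree three and cut vertices are excluded. -/
structure Nice {V ι : Type*} [Fintype V] (G : SimpleGraph V) (L : V → V → ι) : Prop where
  faces : FaceSystem G L
  free : Theta6Free G
  nocut : ∀ v, NoCut G v
  deg3 : ∀ v a b, ∃ c, G.Adj v c ∧ c ≠ a ∧ c ≠ b
  nadj : ∀ u v, G.Adj u v → ∀ a b c d, (∀ w, G.Adj u w → w = v ∨ w = a ∨ w = b) →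
    (∀ w, G.Adj v w → w = u ∨ w = c ∨ w = d) → False
  noK5 : ∀ p : Fin 5 → V, Function.Injective p → ¬ ∀ i j, i ≠ j → G.Adj (p i) (p j)
  big : ∀ a b c d e : V, ∃ w, w ≠ a ∧ w ≠ b ∧ w ≠ c ∧ w ≠ d ∧ w ≠ e

/-- The face `i` is the triangle `abc`. -/
structure IsTri {V ι : Type*} [Fintype V] (G : SimpleGraph V) (L : V → V → ι) (i : ι)
    (a b c : V) : Prop where
  len : faceLen G L i = 3
  ab : Borders G L i a b
  bc : Borders G L i b c
  ca : Borders G L i c a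

/-- The face `i` is the quadrangle `abcd`. -/
structure IsQuad {V ι : Type*} [Fintype V] (G : SimpleGraph V) (L : V → V → ι) (i : ι)
    (a b c d : V) : Prop where
  len : faceLen G L i = 4
  ab : Borders G L i a b
  bc : Borders G L i b c
  cd : Borders G L i c d
  da : Borders G L i d a
  ac : a ≠ c
  bd : b ≠ d

/-- The face `i` is the pentagon `abcde`. -/
structure IsPent {V ι : Type*} [Fintype V] (G : SimpleGraph V) (L : V → V → ι) (i : ι)
    (a b c d e : V) : Prop where
  len : faceLen G L i = 5
  ab : Borders G L i a b
  bc : Borders G L i b c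
  cd : Borders G L i c d
  de : Borders G L i d e
  ea : Borders G L i e a
  ac : a ≠ c
  ad : a ≠ d
  bd : b ≠ d
  be : b ≠ e
  ce : c ≠ e

variable {V ι : Type*} {G : SimpleGraph V} {L : V → V → ι}

local notation "Bd" => Borders G L

theorem Borders.adj {i : ι} {u v : V} (h : Bd i u v) : G.Adj u v := h.1

theorem Borders.ne {i : ι} {u v : V} (h : Bd i u v) : u ≠ v := h.1.ne

theorem Borders.eq_or {i j k : ι} {u v : V} (hi : Bd i u v) (hj : Bd j u v) (hij : i ≠ j)
    (hk : Bd k u v) : k = i ∨ k = j := by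
  unfold Borders at hi hj hk
  grind

theorem Borders.exists_other {i : ι} {u v : V} (h : Bd i u v) : ∃ j, j ≠ i ∧ Bd j u v := by
  obtain ⟨h1, h2, h3⟩ := h
  rcases h3 with h3 | h3
  · exact ⟨L v u, fun h => h2 (h3.trans h.symm), h1, h2, Or.inr rfl⟩
  · exact ⟨L u v, fun h => h2 (h.trans h3.symm), h1, h2, Or.inl rfl⟩

theorem Borders.ite_add {i j : ι} {v a : V} (hi : Bd i v a) (hj : Bd j v a) (hij : i ≠ j)
    (f : ι) : ((if L v a = f then 1 else 0) + (if L a v = f then 1 else 0) : ZMod 2) =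
      (if i = f then 1 else 0) + (if j = f then 1 else 0) := by
  obtain ⟨-, h1, h2⟩ := hi
  obtain ⟨-, -, h3⟩ := hj
  rcases h2 with rfl | rfl <;> rcases h3 with rfl | rfl
  · exact absurd rfl hij
  · rfl
  · rw [add_comm]
  · exact absurd rfl hij

variable [Fintype V]

local notation "Tri" => IsTri G L
local notation "Quad" => IsQuad G L
local notation "Pent" => IsPent G L

theorem IsTri.rot {i : ι} {a b c : V} (h : Tri i a b c) : Tri i b c a :=
  ⟨h.len, h.bc, h.ca, h.ab⟩

theorem IsTri.swap {i : ι} {a b c : V} (h : Tri i a b c) : Tri i b a c :=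
  ⟨h.len, h.ab.symm, h.ca.symm, h.bc.symm⟩

theorem IsQuad.swap {i : ι} {a b c d : V} (h : Quad i a b c d) : Quad i b a d c :=
  ⟨h.len, h.ab.symm, h.da.symm, h.cd.symm, h.bc.symm, h.bd, h.ac⟩

theorem IsPent.swap {i : ι} {a b c d e : V} (h : Pent i a b c d e) : Pent i b a e d c :=
  ⟨h.len, h.ab.symm, h.ea.symm, h.de.symm, h.cd.symm, h.bc.symm, h.be, h.bd, h.ad, h.ac,
    h.ce.symm⟩

theorem IsTri.faceEdges_eq (hF : FaceSystem G L) {i : ι} {a b c : V} (h : Tri i a b c) :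
    faceEdges G L i = {s(a, b), s(b, c), s(c, a)} := by
  have h1 := evenEdges_tri (a := a) (b := b) (c := c) (by
    have := h.ab.ne
    have := h.bc.ne
    have := h.ca.ne
    simp only [List.nodup_cons, List.mem_cons, List.not_mem_nil]; grind)
  refine (hF.evenEdges i).eq_of_subset h1.1 ?_ ?_
  · intro e
    simp only [Finset.mem_insert, Finset.mem_singleton]
    rintro (rfl | rfl | rfl)
    exacts [mem_faceEdges.2 h.ab, mem_faceEdges.2 h.bc, mem_faceEdges.2 h.ca]
  · have := h.len
    unfold faceLen at this
    omega

theorem IsTri.bd (hF : FaceSystem G L) {i : ι} {a b c u v : V} (h : Tri i a b c)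
    (h1 : Bd i u v) : (u = a ∧ v = b) ∨ (u = b ∧ v = a) ∨ (u = b ∧ v = c) ∨ (u = c ∧ v = b) ∨
      (u = c ∧ v = a) ∨ (u = a ∧ v = c) := by
  have := mem_faceEdges.2 h1
  rw [h.faceEdges_eq hF] at this
  simp only [Finset.mem_insert, Finset.mem_singleton, Sym2.eq_iff] at this
  tauto

theorem FaceSystem.exists_tri (hF : FaceSystem G L) {i : ι} {a b : V} (h : Bd i a b)
    (hl : faceLen G L i = 3) : ∃ c, Tri i a b c := by
  have h0 := mem_faceEdges.2 h
  have hl' : (faceEdges G L i).card = 3 := hl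
  rcases (hF.evenEdges i).classify ⟨_, h0⟩ (by omega) with
    ⟨h1, x, y, z, hn, he⟩ | ⟨h1, -⟩ | ⟨h1, -⟩
  · have m1 : Bd i x y := mem_faceEdges.1 (by rw [he]; simp)
    have m2 : Bd i y z := mem_faceEdges.1 (by rw [he]; simp)
    have m3 : Bd i z x := mem_faceEdges.1 (by rw [he]; simp)
    have t : Tri i x y z := ⟨hl, m1, m2, m3⟩
    rw [he] at h0
    simp only [Finset.mem_insert, Finset.mem_singleton, Sym2.eq_iff] at h0
    rcases h0 with (⟨rfl, rfl⟩ | ⟨rfl, rfl⟩) | (⟨rfl, rfl⟩ | ⟨rfl, rfl⟩) | (⟨rfl, rfl⟩ | ⟨rfl, rfl⟩)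
    exacts [⟨_, t⟩, ⟨_, t.swap⟩, ⟨_, t.rot⟩, ⟨_, t.rot.swap⟩, ⟨_, t.rot.rot⟩, ⟨_, t.rot.rot.swap⟩]
  · omega
  · omega

theorem FaceSystem.exists_quad (hF : FaceSystem G L) {i : ι} {a b : V} (h : Bd i a b)
    (hl : faceLen G L i = 4) : ∃ c d, Quad i a b c d := by
  have h0 := mem_faceEdges.2 h
  have hl' : (faceEdges G L i).card = 4 := hl
  rcases (hF.evenEdges i).classify ⟨_, h0⟩ (by omega) with
    ⟨h1, -⟩ | ⟨h1, x, y, z, w, hn, he⟩ | ⟨h1, -⟩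
  · omega
  · have m1 : Bd i x y := mem_faceEdges.1 (by rw [he]; simp)
    have m2 : Bd i y z := mem_faceEdges.1 (by rw [he]; simp)
    have m3 : Bd i z w := mem_faceEdges.1 (by rw [he]; simp)
    have m4 : Bd i w x := mem_faceEdges.1 (by rw [he]; simp)
    simp only [List.nodup_cons, List.mem_cons, List.not_mem_nil] at hn
    have n1 : x ≠ z := by grind
    have n2 : y ≠ w := by grind
    have t : Quad i x y z w := ⟨hl, m1, m2, m3, m4, n1, n2⟩
    have rot : ∀ {x y z w}, Quad i x y z w → Quad i y z w x := fun h =>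
      ⟨h.len, h.bc, h.cd, h.da, h.ab, h.bd, h.ac.symm⟩
    rw [he] at h0
    simp only [Finset.mem_insert, Finset.mem_singleton, Sym2.eq_iff] at h0
    rcases h0 with (⟨rfl, rfl⟩ | ⟨rfl, rfl⟩) | (⟨rfl, rfl⟩ | ⟨rfl, rfl⟩) |
      (⟨rfl, rfl⟩ | ⟨rfl, rfl⟩) | (⟨rfl, rfl⟩ | ⟨rfl, rfl⟩)
    exacts [⟨_, _, t⟩, ⟨_, _, t.swap⟩, ⟨_, _, rot t⟩, ⟨_, _, (rot t).swap⟩, ⟨_, _, rot (rot t)⟩,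
      ⟨_, _, (rot (rot t)).swap⟩, ⟨_, _, rot (rot (rot t))⟩, ⟨_, _, (rot (rot (rot t))).swap⟩]
  · omega

theorem FaceSystem.exists_pent (hF : FaceSystem G L) {i : ι} {a b : V} (h : Bd i a b)
    (hl : faceLen G L i = 5) : ∃ c d e, Pent i a b c d e := by
  have h0 := mem_faceEdges.2 h
  have hl' : (faceEdges G L i).card = 5 := hl
  rcases (hF.evenEdges i).classify ⟨_, h0⟩ (by omega) with
    ⟨h1, -⟩ | ⟨h1, -⟩ | ⟨h1, x, y, z, w, u, hn, he⟩
  · omega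
  · omega
  · have m1 : Bd i x y := mem_faceEdges.1 (by rw [he]; simp)
    have m2 : Bd i y z := mem_faceEdges.1 (by rw [he]; simp)
    have m3 : Bd i z w := mem_faceEdges.1 (by rw [he]; simp)
    have m4 : Bd i w u := mem_faceEdges.1 (by rw [he]; simp)
    have m5 : Bd i u x := mem_faceEdges.1 (by rw [he]; simp)
    simp only [List.nodup_cons, List.mem_cons, List.not_mem_nil] at hn
    have t : Pent i x y z w u := ⟨hl, m1, m2, m3, m4, m5, by grind, by grind, by grind, by grind,
      by grind⟩
    have rot : ∀ {x y z w u}, Pent i x y z w u → Pent i y z w u x := fun h =>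
      ⟨h.len, h.bc, h.cd, h.de, h.ea, h.ab, h.bd, h.be, h.ce, h.ac.symm, h.ad.symm⟩
    rw [he] at h0
    simp only [Finset.mem_insert, Finset.mem_singleton, Sym2.eq_iff] at h0
    rcases h0 with (⟨rfl, rfl⟩ | ⟨rfl, rfl⟩) | (⟨rfl, rfl⟩ | ⟨rfl, rfl⟩) |
      (⟨rfl, rfl⟩ | ⟨rfl, rfl⟩) | (⟨rfl, rfl⟩ | ⟨rfl, rfl⟩) | (⟨rfl, rfl⟩ | ⟨rfl, rfl⟩)
    exacts [⟨_, _, _, t⟩, ⟨_, _, _, t.swap⟩, ⟨_, _, _, rot t⟩, ⟨_, _, _, (rot t).swap⟩,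
      ⟨_, _, _, rot (rot t)⟩, ⟨_, _, _, (rot (rot t)).swap⟩, ⟨_, _, _, rot (rot (rot t))⟩,
      ⟨_, _, _, (rot (rot (rot t))).swap⟩, ⟨_, _, _, rot (rot (rot (rot t)))⟩,
      ⟨_, _, _, (rot (rot (rot (rot t)))).swap⟩]

namespace Nice

variable (h : Nice G L)
include h

theorem face_ne {u v : V} (huv : G.Adj u v) : L u v ≠ L v u := by
  intro he
  obtain ⟨w, hw, hne, -⟩ := h.deg3 u v v
  obtain ⟨z, hz1, hz2, hz3, hz4, -⟩ := (h.nocut u).exists_cycle huv hw hne.symm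
  obtain ⟨g, hg⟩ := h.faces.span z hz1 hz2 hz3
  have := hg u v huv
  rw [he, hz4, ZMod.two_add_self] at this
  exact absurd this (by decide)

theorem bd_left {u v : V} (huv : G.Adj u v) : Bd (L u v) u v :=
  ⟨huv, h.face_ne huv, Or.inl rfl⟩

variable [Fintype ι]

theorem not_two_common {v a b : V} (hab : a ≠ b) {i j : ι} (hij : i ≠ j) (ia : Bd i v a)
    (ib : Bd i v b) (ja : Bd j v a) (jb : Bd j v b) : False := by
  have := h.faces.closure (h.nocut v) {a, b} (by
    intro w hw
    simp only [Finset.mem_insert, Finset.mem_singleton] at hw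
    rcases hw with rfl | rfl
    exacts [ia.adj, ib.adj]) ⟨a, by simp⟩ (by
    intro f
    rw [Finset.sum_pair hab, ia.ite_add ja hij, ib.ite_add jb hij, ZMod.two_add_self])
  obtain ⟨c, hc, hca, hcb⟩ := h.deg3 v a b
  have := this c hc
  simp only [Finset.mem_insert, Finset.mem_singleton] at this
  tauto

theorem nbr_three {v a b c : V} (hab : a ≠ b) (hbc : b ≠ c) (hca : c ≠ a) {i j k : ι}
    (hij : i ≠ j) (hjk : j ≠ k) (hki : k ≠ i) (ia : Bd i v a) (ib : Bd i v b) (jb : Bd j v b)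
    (jc : Bd j v c) (kc : Bd k v c) (ka : Bd k v a) {w : V} (hw : G.Adj v w) :
    w = a ∨ w = b ∨ w = c := by
  have := h.faces.closure (h.nocut v) {a, b, c} (by
    intro w hw
    simp only [Finset.mem_insert, Finset.mem_singleton] at hw
    rcases hw with rfl | rfl | rfl
    exacts [ia.adj, ib.adj, jc.adj]) ⟨a, by simp⟩ (by
    intro f
    rw [Finset.sum_insert (by simp; grind), Finset.sum_pair hbc, ia.ite_add ka hki.symm,
      ib.ite_add jb hij, jc.ite_add kc hjk]
    generalize (if i = f then (1 : ZMod 2) else 0) = x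
    generalize (if j = f then (1 : ZMod 2) else 0) = y
    generalize (if k = f then (1 : ZMod 2) else 0) = z
    revert x y z
    decide) w hw
  simpa using this

theorem nbr_four {v a b c d : V} (hab : a ≠ b) (hac : a ≠ c) (had : a ≠ d) (hbc : b ≠ c)
    (hbd : b ≠ d) (hcd : c ≠ d) {i j k l : ι} (hij : i ≠ j) (hjk : j ≠ k) (hkl : k ≠ l)
    (hli : l ≠ i) (ia : Bd i v a) (ib : Bd i v b) (jb : Bd j v b) (jc : Bd j v c) (kc : Bd k v c)
    (kd : Bd k v d) (ld : Bd l v d) (la : Bd l v a) {w : V} (hw : G.Adj v w) :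
    w = a ∨ w = b ∨ w = c ∨ w = d := by
  have := h.faces.closure (h.nocut v) {a, b, c, d} (by
    intro w hw
    simp only [Finset.mem_insert, Finset.mem_singleton] at hw
    rcases hw with rfl | rfl | rfl | rfl
    exacts [ia.adj, ib.adj, jc.adj, kd.adj]) ⟨a, by simp⟩ (by
    intro f
    rw [Finset.sum_insert (by simp; grind), Finset.sum_insert (by simp; grind),
      Finset.sum_pair hcd, ia.ite_add la hli.symm,
      ib.ite_add jb hij, jc.ite_add kc hjk, kd.ite_add ld hkl]
    generalize (if i = f then (1 : ZMod 2) else 0) = x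
    generalize (if j = f then (1 : ZMod 2) else 0) = y
    generalize (if k = f then (1 : ZMod 2) else 0) = z
    generalize (if l = f then (1 : ZMod 2) else 0) = t
    revert x y z t
    decide) w hw
  simpa using this

end Nice

end nice

section clusters
open scoped Classical

theorem Theta6Free.short {V : Type*} {G : SimpleGraph V} (hG : Theta6Free G) {a b c d e f : V}
    (h1 : G.Adj a b) (h2 : G.Adj b c) (h3 : G.Adj c d)
    (h4 : G.Adj d e) (h5 : G.Adj e f) (h6 : G.Adj f a) (h7 : G.Adj a c)
    (hn : a ≠ d ∧ a ≠ e ∧ b ≠ d ∧ b ≠ e ∧ b ≠ f ∧ c ≠ e ∧ c ≠ f ∧ d ≠ f) : False := by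
  refine hG.hex2 h1 h2 h3 h4 h5 h6 h7 ?_
  simp [h1.ne, h2.ne, h3.ne, h4.ne, h5.ne, h6.ne', h7.ne, hn]

theorem Theta6Free.long {V : Type*} {G : SimpleGraph V} (hG : Theta6Free G) {a b c d e f : V}
    (h1 : G.Adj a b) (h2 : G.Adj b c) (h3 : G.Adj c d)
    (h4 : G.Adj d e) (h5 : G.Adj e f) (h6 : G.Adj f a) (h7 : G.Adj a d)
    (hn : a ≠ c ∧ a ≠ e ∧ b ≠ d ∧ b ≠ e ∧ b ≠ f ∧ c ≠ e ∧ c ≠ f ∧ d ≠ f) : False := by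
  refine hG.hex3 h1 h2 h3 h4 h5 h6 h7 ?_
  simp [h1.ne, h2.ne, h3.ne, h4.ne, h5.ne, h6.ne', h7.ne, hn]

/-- The three triangular faces around the vertex `b` of degree three with neighbours `a`, `c`,
`x`. -/
structure IsCtr {V ι : Type*} [Fintype V] (G : SimpleGraph V) (L : V → V → ι) (b a c x : V)
    (i j k : ι) : Prop where
  t1 : IsTri G L i b a c
  t2 : IsTri G L j b a x
  t3 : IsTri G L k b c x
  ij : i ≠ j
  ik : i ≠ k
  jk : j ≠ k

variable {V ι : Type*} [Fintype V] {G : SimpleGraph V} {L : V → V → ι}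

local notation "Bd" => Borders G L
local notation "Tri" => IsTri G L
local notation "Quad" => IsQuad G L
local notation "Ctr" => IsCtr G L

variable (G L) in
/-- The face is one of three triangular faces around a vertex. -/
def Grp (i : ι) : Prop := ∃ b a c x j k, IsCtr G L b a c x i j k

theorem IsCtr.swap {b a c x : V} {i j k : ι} (C : Ctr b a c x i j k) : Ctr b c a x i k j :=
  ⟨C.t1.rot.rot.swap, C.t3, C.t2, C.ik, C.ij, C.jk.symm⟩

theorem IsCtr.swap' {b a c x : V} {i j k : ι} (C : Ctr b a c x i j k) : Ctr b a x c j i k :=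
  ⟨C.t2, C.t1, C.t3.rot.rot.swap, C.ij.symm, C.jk, C.ik⟩

theorem IsCtr.ne {b a c x : V} {i j k : ι} (C : Ctr b a c x i j k) :
    a ≠ b ∧ c ≠ b ∧ x ≠ b ∧ a ≠ c ∧ a ≠ x ∧ c ≠ x :=
  ⟨C.t1.ab.ne.symm, C.t1.ca.ne, C.t2.ca.ne, C.t1.bc.ne, C.t2.bc.ne, C.t3.bc.ne⟩

namespace Nice

variable (h : Nice G L)
include h

/-- Four vertices whose neighbours all lie among five vertices. -/
theorem not_closed {p q r s t : V} (hpt : p ≠ t)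
    (hp : ∀ w, G.Adj p w → w = p ∨ w = q ∨ w = r ∨ w = s ∨ w = t)
    (hq : ∀ w, G.Adj q w → w = p ∨ w = q ∨ w = r ∨ w = s ∨ w = t)
    (hr : ∀ w, G.Adj r w → w = p ∨ w = q ∨ w = r ∨ w = s ∨ w = t)
    (hs : ∀ w, G.Adj s w → w = p ∨ w = q ∨ w = r ∨ w = s ∨ w = t) : False := by
  obtain ⟨w, w1, w2, w3, w4, w5⟩ := h.big p q r s t
  have hw := h.nocut t p w hpt w5
  have key : ∀ y, Relation.ReflTransGen (fun x y => G.Adj x y ∧ x ≠ t ∧ y ≠ t) p y →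
      y = p ∨ y = q ∨ y = r ∨ y = s := by
    intro y hy
    induction hy with
    | refl => exact Or.inl rfl
    | tail _ hxy ih =>
      obtain ⟨h1, -, h3⟩ := hxy
      rcases ih with rfl | rfl | rfl | rfl
      · have := hp _ h1; tauto
      · have := hq _ h1; tauto
      · have := hr _ h1; tauto
      · have := hs _ h1; tauto
  have := key w hw
  tauto

variable [Fintype ι]

theorem ctr_nbr {b a c x : V} {i j k : ι} (C : Ctr b a c x i j k) {w : V} (hw : G.Adj b w) :
    w = a ∨ w = c ∨ w = x := by
  obtain ⟨-, -, -, n1, n2, n3⟩ := C.ne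
  exact h.nbr_three n1 n3 n2.symm C.ik C.jk.symm C.ij.symm C.t1.ab C.t1.ca.symm C.t3.ab
    C.t3.ca.symm C.t2.ca.symm C.t2.ab hw

theorem ctr_face {b a c x : V} {i j k F : ι} (C : Ctr b a c x i j k) {w : V} (hF : Bd F b w) :
    F = i ∨ F = j ∨ F = k := by
  rcases h.ctr_nbr C hF.adj with rfl | rfl | rfl
  · rcases C.t1.ab.eq_or C.t2.ab C.ij hF with h | h <;> tauto
  · rcases C.t1.ca.symm.eq_or C.t3.ab C.ik hF with h | h <;> tauto
  · rcases C.t2.ca.symm.eq_or C.t3.ca.symm C.jk hF with h | h <;> tauto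

theorem ctr_len {b a c x : V} {i j k F : ι} (C : Ctr b a c x i j k) {w : V} (hF : Bd F b w) :
    faceLen G L F = 3 := by
  rcases h.ctr_face C hF with rfl | rfl | rfl
  exacts [C.t1.len, C.t2.len, C.t3.len]

/-- A vertex adjacent to the centre of a group has a fourth neighbour. -/
theorem ctr_no_face {b a c x : V} {i j k F : ι} (C : Ctr b a c x i j k) (hFi : F ≠ i)
    (h1 : Bd F a c) (h2 : Bd F a x) : False := by
  obtain ⟨m1, m2, m3, n1, n2, n3⟩ := C.ne
  have hFj : F ≠ j := by
    rintro rfl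
    have := C.t2.bd h.faces h1
    grind
  have := fun w (hw : G.Adj a w) => h.nbr_three m2.symm n3 m3 hFi.symm hFj C.ij.symm C.t1.ab.symm
    C.t1.bc h1 h2 C.t2.bc C.t2.ab.symm hw
  exact h.nadj b a C.t1.ab.adj c x c x (fun w hw => by have := h.ctr_nbr C hw; tauto)
    (fun w hw => by have := this w hw; tauto)

theorem ctr_not_quad {b a c x u v : V} {i j k F : ι} (C : Ctr b a c x i j k)
    (hQ : Quad F a c u v) : False := by
  have hl := hQ.len
  have hFi : F ≠ i := by
    rintro rfl
    have := C.t1.len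
    omega
  obtain ⟨m1, m2, m3, n1, n2, n3⟩ := C.ne
  have hub : u ≠ b := by
    rintro rfl
    have := h.ctr_len C hQ.bc.symm
    omega
  have hvb : v ≠ b := by
    rintro rfl
    have := h.ctr_len C hQ.da
    omega
  have hux : u ≠ x := by
    rintro rfl
    exact h.ctr_no_face C.swap hFi hQ.ab.symm hQ.bc
  have hvx : v ≠ x := by
    rintro rfl
    exact h.ctr_no_face C hFi hQ.ab hQ.da.symm
  have := hQ.ac
  have := hQ.bd
  exact h.free.long hQ.da.symm.adj hQ.cd.symm.adj hQ.bc.symm.adj C.t1.ca.adj C.t2.ca.symm.adj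
    C.t2.bc.symm.adj hQ.ab.adj (by grind)

theorem outer_ne {b a c x z : V} {i j k o : ι} (C : Ctr b a c x i j k) (hT : Tri o a c z)
    (ho : o ≠ i) : z ≠ b ∧ z ≠ x ∧ z ≠ a ∧ z ≠ c ∧ o ≠ j ∧ o ≠ k := by
  obtain ⟨m1, m2, m3, n1, n2, n3⟩ := C.ne
  have hj : o ≠ j := by
    rintro rfl
    have := C.t2.bd h.faces hT.ab
    grind
  have hk : o ≠ k := by
    rintro rfl
    have := C.t3.bd h.faces hT.ab
    grind
  refine ⟨?_, ?_, hT.ca.ne, hT.bc.ne.symm, hj, hk⟩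
  · rintro rfl
    rcases h.ctr_face C hT.ca <;> tauto
  · rintro rfl
    exact h.ctr_no_face C ho hT.ab hT.ca.symm

theorem outer_tri_side {b a c x z u : V} {i j k o F : ι} (C : Ctr b a c x i j k)
    (hT : Tri o a c z) (ho : o ≠ i) (hF : F ≠ o) (hU : Tri F a z u) : u = x := by
  obtain ⟨m1, m2, m3, n1, n2, n3⟩ := C.ne
  obtain ⟨z1, z2, z3, z4, oj, ok⟩ := h.outer_ne C hT ho
  by_contra hux
  have huc : u ≠ c := by
    rintro rfl
    exact h.not_two_common n1 hF hU.ab.symm hU.bc hT.ca hT.bc.symm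
  have hub : u ≠ b := by
    rintro rfl
    rcases h.ctr_face C hU.ca with rfl | rfl | rfl
    · have := C.t1.bd h.faces hU.ab; grind
    · have := C.t2.bd h.faces hU.ab; grind
    · have := C.t3.bd h.faces hU.ab; grind
  exact h.free.long hU.ca.symm.adj hU.bc.symm.adj hT.bc.symm.adj C.t1.ca.adj C.t2.ca.symm.adj
    C.t2.bc.symm.adj hT.ab.adj (by grind)

theorem outer_not_quad {b a c x z p q : V} {i j k o F : ι} (C : Ctr b a c x i j k)
    (hT : Tri o a c z) (ho : o ≠ i) (hQ : Quad F a z p q) : False := by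
  obtain ⟨m1, m2, m3, n1, n2, n3⟩ := C.ne
  obtain ⟨z1, z2, z3, z4, oj, ok⟩ := h.outer_ne C hT ho
  have hl := hQ.len
  have l1 := C.t1.len
  have l4 := hT.len
  have hF : F ≠ o := by rintro rfl; omega
  have hpc : p ≠ c := by
    rintro rfl
    exact h.not_two_common n1 hF hQ.ab.symm hQ.bc hT.ca hT.bc.symm
  have hqc : q ≠ c := by
    rintro rfl
    rcases hT.ab.eq_or C.t1.bc ho hQ.da.symm with rfl | rfl <;> omega
  have hpb : p ≠ b := by
    rintro rfl
    have := h.ctr_len C hQ.cd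
    omega
  have hqb : q ≠ b := by
    rintro rfl
    have := h.ctr_len C hQ.da
    omega
  have := hQ.ac
  have := hQ.bd
  exact h.free.short C.t1.ca.adj C.t1.ab.adj hQ.da.symm.adj hQ.cd.symm.adj hQ.bc.symm.adj
    hT.bc.symm.adj C.t1.bc.symm.adj (by grind)

theorem outer_tri_eq {b a c x z u : V} {i j k o F : ι} (C : Ctr b a c x i j k)
    (hT : Tri o a c z) (ho : o ≠ i) (hF : F ≠ j) (hU : Tri F a x u) : u = z := by
  obtain ⟨m1, m2, m3, n1, n2, n3⟩ := C.ne
  obtain ⟨z1, z2, z3, z4, oj, ok⟩ := h.outer_ne C hT ho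
  obtain ⟨u1, u2, u3, u4, -, -⟩ := h.outer_ne C.swap' hU hF
  by_contra huz
  exact h.free.short hT.ca.symm.adj hT.bc.symm.adj C.t1.ca.adj C.t2.ca.symm.adj hU.bc.adj
    hU.ca.adj hT.ab.adj (by grind)

/-- A common face beyond the outer edges of a cluster. -/
theorem cluster_no_common {b a c x z : V} {i j k o m F : ι} (C : Ctr b a c x i j k)
    (hT : Tri o a c z) (ho : o ≠ i) (hU : Tri m a x z) (hm : m ≠ j) (h1 : Bd F c x)
    (hFk : F ≠ k) (h2 : Bd F c z) (hFo : F ≠ o) (h3 : Bd F x z) (hFm : F ≠ m) : False := by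
  obtain ⟨m1, m2, m3, n1, n2, n3⟩ := C.ne
  obtain ⟨z1, z2, z3, z4, oj, ok⟩ := h.outer_ne C hT ho
  obtain ⟨-, -, -, -, mi, mk⟩ := h.outer_ne C.swap' hU hm
  have om : o ≠ m := by
    rintro rfl
    have := hT.bd h.faces hU.ab
    grind
  refine h.not_closed (p := b) (q := a) (r := c) (s := z) (t := x) m3.symm ?_ ?_ ?_ ?_
  · intro w hw
    have := h.ctr_nbr C hw
    tauto
  · intro w hw
    have := h.nbr_four (v := a) (a := b) (b := c) (c := z) (d := x) m2.symm z1.symm m3.symm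
      z4.symm n3 z2 ho.symm om hm C.ij.symm C.t1.ab.symm C.t1.bc hT.ab hT.ca.symm hU.ca.symm
      hU.ab C.t2.bc C.t2.ab.symm hw
    tauto
  · intro w hw
    have := h.nbr_four (v := c) (a := b) (b := a) (c := z) (d := x) m1.symm z1.symm m3.symm
      z3.symm n2 z2 ho.symm hFo.symm hFk C.ik.symm C.t1.ca C.t1.bc.symm hT.ab.symm hT.bc h2
      h1 C.t3.bc C.t3.ab.symm hw
    tauto
  · intro w hw
    have := h.nbr_three (v := z) (a := a) (b := c) (c := x) n1 n3 n2.symm hFo.symm hFm om.symm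
      hT.ca hT.bc.symm h2.symm h3.symm hU.bc.symm hU.ca hw
    tauto

theorem outer_not_grp {b a c x z : V} {i j k o : ι} (C : Ctr b a c x i j k)
    (hT : Tri o a c z) (ho : o ≠ i) : ¬ Grp G L o := by
  obtain ⟨m1, m2, m3, n1, n2, n3⟩ := C.ne
  obtain ⟨z1, z2, z3, z4, oj, ok⟩ := h.outer_ne C hT ho
  rintro ⟨b', a', c', x', j', k', C'⟩
  have hb' : b' = a ∨ b' = c ∨ b' = z := by
    have := hT.bd h.faces C'.t1.ab
    tauto
  have four : ∀ p q r s : V, G.Adj b' p → G.Adj b' q → G.Adj b' r → G.Adj b' s → p ≠ q → p ≠ r →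
      p ≠ s → q ≠ r → q ≠ s → r ≠ s → False := by
    intro p q r s hp hq hr hs
    have := h.ctr_nbr C' hp
    have := h.ctr_nbr C' hq
    have := h.ctr_nbr C' hr
    have := h.ctr_nbr C' hs
    grind
  rcases hb' with rfl | rfl | rfl
  · exact four b c x z C.t1.ab.symm.adj C.t1.bc.adj C.t2.bc.adj hT.ca.symm.adj m2.symm m3.symm
      z1.symm n3 z4.symm z2.symm
  · exact four b a x z C.t1.ca.adj C.t1.bc.symm.adj C.t3.bc.adj hT.bc.adj m1.symm m3.symm
      z1.symm n2 z3.symm z2.symm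
  · have key : ∃ j' k' x', Ctr b' a c x' o j' k' := by
      obtain ⟨p1, p2, p3, q1, q2, q3⟩ := C'.ne
      have := hT.bd h.faces C'.t1.bc
      have : (a' = a ∧ c' = c) ∨ (a' = c ∧ c' = a) := by grind
      rcases this with ⟨rfl, rfl⟩ | ⟨rfl, rfl⟩
      exacts [⟨_, _, _, C'⟩, ⟨_, _, _, C'.swap⟩]
    obtain ⟨j', k', x', D⟩ := key
    have e1 := h.outer_tri_side C hT ho D.ij.symm D.t2.swap
    have e2 := h.outer_tri_side C.swap hT.swap ho D.ik.symm D.t3.swap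
    subst e1
    have hj'j : j' ≠ j := by
      rintro rfl
      have := C.t2.bd h.faces D.t2.ab
      grind
    have hk'k : k' ≠ k := by
      rintro rfl
      have := C.t3.bd h.faces D.t3.ab
      grind
    obtain ⟨_, _, _, _, _, _⟩ := D.ne
    refine h.not_closed (p := b) (q := a) (r := c) (s := b') (t := x') m3.symm ?_ ?_ ?_ ?_
    · intro w hw
      have := h.ctr_nbr C hw
      tauto
    · intro w hw
      have := h.nbr_four (v := a) (a := b) (b := c) (c := b') (d := x') m2.symm z1.symm m3.symm
        z4.symm n3 z2 ho.symm D.ij hj'j C.ij.symm C.t1.ab.symm C.t1.bc hT.ab hT.ca.symm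
        D.t2.ab.symm D.t2.bc C.t2.bc C.t2.ab.symm hw
      tauto
    · intro w hw
      have := h.nbr_four (v := c) (a := b) (b := a) (c := b') (d := x') m1.symm z1.symm m3.symm
        z3.symm n2 z2 ho.symm D.ik hk'k C.ik.symm C.t1.ca C.t1.bc.symm hT.ab.symm hT.bc
        D.t3.ab.symm D.t3.bc C.t3.bc C.t3.ab.symm hw
      tauto
    · intro w hw
      have := h.ctr_nbr D hw
      tauto

/-- The triangles beyond the three outer edges of a group. -/
theorem not_all_outer {b a c x z : V} {i j k o m F : ι} (C : Ctr b a c x i j k)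
    (hT : Tri o a c z) (ho : o ≠ i) (hU : Tri m a x z) (hm : m ≠ j) {y : V} (hF : Tri F c x y)
    (hFk : F ≠ k) : False := by
  have e := h.outer_tri_eq C.swap hT.swap ho hFk hF
  subst e
  obtain ⟨m1, m2, m3, n1, n2, n3⟩ := C.ne
  obtain ⟨z1, z2, z3, z4, oj, ok⟩ := h.outer_ne C hT ho
  refine h.cluster_no_common C hT ho hU hm hF.ab hFk hF.ca.symm ?_ hF.bc ?_
  · rintro rfl
    have := hT.bd h.faces hF.ab
    grind
  · rintro rfl
    have := hU.bd h.faces hF.ab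
    grind

theorem grp_of_three_tri {a b c x y z : V} {i j k l : ι} (hT : Tri i a b c) (hj : Tri j a b x)
    (hk : Tri k b c y) (hl : Tri l c a z) (ij : j ≠ i) (ik : k ≠ i) (il : l ≠ i) : Grp G L i := by
  have ctr : ∀ {a b c x : V} {j k : ι}, Tri i a b c → Tri j a b x → Tri k b c x → j ≠ i → k ≠ i →
      Grp G L i := by
    intro a b c x j k h1 h2 h3 n1 n2
    refine ⟨b, a, c, x, j, k, h1.swap, h2.swap, h3, n1.symm, n2.symm, ?_⟩
    rintro rfl
    have := h2.bd h.faces h3.ab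
    have := h1.ca.ne
    have := h3.bc.ne
    grind
  by_cases hxy : x = y
  · subst hxy; exact ctr hT hj hk ij ik
  by_cases hyz : y = z
  · subst hyz; exact ctr hT.rot hk hl ik il
  by_cases hzx : z = x
  · subst hzx; exact ctr hT.rot.rot hl hj il ij
  exfalso
  have third : ∀ {a b c x : V} {j : ι}, Tri i a b c → Tri j a b x → j ≠ i → x ≠ c := by
    rintro a b c x j h1 h2 n rfl
    exact h.not_two_common h1.bc.ne n h2.ab h2.ca.symm h1.ab h1.ca.symm
  have x1 := third hT hj ij
  have y1 := third hT.rot hk ik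
  have z1 := third hT.rot.rot hl il
  have := hT.bc.ne
  have := hT.ca.ne
  exact h.free.short hj.ca.symm.adj hj.bc.symm.adj hk.ca.symm.adj hk.bc.symm.adj hl.ca.symm.adj
    hl.bc.symm.adj hT.ab.adj (by grind)

end Nice

end clusters

section outerfaces
open scoped Classical

/-- Five triangular faces forming a complete graph on five vertices without the edge `bz`. -/
structure IsKl {V ι : Type*} [Fintype V] (G : SimpleGraph V) (L : V → V → ι) (b a c x z : V)
    (i j k o m : ι) : Prop where
  ctr : IsCtr G L b a c x i j k
  t4 : IsTri G L o a c z
  t5 : IsTri G L m a x z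
  oi : o ≠ i
  mj : m ≠ j

variable {V ι : Type*} [Fintype V] {G : SimpleGraph V} {L : V → V → ι}

local notation "Bd" => Borders G L
local notation "Tri" => IsTri G L
local notation "Quad" => IsQuad G L
local notation "Pent" => IsPent G L
local notation "Kl" => IsKl G L

theorem IsKl.swap {b a c x z : V} {i j k o m : ι} (K : Kl b a c x z i j k o m) :
    Kl b a x c z j i k m o :=
  ⟨K.ctr.swap', K.t5, K.t4, K.mj, K.oi⟩

theorem IsKl.adj {b a c x z : V} {i j k o m : ι} (K : Kl b a c x z i j k o m) :
    G.Adj a b ∧ G.Adj a c ∧ G.Adj a x ∧ G.Adj a z ∧ G.Adj b c ∧ G.Adj b x ∧ G.Adj c x ∧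
      G.Adj c z ∧ G.Adj x z :=
  ⟨K.ctr.t1.ab.symm.adj, K.ctr.t1.bc.adj, K.ctr.t2.bc.adj, K.t4.ca.symm.adj, K.ctr.t1.ca.symm.adj,
    K.ctr.t2.ca.symm.adj, K.ctr.t3.bc.adj, K.t4.bc.adj, K.t5.bc.adj⟩

namespace Nice

variable (h : Nice G L)
include h

theorem not_k5 {a b c d e : V} (ab : G.Adj a b) (ac : G.Adj a c) (ad : G.Adj a d) (ae : G.Adj a e)
    (bc : G.Adj b c) (bd : G.Adj b d) (be : G.Adj b e) (cd : G.Adj c d) (ce : G.Adj c e)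
    (de : G.Adj d e) : False := by
  have key : ∀ i j : Fin 5, i ≠ j → G.Adj (![a, b, c, d, e] i) (![a, b, c, d, e] j) := by
    intro i j hij
    fin_cases i <;> fin_cases j <;> first | exact absurd rfl hij | assumption |
      (apply SimpleGraph.Adj.symm; assumption)
  refine h.noK5 ![a, b, c, d, e] ?_ key
  intro i j hij
  by_contra hne
  exact (key i j hne).ne hij

variable [Fintype ι]

section kl

variable {b a c x z : V} {i j k o m : ι} (K : IsKl G L b a c x z i j k o m)
include K

theorem kl_ne : b ≠ z ∧ o ≠ j ∧ o ≠ k ∧ m ≠ i ∧ m ≠ k ∧ o ≠ m := by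
  obtain ⟨z1, z2, z3, z4, oj, ok⟩ := h.outer_ne K.ctr K.t4 K.oi
  obtain ⟨-, -, -, -, mi, mk⟩ := h.outer_ne K.ctr.swap' K.t5 K.mj
  refine ⟨z1.symm, oj, ok, mi, mk, ?_⟩
  rintro rfl
  obtain ⟨m1, m2, m3, n1, n2, n3⟩ := K.ctr.ne
  have := K.t4.bd h.faces K.t5.ab
  grind

theorem kl_nbr {w : V} (hw : G.Adj a w) : w = b ∨ w = c ∨ w = z ∨ w = x := by
  obtain ⟨bz, oj, ok, mi, mk, om⟩ := h.kl_ne K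
  obtain ⟨m1, m2, m3, n1, n2, n3⟩ := K.ctr.ne
  obtain ⟨ab, ac, ax, az, bc, bx, cx, cz, xz⟩ := K.adj
  exact h.nbr_four m2.symm bz m3.symm cz.ne n3 xz.ne.symm K.oi.symm om K.mj K.ctr.ij.symm
    K.ctr.t1.ab.symm K.ctr.t1.bc K.t4.ab K.t4.ca.symm K.t5.ca.symm K.t5.ab K.ctr.t2.bc
    K.ctr.t2.ab.symm hw

theorem kl_face {w : V} {F : ι} (hF : Bd F a w) : F = i ∨ F = j ∨ F = o ∨ F = m := by
  obtain ⟨bz, oj, ok, mi, mk, om⟩ := h.kl_ne K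
  rcases h.kl_nbr K hF.adj with rfl | rfl | rfl | rfl
  · have := K.ctr.t1.ab.symm.eq_or K.ctr.t2.ab.symm K.ctr.ij hF; tauto
  · have := K.ctr.t1.bc.eq_or K.t4.ab K.oi.symm hF; tauto
  · have := K.t4.ca.symm.eq_or K.t5.ca.symm om hF; tauto
  · have := K.t5.ab.eq_or K.ctr.t2.bc K.mj hF; tauto

theorem kl_ear_two {p q w : V} (hp : p = c ∨ p = x ∨ p = z) (hq : q = c ∨ q = x ∨ q = z)
    (hpq : p ≠ q) (hw : w ≠ a ∧ w ≠ b ∧ w ≠ c ∧ w ≠ x ∧ w ≠ z) (wp : G.Adj p w)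
    (wq : G.Adj q w) : False := by
  obtain ⟨bz, -⟩ := h.kl_ne K
  obtain ⟨ab, ac, ax, az, bc, bx, cx, cz, xz⟩ := K.adj
  have key1 : G.Adj c w → G.Adj x w → False := fun h1 h2 =>
    h.free.short cz az.symm ab bx h2 h1.symm ac.symm (by grind [SimpleGraph.Adj.ne])
  have key2 : G.Adj c w → G.Adj z w → False := fun h1 h2 =>
    h.free.short cx bx.symm ab.symm az h2 h1.symm bc.symm (by grind [SimpleGraph.Adj.ne])
  have key3 : G.Adj x w → G.Adj z w → False := fun h1 h2 =>
    h.free.short cx.symm bc.symm ab.symm az h2 h1.symm bx.symm (by grind [SimpleGraph.Adj.ne])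
  rcases hp with rfl | rfl | rfl <;> rcases hq with rfl | rfl | rfl <;> tauto

theorem kl_ear_three {p q u v : V} (hp : p = c ∨ p = x ∨ p = z) (hq : q = c ∨ q = x ∨ q = z)
    (hpq : p ≠ q) (hu : u ≠ a ∧ u ≠ b ∧ u ≠ c ∧ u ≠ x ∧ u ≠ z)
    (hv : v ≠ a ∧ v ≠ b ∧ v ≠ c ∧ v ≠ x ∧ v ≠ z) (pv : G.Adj p v) (vu : G.Adj v u)
    (uq : G.Adj u q) : False := by
  obtain ⟨bz, -⟩ := h.kl_ne K
  obtain ⟨ab, ac, ax, az, bc, bx, cx, cz, xz⟩ := K.adj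
  have apq : G.Adj p q := by
    rcases hp with rfl | rfl | rfl <;> rcases hq with rfl | rfl | rfl <;>
      first | exact absurd rfl hpq | assumption | (apply SimpleGraph.Adj.symm; assumption)
  by_cases hz : p = z
  · have hbq : G.Adj b q := by grind
    subst hz
    exact h.free.long pv vu uq hbq.symm ab.symm az apq (by grind [SimpleGraph.Adj.ne])
  · have hbp : G.Adj b p := by grind
    have haq : G.Adj a q := by grind
    exact h.free.long pv vu uq haq.symm ab hbp apq (by grind [SimpleGraph.Adj.ne])

theorem kl_len {p q : V} {F : ι} (hp : p = c ∨ p = x ∨ p = z) (hq : q = c ∨ q = x ∨ q = z)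
    (hF : F ≠ i ∧ F ≠ j ∧ F ≠ k ∧ F ≠ o ∧ F ≠ m) (hB : Bd F p q) : 6 ≤ faceLen G L F := by
  obtain ⟨bz, -⟩ := h.kl_ne K
  obtain ⟨ab, ac, ax, az, bc, bx, cx, cz, xz⟩ := K.adj
  have fa : ∀ w, ¬ Bd F a w := fun w hw => by have := h.kl_face K hw; tauto
  have fb : ∀ w, ¬ Bd F b w := fun w hw => by have := h.ctr_face K.ctr hw; tauto
  have hpq := hB.ne
  have apq := hB.adj
  obtain ⟨r, hr, hrp, hrq⟩ : ∃ r, (r = c ∨ r = x ∨ r = z) ∧ r ≠ p ∧ r ≠ q := by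
    rcases hp with rfl | rfl | rfl <;> rcases hq with rfl | rfl | rfl <;>
      first
      | exact absurd rfl hpq
      | exact ⟨c, by simp, by grind [SimpleGraph.Adj.ne], by grind [SimpleGraph.Adj.ne]⟩
      | exact ⟨x, by simp, by grind [SimpleGraph.Adj.ne], by grind [SimpleGraph.Adj.ne]⟩
      | exact ⟨z, by simp, by grind [SimpleGraph.Adj.ne], by grind [SimpleGraph.Adj.ne]⟩
  have nw : ∀ u v, Bd F u v → u ≠ p → u ≠ q → u ≠ r →
      u ≠ a ∧ u ≠ b ∧ u ≠ c ∧ u ≠ x ∧ u ≠ z := by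
    intro u v huv h1 h2 h3
    have ha : u ≠ a := by rintro rfl; exact fa _ huv
    have hb : u ≠ b := by rintro rfl; exact fb _ huv
    grind
  have h3 := h.faces.three_le_faceLen hB
  by_contra hlt
  have hcases : faceLen G L F = 3 ∨ faceLen G L F = 4 ∨ faceLen G L F = 5 := by omega
  rcases hcases with hl | hl | hl
  · obtain ⟨w, hT⟩ := h.faces.exists_tri hB hl
    by_cases hwr : w = r
    · subst hwr
      have h1 := hT.ab
      have h2 := hT.bc
      have h3 := hT.ca
      have : Bd F c x ∧ Bd F c z ∧ Bd F x z := by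
        have := h1.symm
        have := h2.symm
        have := h3.symm
        clear hT hB apq nw
        rcases hp with rfl | rfl | rfl <;> rcases hq with rfl | rfl | rfl <;>
          rcases hr with rfl | rfl | rfl <;>
            first
            | exact absurd rfl hpq
            | exact absurd rfl hrp
            | exact absurd rfl hrq
            | exact ⟨by assumption, by assumption, by assumption⟩
      exact h.cluster_no_common K.ctr K.t4 K.oi K.t5 K.mj this.1 hF.2.2.1 this.2.1 hF.2.2.2.1
        this.2.2 hF.2.2.2.2
    · exact h.kl_ear_two K hp hq hpq (nw w _ hT.ca hT.ca.ne hT.bc.ne.symm hwr) hT.ca.symm.adj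
        hT.bc.adj
  · obtain ⟨u, v, hQ⟩ := h.faces.exists_quad hB hl
    have := hQ.ac
    have := hQ.bd
    by_cases hur : u = r
    · subst hur
      exact h.kl_ear_two K hr hp hrp (nw v _ hQ.da hQ.da.ne hQ.bd.symm hQ.cd.ne.symm) hQ.cd.adj
        hQ.da.symm.adj
    by_cases hvr : v = r
    · subst hvr
      exact h.kl_ear_two K hr hq hrq (nw u _ hQ.cd hQ.ac.symm hQ.bc.ne.symm hur) hQ.cd.symm.adj
        hQ.bc.adj
    exact h.kl_ear_three K hp hq hpq (nw u _ hQ.cd hQ.ac.symm hQ.bc.ne.symm hur)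
      (nw v _ hQ.da hQ.da.ne hQ.bd.symm hvr) hQ.da.symm.adj hQ.cd.symm.adj hQ.bc.symm.adj
  · obtain ⟨u, v, w, hP⟩ := h.faces.exists_pent hB hl
    have e1 := hP.ac
    have e2 := hP.ad
    have e3 := hP.bd
    have e4 := hP.be
    have e5 := hP.ce
    have e6 := hP.bc.ne
    have e7 := hP.cd.ne
    have e8 := hP.de.ne
    have e9 := hP.ea.ne
    by_cases hur : u = r
    · subst hur
      exact h.kl_ear_three K hr hp hrp (nw w _ hP.ea e9 e4.symm e5.symm)
        (nw v _ hP.de e2.symm e3.symm e7.symm) hP.cd.adj hP.de.adj hP.ea.adj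
    by_cases hwr : w = r
    · subst hwr
      exact h.kl_ear_three K hq hr hrq.symm (nw v _ hP.de e2.symm e3.symm e8)
        (nw u _ hP.cd e1.symm e6.symm e5) hP.bc.adj hP.cd.adj hP.de.adj
    by_cases hvr : v = r
    · subst hvr
      exact h.kl_ear_two K hq hr hrq.symm (nw u _ hP.cd e1.symm e6.symm e7) hP.bc.adj
        hP.cd.symm.adj
    have n1 := nw u _ hP.cd e1.symm e6.symm hur
    have n2 := nw v _ hP.de e2.symm e3.symm hvr
    have n3 := nw w _ hP.ea e9 e4.symm hwr
    have haq : G.Adj a q := by grind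
    have hap : G.Adj a p := by grind
    exact h.free.short hap.symm haq hP.bc.adj hP.cd.adj hP.de.adj hP.ea.adj apq
      (by grind [SimpleGraph.Adj.ne])

end kl

section fan

variable {a b c x y u v : V} {i j k F H : ι} (hT : IsTri G L i a b c) (hj : IsTri G L j a b x)
  (hk : IsTri G L k b c y) (ij : j ≠ i) (ik : k ≠ i) (hxy : x ≠ y) (hQ : IsQuad G L F a c u v)
include hT hj hk ij ik hxy hQ

theorem fan_ne : x ≠ c ∧ y ≠ a ∧ u ≠ b ∧ v ≠ b ∧ F ≠ i ∧ F ≠ j ∧ F ≠ k ∧ j ≠ k := by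
  have l1 := hT.len
  have l2 := hj.len
  have l3 := hk.len
  have l4 := hQ.len
  have fi : F ≠ i := by rintro rfl; omega
  have fj : F ≠ j := by rintro rfl; omega
  have fk : F ≠ k := by rintro rfl; omega
  have xc : x ≠ c := by
    rintro rfl
    exact h.not_two_common hT.bc.ne ij hj.ab hj.ca.symm hT.ab hT.ca.symm
  have ya : y ≠ a := by
    rintro rfl
    exact h.not_two_common hT.ab.ne.symm ik hk.ab.symm hk.bc hT.bc.symm hT.ca
  have jk : j ≠ k := by
    rintro rfl
    have := hj.bd h.faces hk.bc
    have := hj.bd h.faces hk.ca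
    have := hk.bc.ne
    have := hk.ca.ne
    grind
  refine ⟨xc, ya, ?_, ?_, fi, fj, fk, jk⟩
  · rintro rfl
    have := hT.bc.symm.eq_or hk.ab.symm ik.symm hQ.bc
    tauto
  · rintro rfl
    have := hT.ab.symm.eq_or hj.ab.symm ij.symm hQ.da
    tauto

theorem fan_left {z : V} (hH : H ≠ j) (hZ : Tri H b x z) : False := by
  obtain ⟨xc, ya, ub, vb, fi, fj, fk, jk⟩ := h.fan_ne hT hj hk ij ik hxy hQ
  have n1 := hT.ab.ne
  have n2 := hT.bc.ne
  have n3 := hT.ca.ne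
  have n4 := hj.bc.ne
  have n5 := hj.ca.ne
  have n6 := hk.bc.ne
  have n7 := hk.ca.ne
  have n8 := hZ.bc.ne
  have n9 := hZ.ca.ne
  have hZi : H ≠ i := by
    rintro rfl
    have := hT.bd h.faces hZ.ab
    grind
  have hZk : H ≠ k := by
    rintro rfl
    have := hk.bd h.faces hZ.ab
    grind
  have zc : z ≠ c := by
    rintro rfl
    have := hT.bc.eq_or hk.ab ik.symm hZ.ca.symm
    tauto
  have za : z ≠ a := by
    rintro rfl
    exact h.not_two_common n5 hH hZ.ab hZ.ca.symm hj.bc hj.ab.symm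
  by_cases zy : z = y
  · subst zy
    have q1 := hQ.ab.ne
    have q2 := hQ.bc.ne
    have q3 := hQ.cd.ne
    have q4 := hQ.da.ne
    have q5 := hQ.ac
    have q6 := hQ.bd
    by_cases hz : z ≠ u ∧ z ≠ v
    · exact h.free.long hQ.da.symm.adj hQ.cd.symm.adj hQ.bc.symm.adj hk.bc.adj hk.ca.adj
        hT.ab.symm.adj hQ.ab.adj (by grind)
    by_cases hx : x ≠ u ∧ x ≠ v
    · exact h.free.long hQ.da.symm.adj hQ.cd.symm.adj hQ.bc.symm.adj hT.bc.symm.adj hj.bc.adj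
        hj.ca.adj hQ.ab.adj (by grind)
    have hcase : (u = z ∧ v = x) ∨ (u = x ∧ v = z) := by grind
    rcases hcase with ⟨rfl, rfl⟩ | ⟨rfl, rfl⟩
    · have hc := fun w (hw : G.Adj c w) => h.nbr_three n1 (Ne.symm n7) ya ik.symm fk.symm
        fi hT.ca hT.bc.symm hk.ab.symm hk.bc hQ.bc hQ.ab.symm hw
      have ha := fun w (hw : G.Adj a w) => h.nbr_three n2.symm n4 xc ij.symm fj.symm
        fi hT.ca.symm hT.ab hj.ab hj.ca.symm hQ.da.symm hQ.ab hw
      exact h.nadj a c hQ.ab.adj b v b u (fun w hw => by have := ha w hw; tauto)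
        (fun w hw => by have := hc w hw; tauto)
    · exact h.not_k5 hT.ab.adj hQ.ab.adj hj.ca.symm.adj hQ.da.symm.adj hT.bc.adj hZ.ab.adj
        hZ.ca.symm.adj hQ.bc.adj hk.bc.adj hQ.cd.adj
  · exact h.free.short hZ.ca.symm.adj hZ.bc.symm.adj hj.ca.adj hT.ca.symm.adj hk.bc.adj hk.ca.adj
      hZ.ab.adj (by grind)

theorem fan_right {z : V} (hH : H ≠ j) (hZ : Tri H a x z) : False := by
  obtain ⟨xc, ya, ub, vb, fi, fj, fk, jk⟩ := h.fan_ne hT hj hk ij ik hxy hQ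
  have n1 := hT.ab.ne
  have n2 := hT.bc.ne
  have n3 := hT.ca.ne
  have n4 := hj.bc.ne
  have n5 := hj.ca.ne
  have n6 := hk.bc.ne
  have n7 := hk.ca.ne
  have n8 := hZ.bc.ne
  have n9 := hZ.ca.ne
  have lH := hZ.len
  have lF := hQ.len
  have hHF : H ≠ F := by rintro rfl; omega
  have hZi : H ≠ i := by
    rintro rfl
    have := hT.bd h.faces hZ.ab
    grind
  have zb : z ≠ b := by
    rintro rfl
    exact h.not_two_common n4.symm hH hZ.ab hZ.ca.symm hj.ca.symm hj.ab
  have zc : z ≠ c := by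
    rintro rfl
    have := hT.ca.eq_or hQ.ab.symm fi.symm hZ.ca
    tauto
  have vx : v ≠ x := by
    rintro rfl
    have := hj.ca.eq_or hZ.ab.symm hH.symm hQ.da
    grind
  by_cases zy : z = y
  · subst zy
    have q1 := hQ.ab.ne
    have q2 := hQ.bc.ne
    have q3 := hQ.cd.ne
    have q4 := hQ.da.ne
    have q5 := hQ.ac
    have q6 := hQ.bd
    by_cases ux : u = x
    · subst ux
      exact h.not_k5 hT.ab.adj hQ.ab.adj hj.ca.symm.adj hZ.ca.symm.adj hT.bc.adj hj.bc.adj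
        hk.ca.symm.adj hQ.bc.adj hk.bc.adj hZ.bc.adj
    by_cases vz : v = z
    · subst vz
      exact h.free.short hQ.bc.adj hQ.cd.adj hZ.bc.symm.adj hj.ca.adj hT.ab.adj hT.bc.adj
        hk.bc.adj (by grind)
    by_cases uz : u = z
    · subst uz
      exact h.free.short hQ.cd.adj hQ.da.adj hj.ca.symm.adj hj.bc.symm.adj hT.bc.adj hk.bc.adj
        hZ.ca.adj (by grind)
    exact h.free.long hQ.da.symm.adj hQ.cd.symm.adj hQ.bc.symm.adj hT.bc.symm.adj hj.bc.adj
      hj.ca.adj hQ.ab.adj (by grind)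
  · exact h.free.long hZ.ca.symm.adj hZ.bc.symm.adj hj.bc.symm.adj hk.ca.symm.adj hk.bc.symm.adj
      hT.ca.adj hT.ab.adj (by grind)

end fan

end Nice

end outerfaces

section transfer
open scoped Classical

variable {V ι : Type*} [Fintype V] {G : SimpleGraph V} {L : V → V → ι}

local notation "Bd" => Borders G L
local notation "Tri" => IsTri G L
local notation "Quad" => IsQuad G L
local notation "Ctr" => IsCtr G L
local notation "Kl" => IsKl G L

variable (G L) in
/-- Two distinct faces share an edge. -/
def FaceAdj (i j : ι) : Prop := j ≠ i ∧ ∃ u v, Borders G L i u v ∧ Borders G L j u v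

variable (G L) in
/-- All faces sharing an edge with the given one are triangles. -/
def AllTri (i : ι) : Prop := ∀ j, FaceAdj G L i j → faceLen G L j = 3

variable (G L) in
/-- Some face sharing an edge with the given one is a pentagon. -/
def HasPent (i : ι) : Prop := ∃ j, FaceAdj G L i j ∧ faceLen G L j = 5

variable (G L) in
/-- A triangular face outside the groups adjacent to two triangles and a quadrangle. -/
def Mid (i : ι) : Prop := ¬ Grp G L i ∧ faceLen G L i = 3 ∧ ∃ j k l, j ≠ k ∧ FaceAdj G L i j ∧
  FaceAdj G L i k ∧ FaceAdj G L i l ∧ faceLen G L j = 3 ∧ faceLen G L k = 3 ∧ faceLen G L l = 4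

variable (G L) in
/-- The triangular face belongs to a cluster of five triangles on five vertices. -/
def InKl (t : ι) : Prop := ∃ b a c x z i j k o m, IsKl G L b a c x z i j k o m ∧
  (t = i ∨ t = j ∨ t = k ∨ t = o ∨ t = m)

/-- The initial charge per edge of a face of given length. -/
def own (n : ℕ) : ℤ := if n = 3 then -5 else if n = 4 then 10 else if n = 5 then 19 else 25

variable (G L) in
/-- The charge a triangle receives from an adjacent triangle. -/
noncomputable def recv (i j : ι) : ℤ :=
  if Grp G L i then
    if ¬ Grp G L j then 10
    else if AllTri G L i ∧ ¬ AllTri G L j then if HasPent G L j then 3 else 5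
    else 0
  else if ¬ Grp G L j ∧ Mid G L i ∧ ¬ Mid G L j then 3 else 0

variable (G L) in
/-- The charge a face receives across an edge shared with another face. -/
noncomputable def transfer (i j : ι) : ℤ :=
  if faceLen G L i = 3 then
    if faceLen G L j = 3 then recv G L i j - recv G L j i else own (faceLen G L j)
  else if faceLen G L j = 3 then - own (faceLen G L i) else 0

variable (G L) in
/-- The charge left at a face on an edge shared with another face. -/
noncomputable def final (i j : ι) : ℤ := own (faceLen G L i) + transfer G L i j

theorem transfer_antisymm (i j : ι) : transfer G L i j = - transfer G L j i := by
  unfold transfer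
  split_ifs <;> ring

omit [Fintype V] in
theorem FaceAdj.symm {i j : ι} (h : FaceAdj G L i j) : FaceAdj G L j i := by
  obtain ⟨h1, u, v, h2, h3⟩ := h
  exact ⟨h1.symm, u, v, h3, h2⟩

theorem recv_nonneg (i j : ι) : 0 ≤ recv G L i j := by
  unfold recv
  split_ifs <;> norm_num

theorem IsTri.faceAdj_eq (hF : FaceSystem G L) {a b c : V} {i j k l t : ι} (hT : Tri i a b c)
    (hj : Bd j a b) (hk : Bd k b c) (hl : Bd l c a) (ij : j ≠ i) (ik : k ≠ i) (il : l ≠ i)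
    (ht : FaceAdj G L i t) : t = j ∨ t = k ∨ t = l := by
  obtain ⟨ti, u, v, h1, h2⟩ := ht
  rcases hT.bd hF h1 with
    ⟨rfl, rfl⟩ | ⟨rfl, rfl⟩ | ⟨rfl, rfl⟩ | ⟨rfl, rfl⟩ | ⟨rfl, rfl⟩ | ⟨rfl, rfl⟩
  · have := hT.ab.eq_or hj ij.symm h2; tauto
  · have := hT.ab.eq_or hj ij.symm h2.symm; tauto
  · have := hT.bc.eq_or hk ik.symm h2; tauto
  · have := hT.bc.eq_or hk ik.symm h2.symm; tauto
  · have := hT.ca.eq_or hl il.symm h2; tauto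
  · have := hT.ca.eq_or hl il.symm h2.symm; tauto

theorem IsCtr.grp {b a c x : V} {i j k : ι} (C : Ctr b a c x i j k) : Grp G L i :=
  ⟨b, a, c, x, j, k, C⟩

theorem final_tri {i j : ι} (hi : faceLen G L i = 3) (hj : faceLen G L j = 3) :
    final G L i j = -5 + recv G L i j - recv G L j i := by
  simp [final, transfer, hi, hj, own]
  ring

theorem final_tri_other {i j : ι} (hi : faceLen G L i = 3) (hj : faceLen G L j ≠ 3) :
    final G L i j = -5 + own (faceLen G L j) := by
  simp [final, transfer, hi, hj, own]

theorem final_other {i j : ι} (hi : faceLen G L i ≠ 3) : 0 ≤ final G L i j ∧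
    (final G L i j = 0 → faceLen G L j = 3) := by
  unfold final transfer own
  simp only [hi, if_false]
  split_ifs <;> simp_all

theorem IsKl.tri_len {b a c x z : V} {i j k o m : ι} (K : Kl b a c x z i j k o m) {t : ι}
    (ht : t = i ∨ t = j ∨ t = k ∨ t = o ∨ t = m) : faceLen G L t = 3 := by
  rcases ht with rfl | rfl | rfl | rfl | rfl
  exacts [K.ctr.t1.len, K.ctr.t2.len, K.ctr.t3.len, K.t4.len, K.t5.len]

theorem five_le {n : ℕ} (h : n ≠ 3) (h4 : n ≠ 4) : 19 ≤ own n := by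
  unfold own
  split_ifs <;> omega

theorem four_le {n : ℕ} (h : n ≠ 3) : 10 ≤ own n := by
  unfold own
  split_ifs <;> omega

theorem own_of_six_le {n : ℕ} (h : 6 ≤ n) : own n = 25 := by
  unfold own
  split_ifs <;> omega

namespace Nice

variable (h : Nice G L) [Fintype ι]
include h

theorem kl_outer {b a c x z : V} {i j k o m : ι} (K : Kl b a c x z i j k o m) {t F : ι}
    (ht : t = i ∨ t = j ∨ t = k ∨ t = o ∨ t = m) (hl : faceLen G L F ≠ 3) {p q : V}
    (h1 : Bd t p q) (h2 : Bd F p q) :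
    6 ≤ faceLen G L F ∧ (p = c ∨ p = x ∨ p = z) ∧ (q = c ∨ q = x ∨ q = z) := by
  have hF5 : F ≠ i ∧ F ≠ j ∧ F ≠ k ∧ F ≠ o ∧ F ≠ m := by
    refine ⟨?_, ?_, ?_, ?_, ?_⟩ <;> (rintro rfl; exact hl (K.tri_len (by tauto)))
  have key : p = c ∨ p = x ∨ p = z → q = c ∨ q = x ∨ q = z →
      6 ≤ faceLen G L F ∧ (p = c ∨ p = x ∨ p = z) ∧ (q = c ∨ q = x ∨ q = z) :=
    fun hp hq => ⟨h.kl_len K hp hq hF5 h2, hp, hq⟩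
  obtain ⟨f1, f2, f3, f4, f5⟩ := hF5
  have aF : ∀ w, ¬ Bd F a w := fun w hw => by have := h.kl_face K hw; tauto
  have bF : ∀ w, ¬ Bd F b w := fun w hw => by have := h.ctr_face K.ctr hw; tauto
  rcases ht with rfl | rfl | rfl | rfl | rfl
  · have := K.ctr.t1.bd h.faces h1
    grind [Borders.symm]
  · have := K.ctr.t2.bd h.faces h1
    grind [Borders.symm]
  · have := K.ctr.t3.bd h.faces h1
    grind [Borders.symm]
  · have := K.t4.bd h.faces h1
    grind [Borders.symm]
  · have := K.t5.bd h.faces h1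
    grind [Borders.symm]

theorem kl_faceAdj {b a c x z : V} {i j k o m : ι} (K : Kl b a c x z i j k o m) {t F : ι}
    (ht : t = i ∨ t = j ∨ t = k ∨ t = o ∨ t = m) (hF : FaceAdj G L t F) (hl : faceLen G L F ≠ 3) :
    6 ≤ faceLen G L F := by
  obtain ⟨Ft, p, q, h1, h2⟩ := hF
  exact (h.kl_outer K ht hl h1 h2).1

theorem exists_kl {b a c x : V} {i j k : ι} (C : Ctr b a c x i j k) (hi : AllTri G L i)
    (hj : AllTri G L j) : ∃ z o m, Kl b a c x z i j k o m := by
  obtain ⟨o, oi, ho⟩ := C.t1.bc.exists_other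
  obtain ⟨m, mj, hm⟩ := C.t2.bc.exists_other
  obtain ⟨z, hT⟩ := h.faces.exists_tri ho (hi o ⟨oi, _, _, C.t1.bc, ho⟩)
  obtain ⟨u, hU⟩ := h.faces.exists_tri hm (hj m ⟨mj, _, _, C.t2.bc, hm⟩)
  obtain rfl := h.outer_tri_eq C hT oi mj hU
  exact ⟨u, o, m, C, hT, hU, oi, mj⟩

theorem kl_not_pent {b a c x z : V} {i j k o m : ι} (K : Kl b a c x z i j k o m) {t : ι}
    (ht : t = i ∨ t = j ∨ t = k ∨ t = o ∨ t = m) : ¬ HasPent G L t ∧ ¬ Mid G L t := by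
  constructor
  · rintro ⟨F, hF, h5⟩
    have := h.kl_faceAdj K ht hF (by omega)
    omega
  · rintro ⟨-, -, p, q, F, -, -, -, hF, -, -, h4⟩
    have := h.kl_faceAdj K ht hF (by omega)
    omega

theorem final_grp {b a c x : V} {i j k o : ι} (C : Ctr b a c x i j k) (ho : Bd o a c)
    (oi : o ≠ i) : 0 ≤ final G L i j + final G L i k + final G L i o ∧
      (final G L i j + final G L i k + final G L i o = 0 → InKl G L i) := by
  have l1 := C.t1.len
  have l2 := C.t2.len
  have l3 := C.t3.len
  have g1 := C.grp
  have g2 := C.swap'.grp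
  have g3 := C.swap.swap'.grp
  rw [final_tri l1 l2, final_tri l1 l3]
  have r0 : ∀ {i j : ι}, Grp G L i → Grp G L j → recv G L i j =
    if AllTri G L i ∧ ¬ AllTri G L j then if HasPent G L j then 3 else 5 else 0 := by
    intro i j h1 h2
    simp [recv, h1, h2]
  rw [r0 g1 g2, r0 g2 g1, r0 g1 g3, r0 g3 g1]
  have hio : FaceAdj G L i o := ⟨oi, _, _, C.t1.bc, ho⟩
  by_cases lo : faceLen G L o = 3
  · have A : AllTri G L i := by
      intro t ht
      rcases C.t1.faceAdj_eq h.faces C.t2.ab ho C.t3.ab.symm C.ij.symm oi C.ik.symm ht with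
        rfl | rfl | rfl <;> assumption
    obtain ⟨z, hz⟩ := h.faces.exists_tri ho lo
    have go := h.outer_not_grp C hz oi
    have e1 : recv G L i o = 10 := by simp [recv, g1, go]
    have e2 : recv G L o i = 0 := by simp [recv, g1, go]
    rw [final_tri l1 lo, e1, e2]
    by_cases B : AllTri G L j
    · obtain ⟨z, o', m, K⟩ := h.exists_kl C A B
      have hC : ¬ AllTri G L k := by
        intro D
        obtain ⟨p, pk, hp⟩ := C.t3.bc.exists_other
        obtain ⟨y, hy⟩ := h.faces.exists_tri hp (D p ⟨pk, _, _, C.t3.bc, hp⟩)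
        exact h.not_all_outer C K.t4 K.oi K.t5 K.mj hy pk
      have h5 := (h.kl_not_pent K (t := k) (by tauto)).1
      simp only [A, B, hC, h5]
      norm_num
      exact ⟨_, _, _, _, _, _, _, _, _, _, K, Or.inl rfl⟩
    · by_cases D : AllTri G L k
      · obtain ⟨z, o', m, K⟩ := h.exists_kl C.swap A D
        have h5 := (h.kl_not_pent K (t := j) (by tauto)).1
        simp only [A, B, D, h5]
        norm_num
        exact ⟨_, _, _, _, _, _, _, _, _, _, K, Or.inl rfl⟩
      · have r : ∀ P : Prop, (3 : ℤ) ≤ if P then 3 else 5 := by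
          intro P
          split_ifs <;> norm_num
        have r1 := r (HasPent G L j)
        have r2 := r (HasPent G L k)
        simp only [A, B, D, not_true, not_false_iff, and_true, and_false, if_true, if_false]
        constructor
        · linarith
        · intro h0
          linarith
  · have A : ¬ AllTri G L i := fun hA => lo (hA o hio)
    have l4 : faceLen G L o ≠ 4 := by
      intro h4
      obtain ⟨u, v, hQ⟩ := h.faces.exists_quad ho h4
      exact h.ctr_not_quad C hQ
    rw [final_tri_other l1 lo]
    have lo3 := h.faces.three_le_faceLen ho
    by_cases BD : AllTri G L j ∧ AllTri G L k
    · obtain ⟨z, o', m, K⟩ := h.exists_kl C.swap'.swap BD.1 BD.2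
      have l6 := h.kl_faceAdj K (t := i) (by tauto) hio lo
      have h5 := (h.kl_not_pent K (t := i) (by tauto)).1
      rw [own_of_six_le l6]
      simp only [A, BD.1, BD.2, h5]
      norm_num
      exact ⟨_, _, _, _, _, _, _, _, _, _, K, by tauto⟩
    · have key :
        (if AllTri G L j ∧ ¬AllTri G L i then if HasPent G L i then (3 : ℤ) else 5 else 0) +
          (if AllTri G L k ∧ ¬AllTri G L i then if HasPent G L i then 3 else 5 else 0) <
          -15 + own (faceLen G L o) := by
        by_cases h5 : faceLen G L o = 5
        · have : HasPent G L i := ⟨o, hio, h5⟩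
          rw [h5]
          simp only [this, own, A]
          split_ifs <;> first | omega | simp_all
        · rw [own_of_six_le (n := faceLen G L o) (by omega)]
          split_ifs <;> first | omega | simp_all
      simp only [A]
      simp only [A] at key
      constructor
      · norm_num at key ⊢
        linarith
      · intro h0
        norm_num at key h0
        linarith

end Nice

end transfer

section nongroup
open scoped Classical

variable {V ι : Type*} [Fintype V] {G : SimpleGraph V} {L : V → V → ι}

local notation "Bd" => Borders G L
local notation "Tri" => IsTri G L
local notation "Quad" => IsQuad G L
local notation "Ctr" => IsCtr G L
local notation "Kl" => IsKl G L

theorem final_lower {i j : ι} (li : faceLen G L i = 3) (gj : ¬ Grp G L j) :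
    -8 ≤ final G L i j ∧ (faceLen G L j ≠ 3 → 5 ≤ final G L i j) := by
  constructor
  · by_cases lj : faceLen G L j = 3
    · rw [final_tri li lj]
      have := recv_nonneg (G := G) (L := L) i j
      have : recv G L j i ≤ 3 := by
        simp only [recv, gj, if_false]
        split_ifs <;> norm_num
      linarith
    · rw [final_tri_other li lj]
      have := four_le lj
      linarith
  · intro lj
    rw [final_tri_other li lj]
    have := four_le lj
    linarith

namespace Nice

variable (h : Nice G L) [Fintype ι]
include h

omit [Fintype ι] in
theorem exists_ctr_of_grp {a b c : V} {i j : ι} (hT : Tri i a b c) (hj : Bd j a b) (ij : j ≠ i)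
    (gi : ¬ Grp G L i) (gj : Grp G L j) : ∃ q x k l, Ctr q a b x j k l := by
  obtain ⟨b', a', c', x', k, l, C⟩ := gj
  rcases C.t1.bd h.faces hj with ⟨rfl, rfl⟩ | ⟨rfl, rfl⟩ | ⟨rfl, rfl⟩ | ⟨rfl, rfl⟩ | ⟨rfl, rfl⟩ |
    ⟨rfl, rfl⟩
  · rcases hj.eq_or C.t2.ab C.ij hT.ab with rfl | rfl
    exacts [absurd rfl ij, absurd C.swap'.grp gi]
  · rcases hj.symm.eq_or C.t2.ab C.ij hT.ab.symm with rfl | rfl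
    exacts [absurd rfl ij, absurd C.swap'.grp gi]
  · exact ⟨_, _, _, _, C⟩
  · exact ⟨_, _, _, _, C.swap⟩
  · rcases hj.symm.eq_or C.t3.ab C.ik hT.ab.symm with rfl | rfl
    exacts [absurd rfl ij, absurd C.swap.swap'.grp gi]
  · rcases hj.eq_or C.t3.ab C.ik hT.ab with rfl | rfl
    exacts [absurd rfl ij, absurd C.swap.swap'.grp gi]

theorem final_outer_one {a b c q x : V} {i j k l s t : ι} (hT : Tri i a b c) (C : Ctr q a b x j k l)
    (ij : j ≠ i) (hs : Bd s c a) (si : s ≠ i) (ls : faceLen G L s = 3) (ht : Bd t b c)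
    (ti : t ≠ i) :
    final G L i j + final G L i s + final G L i t = 0 ∧ InKl G L i := by
  have go := h.outer_not_grp C hT ij.symm
  obtain ⟨u, hU⟩ := h.faces.exists_tri hs.symm ls
  obtain rfl := h.outer_tri_side C hT ij.symm si hU
  have sk : s ≠ k := by
    rintro rfl
    obtain ⟨z1, z2, z3, z4, oj, ok⟩ := h.outer_ne C hT ij.symm
    have := C.t2.bd h.faces hs
    have := hT.ab.ne
    grind
  have hU' : Tri s a u c := hU.rot.rot.swap
  have K : Kl q a b u c j k l i s := ⟨C, hT, hU', ij.symm, sk⟩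
  have lt : faceLen G L t ≠ 3 := by
    intro lt
    obtain ⟨y, hy⟩ := h.faces.exists_tri ht lt
    obtain rfl := h.outer_tri_side C.swap hT.swap ij.symm ti hy
    have tl : t ≠ l := by
      rintro rfl
      obtain ⟨z1, z2, z3, z4, oj, ok⟩ := h.outer_ne C hT ij.symm
      have := C.t3.bd h.faces ht
      have := hT.bc.ne
      grind
    exact h.not_all_outer C hT ij.symm hU' sk hy.rot.rot.swap tl
  have gs := h.outer_not_grp C.swap' hU' sk
  have mi := (h.kl_not_pent K (t := i) (by tauto)).2
  have ms := (h.kl_not_pent K (t := s) (by tauto)).2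
  have l6 := h.kl_faceAdj K (t := i) (by tauto) ⟨ti, _, _, hT.bc, ht⟩ lt
  have gj := C.grp
  rw [final_tri hT.len C.t1.len, final_tri hT.len ls, final_tri_other hT.len lt, own_of_six_le l6]
  refine ⟨?_, _, _, _, _, _, _, _, _, _, _, K, by tauto⟩
  simp [recv, go, gs, mi, ms, gj]

theorem final_outer {a b c : V} {i j s t : ι} (hT : Tri i a b c) (hj : Bd j a b) (ij : j ≠ i)
    (gi : ¬ Grp G L i) (gj : Grp G L j) (hs : Bd s c a) (si : s ≠ i) (ht : Bd t b c) (ti : t ≠ i) :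
    0 ≤ final G L i j + final G L i s + final G L i t ∧
      (final G L i j + final G L i s + final G L i t = 0 → InKl G L i) := by
  obtain ⟨q, x, k, l, C⟩ := h.exists_ctr_of_grp hT hj ij gi gj
  by_cases ls : faceLen G L s = 3
  · have := h.final_outer_one hT C ij hs si ls ht ti
    exact ⟨this.1.ge, fun _ => this.2⟩
  by_cases lt : faceLen G L t = 3
  · have := h.final_outer_one hT.swap C.swap ij ht.symm ti lt hs.symm si
    exact ⟨by linarith [this.1], fun _ => this.2⟩
  have s4 : faceLen G L s ≠ 4 := by
    intro h4
    obtain ⟨_, _, hQ⟩ := h.faces.exists_quad hs.symm h4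
    exact h.outer_not_quad C hT ij.symm hQ
  have t4 : faceLen G L t ≠ 4 := by
    intro h4
    obtain ⟨_, _, hQ⟩ := h.faces.exists_quad ht h4
    exact h.outer_not_quad C.swap hT.swap ij.symm hQ
  rw [final_tri hT.len C.t1.len, final_tri_other hT.len ls, final_tri_other hT.len lt]
  have e1 : recv G L i j = 0 := by simp [recv, gi, gj]
  have e2 : recv G L j i = 10 := by simp [recv, gi, gj]
  have := five_le ls s4
  have := five_le lt t4
  rw [e1, e2]
  constructor
  · linarith
  · intro h0
    linarith

theorem fan_faceAdj {a b c x y u v : V} {i j k F H : ι} (hT : Tri i a b c) (hj : Tri j a b x)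
    (hk : Tri k b c y) (ij : j ≠ i) (ik : k ≠ i) (hxy : x ≠ y) (hQ : Quad F a c u v)
    (hH : FaceAdj G L j H) (Hi : H ≠ i) : faceLen G L H ≠ 3 := by
  intro l3
  obtain ⟨Hj, p, q, h1, h2⟩ := hH
  have h3 : Bd H a b ∨ Bd H b x ∨ Bd H a x := by
    rcases hj.bd h.faces h1 with ⟨rfl, rfl⟩ | ⟨rfl, rfl⟩ | ⟨rfl, rfl⟩ | ⟨rfl, rfl⟩ | ⟨rfl, rfl⟩ |
      ⟨rfl, rfl⟩
    exacts [Or.inl h2, Or.inl h2.symm, Or.inr (Or.inl h2), Or.inr (Or.inl h2.symm),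
      Or.inr (Or.inr h2.symm), Or.inr (Or.inr h2)]
  rcases h3 with h3 | h3 | h3
  · have := hT.ab.eq_or hj.ab ij.symm h3
    tauto
  · obtain ⟨z, hz⟩ := h.faces.exists_tri h3 l3
    exact h.fan_left hT hj hk ij ik hxy hQ Hj hz
  · obtain ⟨z, hz⟩ := h.faces.exists_tri h3 l3
    exact h.fan_right hT hj hk ij ik hxy hQ Hj hz

theorem exists_of_mid {i : ι} (hM : Mid G L i) : ∃ (a b c x y u v : V) (j k F : ι), Tri i a b c ∧
    Tri j a b x ∧ Tri k b c y ∧ j ≠ i ∧ k ≠ i ∧ x ≠ y ∧ Quad F a c u v := by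
  obtain ⟨gi, li, j, k, F, jk, hj, hk, ⟨Fi, c, a, h1, h2⟩, lj, lk, lF⟩ := hM
  obtain ⟨b, hT⟩ := h.faces.exists_tri h1 li
  obtain ⟨u, v, hQ⟩ := h.faces.exists_quad h2.symm lF
  replace hT := hT.rot
  obtain ⟨s, si, hs⟩ := hT.ab.exists_other
  obtain ⟨t, ti, ht⟩ := hT.bc.exists_other
  have key := fun w (hw : FaceAdj G L i w) => hT.faceAdj_eq h.faces hs ht h2 si ti Fi hw
  have k1 := key j hj
  have k2 := key k hk
  have jF : j ≠ F := by rintro rfl; omega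
  have kF : k ≠ F := by rintro rfl; omega
  have ls : faceLen G L s = 3 ∧ faceLen G L t = 3 := by
    rcases k1 with rfl | rfl | rfl
    · rcases k2 with rfl | rfl | rfl <;> tauto
    · rcases k2 with rfl | rfl | rfl <;> tauto
    · tauto
  obtain ⟨x, hx⟩ := h.faces.exists_tri hs ls.1
  obtain ⟨y, hy⟩ := h.faces.exists_tri ht ls.2
  refine ⟨a, b, c, x, y, u, v, s, t, F, hT, hx, hy, si, ti, ?_, hQ⟩
  rintro rfl
  have st : s ≠ t := by
    rintro rfl
    exact h.not_two_common hT.ca.ne.symm si hs.symm ht hT.ab.symm hT.bc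
  exact gi ⟨b, a, c, x, s, t, hT.swap, hx.swap, hy, si.symm, ti.symm, st⟩

theorem mid_faceAdj {i j H : ι} (hM : Mid G L i) (hj : FaceAdj G L i j)
    (lj : faceLen G L j = 3) (hH : FaceAdj G L j H) (Hi : H ≠ i) : faceLen G L H ≠ 3 := by
  obtain ⟨a, b, c, x, y, u, v, s, t, F, hT, hx, hy, si, ti, xy, hQ⟩ := h.exists_of_mid hM
  have Fi : F ≠ i := by
    rintro rfl
    have := hQ.len
    have := hT.len
    omega
  rcases hT.faceAdj_eq h.faces hx.ab hy.ab hQ.ab.symm si ti Fi hj with rfl | rfl | rfl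
  · exact h.fan_faceAdj hT hx hy si ti xy hQ hH Hi
  · have hQ' : Quad F c a v u := hQ.swap
    exact h.fan_faceAdj hT.rot.swap hy.swap hx.swap ti si xy.symm hQ' hH Hi
  · have := hQ.len
    omega

theorem not_mid_of_mid {i j : ι} (hM : Mid G L i) (hj : FaceAdj G L i j) : ¬ Mid G L j := by
  rintro ⟨-, lj, p, q, -, pq, hp, hq, -, lp, lq, -⟩
  have h1 : p = i := by
    by_contra hne
    exact h.mid_faceAdj hM hj lj hp hne lp
  have h2 : q = i := by
    by_contra hne
    exact h.mid_faceAdj hM hj lj hq hne lq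
  exact pq (h1.trans h2.symm)

theorem final_two {i j k l : ι} (li : faceLen G L i = 3) (gi : ¬ Grp G L i) (gj : ¬ Grp G L j)
    (gk : ¬ Grp G L k) (hj : FaceAdj G L i j) (hk : FaceAdj G L i k) (hl : FaceAdj G L i l)
    (jk : j ≠ k) (lj : faceLen G L j = 3) (lk : faceLen G L k = 3) (ll : faceLen G L l ≠ 3) :
    0 < final G L i j + final G L i k + final G L i l := by
  rw [final_tri li lj, final_tri li lk, final_tri_other li ll]
  by_cases l4 : faceLen G L l = 4
  · have hM : Mid G L i := ⟨gi, li, j, k, l, jk, hj, hk, hl, lj, lk, l4⟩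
    have mj := h.not_mid_of_mid hM hj
    have mk := h.not_mid_of_mid hM hk
    simp [recv, gi, gj, gk, hM, mj, mk, l4, own]
  · have key : ∀ {j k : ι}, ¬ Grp G L j → FaceAdj G L i j → FaceAdj G L i k → j ≠ k →
        faceLen G L j = 3 → faceLen G L k = 3 → recv G L j i = 0 := by
      intro j k gj hj hk jk lj lk
      have mj : ¬ Mid G L j := fun hM => h.mid_faceAdj hM hj.symm li hk jk.symm lk
      simp [recv, gj, gi, mj]
    rw [key gj hj hk jk lj lk, key gk hk hj jk.symm lk lj]
    have := five_le ll l4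
    have := recv_nonneg (G := G) (L := L) i j
    have := recv_nonneg (G := G) (L := L) i k
    linarith

theorem final_grp_of_borders {b a c x : V} {i s t j k l : ι} (C : Ctr b a c x i s t)
    (hj : Bd j a c) (ij : j ≠ i) (hk : Bd k b a) (ik : k ≠ i) (hl : Bd l b c) (il : l ≠ i) :
    0 ≤ final G L i k + final G L i l + final G L i j ∧
      (final G L i k + final G L i l + final G L i j = 0 → InKl G L i) := by
  rcases C.t1.ab.eq_or C.t2.ab C.ij hk with rfl | rfl
  · exact absurd rfl ik
  rcases C.t1.ca.symm.eq_or C.t3.ab C.ik hl with rfl | rfl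
  · exact absurd rfl il
  exact h.final_grp C hj ij

theorem final_tri_sum {a b c : V} {i j k l : ι} (hT : Tri i a b c) (hj : Bd j a b) (hk : Bd k b c)
    (hl : Bd l c a) (ij : j ≠ i) (ik : k ≠ i) (il : l ≠ i) :
    0 ≤ final G L i j + final G L i k + final G L i l ∧
      (final G L i j + final G L i k + final G L i l = 0 → InKl G L i) := by
  by_cases gi : Grp G L i
  · obtain ⟨b', a', c', x', s, t, C⟩ := id gi
    have hb : b' = a ∨ b' = b ∨ b' = c := by
      have := hT.bd h.faces C.t1.ab
      tauto
    have := C.t1.ab.ne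
    have := C.t1.ca.ne
    rcases hT.bd h.faces C.t1.bc with ⟨rfl, rfl⟩ | ⟨rfl, rfl⟩ | ⟨rfl, rfl⟩ | ⟨rfl, rfl⟩ |
      ⟨rfl, rfl⟩ | ⟨rfl, rfl⟩ <;> rcases hb with rfl | rfl | rfl <;> first | contradiction | skip
    · have := h.final_grp_of_borders C hj ij hl il hk.symm ik
      exact ⟨by linarith [this.1], fun h0 => this.2 (by linarith)⟩
    · have := h.final_grp_of_borders C hj.symm ij hk.symm ik hl il
      exact ⟨by linarith [this.1], fun h0 => this.2 (by linarith)⟩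
    · have := h.final_grp_of_borders C hk ik hj ij hl.symm il
      exact ⟨by linarith [this.1], fun h0 => this.2 (by linarith)⟩
    · have := h.final_grp_of_borders C hk.symm ik hl.symm il hj ij
      exact ⟨by linarith [this.1], fun h0 => this.2 (by linarith)⟩
    · have := h.final_grp_of_borders C hl il hk ik hj.symm ij
      exact ⟨by linarith [this.1], fun h0 => this.2 (by linarith)⟩
    · have := h.final_grp_of_borders C hl.symm il hj.symm ij hk ik
      exact ⟨by linarith [this.1], fun h0 => this.2 (by linarith)⟩
  by_cases gj : Grp G L j
  · have := h.final_outer hT hj ij gi gj hl il hk ik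
    exact ⟨by linarith [this.1], fun h0 => this.2 (by linarith)⟩
  by_cases gk : Grp G L k
  · have := h.final_outer hT.rot hk ik gi gk hj ij hl il
    exact ⟨by linarith [this.1], fun h0 => this.2 (by linarith)⟩
  by_cases gl : Grp G L l
  · have := h.final_outer hT.rot.rot hl il gi gl hk ik hj ij
    exact ⟨by linarith [this.1], fun h0 => this.2 (by linarith)⟩
  have aj : FaceAdj G L i j := ⟨ij, _, _, hT.ab, hj⟩
  have ak : FaceAdj G L i k := ⟨ik, _, _, hT.bc, hk⟩
  have al : FaceAdj G L i l := ⟨il, _, _, hT.ca, hl⟩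
  have jk : j ≠ k := by
    rintro rfl
    exact h.not_two_common hT.ca.ne.symm ij hj.symm hk hT.ab.symm hT.bc
  have kl : k ≠ l := by
    rintro rfl
    exact h.not_two_common hT.ab.ne.symm ik hk.symm hl hT.bc.symm hT.ca
  have lj : l ≠ j := by
    rintro rfl
    exact h.not_two_common hT.bc.ne.symm il hl.symm hj hT.ca.symm hT.ab
  have b1 := final_lower hT.len gj
  have b2 := final_lower hT.len gk
  have b3 := final_lower hT.len gl
  suffices 0 < final G L i j + final G L i k + final G L i l from
    ⟨this.le, fun h0 => absurd h0 this.ne'⟩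
  by_cases l1 : faceLen G L j = 3 <;> by_cases l2 : faceLen G L k = 3 <;>
    by_cases l3 : faceLen G L l = 3
  · obtain ⟨x, hx⟩ := h.faces.exists_tri hj l1
    obtain ⟨y, hy⟩ := h.faces.exists_tri hk l2
    obtain ⟨z, hz⟩ := h.faces.exists_tri hl l3
    exact absurd (h.grp_of_three_tri hT hx hy hz ij ik il) gi
  · exact h.final_two hT.len gi gj gk aj ak al jk l1 l2 l3
  · have := h.final_two hT.len gi gj gl aj al ak lj.symm l1 l3 l2
    linarith
  · have := b2.2 l2
    have := b3.2 l3
    linarith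
  · have := h.final_two hT.len gi gk gl ak al aj kl l2 l3 l1
    linarith
  · have := b1.2 l1
    have := b3.2 l3
    linarith
  · have := b1.2 l1
    have := b2.2 l2
    linarith
  · have := b1.2 l1
    have := b2.2 l2
    have := b3.2 l3
    linarith

end Nice

end nongroup

section total
open scoped Classical

variable {V ι : Type*} [Fintype V] {G : SimpleGraph V} {L : V → V → ι}

local notation "Bd" => Borders G L
local notation "Tri" => IsTri G L

omit [Fintype V] in
theorem Borders.exists_dart {i j : ι} {u v : V} (hi : Bd i u v) (hj : Bd j u v) (ij : j ≠ i) :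
    ∃ p : V × V, G.Adj p.1 p.2 ∧ L p.1 p.2 = i ∧ L p.2 p.1 = j ∧ s(p.1, p.2) = s(u, v) := by
  obtain ⟨h1, h2, h3⟩ := hi
  obtain ⟨-, -, h4⟩ := hj
  rcases h3 with rfl | rfl
  · refine ⟨(u, v), h1, rfl, ?_, rfl⟩
    rcases h4 with rfl | rfl
    exacts [absurd rfl ij, rfl]
  · refine ⟨(v, u), h1.symm, rfl, ?_, Sym2.eq_swap⟩
    rcases h4 with rfl | rfl
    exacts [rfl, absurd rfl ij]

theorem sum_own_eq :
    ∑ p ∈ dartPairs G, own (faceLen G L (L p.1 p.2)) =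
      ∑ p ∈ dartPairs G, final G L (L p.1 p.2) (L p.2 p.1) := by
  have h0 : ∑ p ∈ dartPairs G, transfer G L (L p.1 p.2) (L p.2 p.1) = 0 := by
    have h1 : ∑ p ∈ dartPairs G, transfer G L (L p.1 p.2) (L p.2 p.1) =
        ∑ p ∈ dartPairs G, transfer G L (L p.2 p.1) (L p.1 p.2) := by
      refine Finset.sum_nbij' Prod.swap Prod.swap ?_ ?_ ?_ ?_ ?_
      · rintro ⟨u, v⟩ hp
        exact mem_dartPairs.2 (mem_dartPairs.1 hp).symm
      · rintro ⟨u, v⟩ hp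
        exact mem_dartPairs.2 (mem_dartPairs.1 hp).symm
      · simp
      · simp
      · simp
    have h2 : ∑ p ∈ dartPairs G, transfer G L (L p.2 p.1) (L p.1 p.2) =
        - ∑ p ∈ dartPairs G, transfer G L (L p.1 p.2) (L p.2 p.1) := by
      rw [← Finset.sum_neg_distrib]
      exact Finset.sum_congr rfl fun p _ => transfer_antisymm _ _
    linarith
  simp only [final, Finset.sum_add_distrib, h0, add_zero]

namespace Nice

variable (h : Nice G L)
include h

theorem card_fiber (i : ι) :
    ((dartPairs G).filter fun p => L p.1 p.2 = i).card = faceLen G L i := by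
  rw [← card_darts_face]
  congr 1
  ext ⟨u, v⟩
  simp only [Finset.mem_filter, mem_dartPairs, Finset.mem_univ, true_and]
  constructor
  · exact fun hh => ⟨hh.1, h.face_ne hh.1, hh.2⟩
  · exact fun hh => ⟨hh.1, hh.2.2⟩

theorem sum_fiber_tri {a b c : V} {i j k l : ι} (hT : Tri i a b c) (hj : Bd j a b) (hk : Bd k b c)
    (hl : Bd l c a) (ij : j ≠ i) (ik : k ≠ i) (il : l ≠ i) (F : ι → ℤ) :
    ∑ p ∈ (dartPairs G).filter (fun p => L p.1 p.2 = i), F (L p.2 p.1) = F j + F k + F l := by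
  obtain ⟨p, p1, p2, p3, p4⟩ := hT.ab.exists_dart hj ij
  obtain ⟨q, q1, q2, q3, q4⟩ := hT.bc.exists_dart hk ik
  obtain ⟨r, r1, r2, r3, r4⟩ := hT.ca.exists_dart hl il
  have n1 := hT.ab.ne
  have n2 := hT.bc.ne
  have n3 := hT.ca.ne
  have pq : p ≠ q := by
    rintro rfl
    rw [p4] at q4
    simp only [Sym2.eq_iff] at q4
    grind
  have pr : p ≠ r := by
    rintro rfl
    rw [p4] at r4
    simp only [Sym2.eq_iff] at r4
    grind
  have qr : q ≠ r := by
    rintro rfl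
    rw [q4] at r4
    simp only [Sym2.eq_iff] at r4
    grind
  have key : (dartPairs G).filter (fun p => L p.1 p.2 = i) = {p, q, r} := by
    symm
    refine Finset.eq_of_subset_of_card_le ?_ ?_
    · intro t ht
      simp only [Finset.mem_insert, Finset.mem_singleton] at ht
      rw [Finset.mem_filter]
      rcases ht with rfl | rfl | rfl
      exacts [⟨mem_dartPairs.2 p1, p2⟩, ⟨mem_dartPairs.2 q1, q2⟩, ⟨mem_dartPairs.2 r1, r2⟩]
    · rw [h.card_fiber, hT.len, Finset.card_eq_three.2 ⟨p, q, r, pq, pr, qr, rfl⟩]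
  rw [key, Finset.sum_insert (by simp [pq, pr]), Finset.sum_insert (by simp [qr]),
    Finset.sum_singleton, p3, q3, r3]
  ring

variable [Fintype ι]

theorem fiber_nonneg (i : ι) :
    0 ≤ ∑ p ∈ (dartPairs G).filter (fun p => L p.1 p.2 = i), final G L i (L p.2 p.1) ∧
      (∑ p ∈ (dartPairs G).filter (fun p => L p.1 p.2 = i), final G L i (L p.2 p.1) = 0 →
        if faceLen G L i = 3 then InKl G L i else AllTri G L i) := by
  by_cases li : faceLen G L i = 3
  · obtain ⟨e, he⟩ := Finset.card_pos.1 (show 0 < (faceEdges G L i).card by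
      have : (faceEdges G L i).card = 3 := li
      omega)
    induction e with
    | _ a b =>
      obtain ⟨c, hT⟩ := h.faces.exists_tri (mem_faceEdges.1 he) li
      obtain ⟨j, ij, hj⟩ := hT.ab.exists_other
      obtain ⟨k, ik, hk⟩ := hT.bc.exists_other
      obtain ⟨l, il, hl⟩ := hT.ca.exists_other
      rw [h.sum_fiber_tri hT hj hk hl ij ik il, if_pos li]
      exact h.final_tri_sum hT hj hk hl ij ik il
  · rw [if_neg li]
    refine ⟨Finset.sum_nonneg fun p _ => (final_other li).1, fun h0 j hj => ?_⟩
    rw [Finset.sum_eq_zero_iff_of_nonneg fun p _ => (final_other li).1] at h0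
    obtain ⟨ij, u, v, h1, h2⟩ := hj
    obtain ⟨p, p1, p2, p3, -⟩ := h1.exists_dart h2 ij
    have := h0 p (Finset.mem_filter.2 ⟨mem_dartPairs.2 p1, p2⟩)
    rw [p3] at this
    exact (final_other li).2 this

theorem discharging : 18 * (usedFaces G L).card ≤ 11 * Fintype.card G.edgeSet ∧
    (18 * (usedFaces G L).card = 11 * Fintype.card G.edgeSet → ∀ u v, G.Adj u v →
      faceLen G L (L u v) ≤ 6 ∧
        if faceLen G L (L u v) = 3 then InKl G L (L u v) else AllTri G L (L u v)) := by
  have hmem : ∀ p ∈ dartPairs G, L p.1 p.2 ∈ usedFaces G L := fun p hp =>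
    mem_usedFaces.2 ⟨p.1, p.2, mem_dartPairs.1 hp, h.face_ne (mem_dartPairs.1 hp), Or.inl rfl⟩
  have h1 : ∑ i ∈ usedFaces G L,
      ∑ p ∈ (dartPairs G).filter (fun p => L p.1 p.2 = i), final G L i (L p.2 p.1) =
        ∑ i ∈ usedFaces G L, (faceLen G L i : ℤ) * own (faceLen G L i) := by
    have e1 : ∑ i ∈ usedFaces G L,
      ∑ p ∈ (dartPairs G).filter (fun p => L p.1 p.2 = i), final G L i (L p.2 p.1) =
        ∑ p ∈ dartPairs G, final G L (L p.1 p.2) (L p.2 p.1) := by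
      rw [← Finset.sum_fiberwise_of_maps_to hmem]
      refine Finset.sum_congr rfl fun i _ => Finset.sum_congr rfl fun p hp => ?_
      rw [(Finset.mem_filter.1 hp).2]
    rw [e1, ← sum_own_eq, ← Finset.sum_fiberwise_of_maps_to hmem]
    refine Finset.sum_congr rfl fun i _ => ?_
    rw [← h.card_fiber i, ← nsmul_eq_mul, ← Finset.sum_const, h.card_fiber]
    refine Finset.sum_congr rfl fun p hp => ?_
    rw [(Finset.mem_filter.1 hp).2]
  have len3 : ∀ i ∈ usedFaces G L, 3 ≤ faceLen G L i := by
    intro i hi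
    obtain ⟨u, v, huv⟩ := mem_usedFaces.1 hi
    exact h.faces.three_le_faceLen huv
  have bound : ∀ i ∈ usedFaces G L, 0 ≤ 55 * (faceLen G L i : ℤ) - 180 -
      faceLen G L i * own (faceLen G L i) ∧ (55 * (faceLen G L i : ℤ) - 180 -
      faceLen G L i * own (faceLen G L i) = 0 → faceLen G L i ≤ 6) := by
    intro i hi
    have := len3 i hi
    unfold own
    split_ifs with h3 h4 h5
    · rw [h3]; norm_num
    · rw [h4]; norm_num
    · rw [h5]; norm_num
    · constructor <;> omega
  have tot := sum_faceLen_le (G := G) (L := L)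
  zify at tot
  have split : ∑ i ∈ usedFaces G L, (55 * (faceLen G L i : ℤ) - 180 -
      faceLen G L i * own (faceLen G L i)) = 55 * ∑ i ∈ usedFaces G L, (faceLen G L i : ℤ) -
      180 * (usedFaces G L).card -
      ∑ i ∈ usedFaces G L, (faceLen G L i : ℤ) * own (faceLen G L i) := by
    rw [Finset.sum_sub_distrib, Finset.sum_sub_distrib, Finset.mul_sum, Finset.sum_const,
      nsmul_eq_mul]
    ring
  have nn1 := Finset.sum_nonneg fun i hi => (bound i hi).1
  have nn2 := Finset.sum_nonneg fun i (_ : i ∈ usedFaces G L) => (h.fiber_nonneg i).1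
  constructor
  · zify
    linarith
  · intro heq u v huv
    zify at heq
    have hi := hmem (u, v) (mem_dartPairs.2 huv)
    have z1 := (Finset.sum_eq_zero_iff_of_nonneg fun i hi => (bound i hi).1).1
      (by linarith) _ hi
    have z2 := (Finset.sum_eq_zero_iff_of_nonneg fun i (_ : i ∈ usedFaces G L) =>
      (h.fiber_nonneg i).1).1 (by linarith) _ hi
    exact ⟨(bound _ hi).2 z1, (h.fiber_nonneg _).2 z2⟩

end Nice

end total

section tight
open scoped Classical

variable {V ι : Type*} [Fintype V] {G : SimpleGraph V} {L : V → V → ι}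

local notation "Bd" => Borders G L
local notation "Tri" => IsTri G L
local notation "Kl" => IsKl G L

variable (G L) in
/-- Every face is a triangle in a cluster of five or a hexagon surrounded by triangles. -/
def Tight : Prop := ∀ i u v, Borders G L i u v → (faceLen G L i = 3 ∧ InKl G L i) ∨
  (faceLen G L i = 6 ∧ AllTri G L i)

variable (G L) in
/-- The edges bordering hexagons. -/
def SixAdj (u v : V) : Prop := ∃ i, faceLen G L i = 6 ∧ Borders G L i u v

theorem SixAdj.symm {u v : V} (h : SixAdj G L u v) : SixAdj G L v u := by
  obtain ⟨i, h1, h2⟩ := h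
  exact ⟨i, h1, h2.symm⟩

theorem IsTri.apex_eq {a b c d : V} {i : ι} (hF : FaceSystem G L) (h1 : Tri i a b c)
    (h2 : Tri i d b c) : a = d := by
  have := h1.bd hF h2.ab
  have := h2.ca.ne
  have := h2.ab.ne
  grind

namespace Nice

variable (h : Nice G L) [Fintype ι]
include h

theorem kl_side {b a c x z : V} {i j k o m F : ι} (K : Kl b a c x z i j k o m)
    (hF : (Bd F c x ∧ F ≠ k) ∨ (Bd F c z ∧ F ≠ o) ∨ (Bd F x z ∧ F ≠ m)) :
    F ≠ i ∧ F ≠ j ∧ F ≠ k ∧ F ≠ o ∧ F ≠ m := by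
  obtain ⟨bz, -⟩ := h.kl_ne K
  obtain ⟨ab, ac, ax, az, bc, bx, cx, cz, xz⟩ := K.adj
  have n1 := ab.ne
  have n2 := ac.ne
  have n3 := ax.ne
  have n4 := az.ne
  have n5 := bc.ne
  have n6 := bx.ne
  have n7 := cx.ne
  have n8 := cz.ne
  have n9 := xz.ne
  obtain ⟨p, q, hB⟩ : ∃ p q, Bd F p q ∧ ((p = c ∧ q = x ∧ F ≠ k) ∨ (p = c ∧ q = z ∧ F ≠ o) ∨
      (p = x ∧ q = z ∧ F ≠ m)) := by
    rcases hF with hF | hF | hF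
    exacts [⟨c, x, hF.1, by tauto⟩, ⟨c, z, hF.1, by tauto⟩, ⟨x, z, hF.1, by tauto⟩]
  obtain ⟨hB, hpq⟩ := hB
  refine ⟨?_, ?_, ?_, ?_, ?_⟩ <;> rintro rfl
  · have := K.ctr.t1.bd h.faces hB
    grind
  · have := K.ctr.t2.bd h.faces hB
    grind
  · have := K.ctr.t3.bd h.faces hB
    grind
  · have := K.t4.bd h.faces hB
    grind
  · have := K.t5.bd h.faces hB
    grind

variable (Z : Tight G L)
include Z

theorem kl_six {b a c x z : V} {i j k o m : ι} (K : Kl b a c x z i j k o m) {p q : V}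
    (hp : p = c ∨ p = x ∨ p = z) (hq : q = c ∨ q = x ∨ q = z) (hpq : p ≠ q) : SixAdj G L p q := by
  have key : ∀ {t p q}, Bd t p q → (p = c ∨ p = x ∨ p = z) → (q = c ∨ q = x ∨ q = z) →
      (∀ F, Bd F p q → F ≠ t → (Bd F c x ∧ F ≠ k) ∨ (Bd F c z ∧ F ≠ o) ∨ (Bd F x z ∧ F ≠ m)) →
      SixAdj G L p q := by
    intro t p q ht hp hq hh
    obtain ⟨F, Ft, hF⟩ := ht.exists_other
    have := h.kl_len K hp hq (h.kl_side K (hh F hF Ft)) hF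
    rcases Z F p q hF with h3 | h3
    · omega
    · exact ⟨F, h3.1, hF⟩
  have s1 : SixAdj G L c x := key K.ctr.t3.bc (by tauto) (by tauto) (by tauto)
  have s2 : SixAdj G L c z := key K.t4.bc (by tauto) (by tauto) (by tauto)
  have s3 : SixAdj G L x z := key K.t5.bc (by tauto) (by tauto) (by tauto)
  rcases hp with rfl | rfl | rfl <;> rcases hq with rfl | rfl | rfl <;>
    first | exact absurd rfl hpq | assumption | (apply SixAdj.symm; assumption)

omit [Fintype ι] Z in
/-- A hexagon does not contain exactly two edges of an outer triangle of a cluster. -/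
theorem no_third {v p r : V} {F : ι} (lF : faceLen G L F = 6) (h1 : Bd F v p) (h2 : Bd F v r)
    (hv : ∀ w, Bd F v w → w = p ∨ w = r) (pr : G.Adj p r) (hpr : ¬ Bd F p r) : False := by
  have vp := h1.ne
  have vr := h2.ne
  have npr := pr.ne
  have lF' : (faceEdges G L F).card = 6 := lF
  obtain ⟨s, sv, rs⟩ := h.faces.even_card_borders F h2.symm
  obtain ⟨u, uv, pu⟩ := h.faces.even_card_borders F h1.symm
  obtain ⟨t, tr, st⟩ := h.faces.even_card_borders F rs.symm
  obtain ⟨y, ys, ty⟩ := h.faces.even_card_borders F st.symm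
  have quad : ∀ w, Bd F r w → Bd F w p → w ≠ v → False := by
    intro w g1 g2 g3
    have e := evenEdges_quad (a := v) (b := r) (c := w) (d := p) (by
      have := g1.ne
      have := g2.ne
      simp only [List.nodup_cons, List.mem_cons, List.not_mem_nil]; grind)
    have := (h.faces.evenEdges F).eq_of_subset e.1 (by
      intro e
      simp only [Finset.mem_insert, Finset.mem_singleton]
      rintro (rfl | rfl | rfl | rfl)
      exacts [mem_faceEdges.2 h2, mem_faceEdges.2 g1, mem_faceEdges.2 g2,
        mem_faceEdges.2 h1.symm]) (by omega)
    rw [this] at lF'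
    omega
  have pent : ∀ w w', Bd F r w → Bd F w w' → Bd F w' p → w ≠ v → w' ≠ v → w ≠ p → w' ≠ r →
      False := by
    intro w w' g1 g2 g3 n1 n2 n3 n4
    have e := evenEdges_pent (a := v) (b := r) (c := w) (d := w') (e := p) (by
      have := g1.ne
      have := g2.ne
      have := g3.ne
      simp only [List.nodup_cons, List.mem_cons, List.not_mem_nil]; grind)
    have := (h.faces.evenEdges F).eq_of_subset e.1 (by
      intro e
      simp only [Finset.mem_insert, Finset.mem_singleton]
      rintro (rfl | rfl | rfl | rfl | rfl)
      exacts [mem_faceEdges.2 h2, mem_faceEdges.2 g1, mem_faceEdges.2 g2, mem_faceEdges.2 g3,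
        mem_faceEdges.2 h1.symm]) (by omega)
    rw [this] at lF'
    omega
  have sp : s ≠ p := by rintro rfl; exact hpr rs.symm
  have ur : u ≠ r := by rintro rfl; exact hpr pu
  have us : u ≠ s := by rintro rfl; exact quad _ rs pu.symm sv
  have tv : t ≠ v := by
    rintro rfl
    have := hv s st.symm
    have := rs.ne
    grind
  have tp : t ≠ p := by rintro rfl; exact quad _ rs st sv
  have tu : t ≠ u := by rintro rfl; exact pent _ _ rs st pu.symm sv tv sp tr
  have nrs := rs.ne
  have nst := st.ne
  have nty := ty.ne
  have npu := pu.ne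
  have yu : y = u := by
    by_contra hyu
    obtain ⟨w, wp, uw⟩ := h.faces.even_card_borders F pu.symm
    have nuw := uw.ne
    have hn : [s(p, v), s(v, r), s(r, s), s(s, t), s(t, y), s(p, u), s(u, w)].Nodup := by
      simp only [List.nodup_cons, List.mem_cons, List.not_mem_nil, Sym2.eq_iff]
      grind
    have hs : [s(p, v), s(v, r), s(r, s), s(s, t), s(t, y), s(p, u), s(u, w)].toFinset ⊆
        faceEdges G L F := by
      intro e
      simp only [List.mem_toFinset, List.mem_cons, List.not_mem_nil, or_false]
      rintro (rfl | rfl | rfl | rfl | rfl | rfl | rfl)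
      exacts [mem_faceEdges.2 h1.symm, mem_faceEdges.2 h2, mem_faceEdges.2 rs,
        mem_faceEdges.2 st, mem_faceEdges.2 ty, mem_faceEdges.2 pu, mem_faceEdges.2 uw]
    have := Finset.card_le_card hs
    rw [List.toFinset_card_of_nodup hn] at this
    simp at this
    omega
  subst yu
  exact h.free.short h1.symm.adj h2.adj rs.adj st.adj ty.adj pu.symm.adj pr (by grind)

end Nice

end tight

section tightcount
open scoped Classical

variable {V ι : Type*} [Fintype V] {G : SimpleGraph V} {L : V → V → ι}

local notation "Bd" => Borders G L
local notation "Tri" => IsTri G L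
local notation "Kl" => IsKl G L

variable (G L) in
/-- The set of edges bordering hexagons. -/
noncomputable def sixEdges [Fintype ι] : Finset (Sym2 V) :=
  ((usedFaces G L).filter fun i => faceLen G L i = 6).biUnion (faceEdges G L)

theorem mem_sixEdges [Fintype ι] {u v : V} : s(u, v) ∈ sixEdges G L ↔ SixAdj G L u v := by
  simp only [sixEdges, Finset.mem_biUnion, Finset.mem_filter, mem_faceEdges, mem_usedFaces]
  constructor
  · rintro ⟨i, ⟨-, hi⟩, hB⟩
    exact ⟨i, hi, hB⟩
  · rintro ⟨i, hi, hB⟩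
    exact ⟨i, ⟨⟨u, v, hB⟩, hi⟩, hB⟩

theorem card_sixEdges_le [Fintype ι] :
    (sixEdges G L).card ≤ 6 * ((usedFaces G L).filter fun i => faceLen G L i = 6).card := by
  rw [mul_comm]
  refine Finset.card_biUnion_le_card_mul _ _ _ fun i hi => ?_
  exact (Finset.mem_filter.1 hi).2.le

namespace Nice

variable (h : Nice G L) [Fintype ι] (Z : Tight G L)
include h Z

theorem exists_third {v p q : V} {F : ι} (lF : faceLen G L F = 6) (hp : Bd F v p) (hq : Bd F v q)
    (qp : q ≠ p) : ∃ r, r ≠ p ∧ r ≠ q ∧ SixAdj G L v r := by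
  by_contra! hc
  have all : ∀ w, SixAdj G L v w → w = p ∨ w = q := by
    intro w hw
    by_contra! hne
    exact hc w hne.1 hne.2 hw
  have hA : AllTri G L F := by
    have := Z F v p hp
    rcases this with h3 | h3
    · omega
    · exact h3.2
  obtain ⟨d, dF, hd⟩ := hp.exists_other
  have ld := hA d ⟨dF, _, _, hp, hd⟩
  have kd : InKl G L d := by
    rcases Z d v p hd with h3 | h3
    · exact h3.2
    · omega
  obtain ⟨b, a, c, x, z, i, j, k, o, m, K, ht⟩ := kd
  obtain ⟨-, hv, hp'⟩ := h.kl_outer K ht (by omega) hd hp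
  obtain ⟨ab, ac, ax, az, bc, bx, cx, cz, xz⟩ := K.adj
  have n1 := cx.ne
  have n2 := cz.ne
  have n3 := xz.ne
  have vp := hp.ne
  obtain ⟨r, hr, rv, rp⟩ : ∃ r, (r = c ∨ r = x ∨ r = z) ∧ r ≠ v ∧ r ≠ p := by
    rcases hv with rfl | rfl | rfl <;> rcases hp' with rfl | rfl | rfl <;>
      first | exact absurd rfl vp | exact ⟨c, by grind⟩ | exact ⟨x, by grind⟩ | exact ⟨z, by grind⟩
  have hsix := h.kl_six Z K hv hr rv.symm
  obtain rfl : r = q := (all r hsix).resolve_left rp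
  have pr : G.Adj p r := by
    obtain ⟨_, _, hB⟩ := h.kl_six Z K hp' hr rp.symm
    exact hB.adj
  have F5 : F ≠ i ∧ F ≠ j ∧ F ≠ k ∧ F ≠ o ∧ F ≠ m := by
    refine ⟨?_, ?_, ?_, ?_, ?_⟩ <;> rintro rfl
    · have := K.ctr.t1.len; omega
    · have := K.ctr.t2.len; omega
    · have := K.ctr.t3.len; omega
    · have := K.t4.len; omega
    · have := K.t5.len; omega
  by_cases hpr : Bd F p r
  · have : Bd F c x ∧ Bd F c z ∧ Bd F x z := by
      have := hp.symm
      have := hq.symm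
      have := hpr.symm
      rcases hv with rfl | rfl | rfl <;> rcases hp' with rfl | rfl | rfl <;>
        rcases hr with rfl | rfl | rfl <;> tauto
    exact h.cluster_no_common K.ctr K.t4 K.oi K.t5 K.mj this.1 F5.2.2.1 this.2.1 F5.2.2.2.1
      this.2.2 F5.2.2.2.2
  · exact h.no_third lF hp hq (fun w hw => all w ⟨F, lF, hw⟩) pr hpr

theorem four_le_sixEdges {v p : V} (hs : SixAdj G L v p) :
    4 ≤ ((sixEdges G L).filter (v ∈ ·)).card := by
  obtain ⟨F, lF, hp⟩ := hs
  obtain ⟨q, qp, hq⟩ := h.faces.even_card_borders F hp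
  obtain ⟨r, rp, rq, F', lF', hr⟩ := h.exists_third Z lF hp hq qp
  by_cases hFF : F' = F
  · subst hFF
    have hev := (h.faces.evenEdges F').2 v
    have h3 : 3 ≤ ((faceEdges G L F').filter (v ∈ ·)).card := by
      have : ({s(v, p), s(v, q), s(v, r)} : Finset (Sym2 V)).card = 3 := by
        refine Finset.card_eq_three.2 ⟨_, _, _, ?_, ?_, ?_, rfl⟩ <;>
          (simp only [ne_eq, Sym2.eq_iff]; grind)
      rw [← this]
      refine Finset.card_le_card fun e => ?_
      simp only [Finset.mem_insert, Finset.mem_singleton, Finset.mem_filter]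
      rintro (rfl | rfl | rfl)
      exacts [⟨mem_faceEdges.2 hp, by simp⟩, ⟨mem_faceEdges.2 hq, by simp⟩,
        ⟨mem_faceEdges.2 hr, by simp⟩]
    have hle : ((faceEdges G L F').filter (v ∈ ·)).card ≤
        ((sixEdges G L).filter (v ∈ ·)).card := by
      refine Finset.card_le_card (Finset.filter_subset_filter _ ?_)
      exact Finset.subset_biUnion_of_mem _ (Finset.mem_filter.2 ⟨mem_usedFaces.2 ⟨v, p, hp⟩, lF⟩)
    obtain ⟨t, ht⟩ := hev
    omega
  · have hA : AllTri G L F := by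
      rcases Z F v p hp with h3 | h3
      · omega
      · exact h3.2
    have no : ∀ w, Bd F v w → ¬ Bd F' v w := by
      intro w h1 h2
      have := hA F' ⟨hFF, _, _, h1, h2⟩
      omega
    obtain ⟨s, sr, hs⟩ := h.faces.even_card_borders F' hr
    have sp : s ≠ p := by rintro rfl; exact no _ hp hs
    have sq : s ≠ q := by rintro rfl; exact no _ hq hs
    have hn : [s(v, p), s(v, q), s(v, r), s(v, s)].Nodup := by
      simp only [List.nodup_cons, List.mem_cons, List.not_mem_nil, Sym2.eq_iff]
      grind
    have : [s(v, p), s(v, q), s(v, r), s(v, s)].toFinset.card = 4 := by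
      rw [List.toFinset_card_of_nodup hn]
      rfl
    rw [← this]
    refine Finset.card_le_card fun e => ?_
    simp only [List.mem_toFinset, List.mem_cons, List.not_mem_nil, or_false, Finset.mem_filter]
    rintro (rfl | rfl | rfl | rfl)
    exacts [⟨mem_sixEdges.2 ⟨F, lF, hp⟩, by simp⟩, ⟨mem_sixEdges.2 ⟨F, lF, hq⟩, by simp⟩,
      ⟨mem_sixEdges.2 ⟨F', lF', hr⟩, by simp⟩, ⟨mem_sixEdges.2 ⟨F', lF', hs⟩, by simp⟩]

theorem exists_kl_of_inner {v : V} (hv : ∀ w, ¬ SixAdj G L v w) :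
    ∃ b a c x z i j k o m, Kl b a c x z i j k o m ∧ (v = a ∨ v = b) := by
  obtain ⟨w, hw, -, -⟩ := h.deg3 v v v
  have hB := h.bd_left hw
  have hk : InKl G L (L v w) := by
    rcases Z _ v w hB with h3 | h3
    · exact h3.2
    · exact absurd ⟨_, h3.1, hB⟩ (hv w)
  obtain ⟨b, a, c, x, z, i, j, k, o, m, K, ht⟩ := hk
  refine ⟨b, a, c, x, z, i, j, k, o, m, K, ?_⟩
  obtain ⟨ab, ac, ax, az, bc, bx, cx, cz, xz⟩ := K.adj
  have n1 := cx.ne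
  have n2 := cz.ne
  have n3 := xz.ne
  have hmem : v = a ∨ v = b ∨ v = c ∨ v = x ∨ v = z := by
    rcases ht with ht | ht | ht | ht | ht <;> rw [ht] at hB
    · have := K.ctr.t1.bd h.faces hB; tauto
    · have := K.ctr.t2.bd h.faces hB; tauto
    · have := K.ctr.t3.bd h.faces hB; tauto
    · have := K.t4.bd h.faces hB; tauto
    · have := K.t5.bd h.faces hB; tauto
  rcases hmem with rfl | rfl | rfl | rfl | rfl
  · exact Or.inl rfl
  · exact Or.inr rfl
  · exact absurd (h.kl_six Z K (by tauto) (by tauto) n1) (hv _)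
  · exact absurd (h.kl_six Z K (by tauto) (by tauto) n3) (hv _)
  · exact absurd (h.kl_six Z K (by tauto) (by tauto) n2.symm) (hv _)

end Nice

end tightcount

section tightend
open scoped Classical

variable {V ι : Type*} [Fintype V] {G : SimpleGraph V} {L : V → V → ι}

local notation "Bd" => Borders G L
local notation "Tri" => IsTri G L
local notation "Kl" => IsKl G L

variable (G L) in
/-- The vertex is interior to a cluster of five triangles having the edge on its outer triangle. -/
def KlRel (v : V) (e : Sym2 V) : Prop := ∃ b a c x z i j k o m, IsKl G L b a c x z i j k o m ∧
  (v = a ∨ v = b) ∧ (e = s(c, x) ∨ e = s(c, z) ∨ e = s(x, z))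

namespace Nice

variable (h : Nice G L) [Fintype ι] (Z : Tight G L)
include h Z

omit [Fintype ι] Z in
theorem tri_eq {p q u v : V} {s t : ι} (hs : Tri s u p q) (ht : Tri t v p q)
    (hp : SixAdj G L p q) : s = t ∧ u = v := by
  obtain ⟨F, lF, hF⟩ := hp
  have l1 := hs.len
  have l2 := ht.len
  have hsF : s ≠ F := by rintro rfl; omega
  have hst : t = s := by
    rcases hs.bc.eq_or hF hsF ht.bc with h1 | rfl
    · exact h1
    · omega
  subst hst
  exact ⟨rfl, hs.apex_eq h.faces ht⟩

theorem kl_unique_inner {b a c x z b' a' z' : V} {i j k o m i' j' k' o' m' : ι}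
    (K : Kl b a c x z i j k o m) (K' : Kl b' a' c x z' i' j' k' o' m') : a' = a ∧ b' = b := by
  obtain ⟨-, hb⟩ := h.tri_eq K.ctr.t3 K'.ctr.t3
    (h.kl_six Z K (by tauto) (by tauto) K.ctr.t3.bc.ne)
  subst hb
  have := h.ctr_nbr K.ctr K'.ctr.t1.ab.adj
  have := K'.ctr.ne
  grind

theorem kl_unique_outer {b a c x z b' a' x' : V} {i j k o m i' j' k' o' m' : ι}
    (K : Kl b a c x z i j k o m) (K' : Kl b' a' c x' z i' j' k' o' m') : a' = a ∧ b' = b := by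
  obtain ⟨-, hb⟩ := h.tri_eq K.t4 K'.t4 (h.kl_six Z K (by tauto) (by tauto) K.t4.bc.ne)
  subst hb
  have h1 := h.kl_nbr K K'.adj.1
  have h2 := h.ctr_nbr K'.ctr (w := z)
  have h3 := K.adj.2.2.2.2.2.2.2.2
  have h4 := K'.ctr.ne
  have h5 := K'.t4.bc.ne
  have h6 := K'.t4.ca.ne
  have h7 := K'.t5.bc.ne
  have h8 := h.kl_ne K'
  grind

theorem kl_unique_outer' {b a c x z b' a' x' : V} {i j k o m i' j' k' o' m' : ι}
    (K : Kl b a c x z i j k o m) (K' : Kl b' a' z x' c i' j' k' o' m') : a' = a ∧ b' = b := by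
  obtain ⟨-, hb⟩ := h.tri_eq K.t4 K'.t4.rot.rot.swap
    (h.kl_six Z K (by tauto) (by tauto) K.t4.bc.ne)
  subst hb
  have h1 := h.kl_nbr K K'.adj.1
  have h2 := h.ctr_nbr K'.ctr (w := c)
  have h3 := K.adj.2.2.2.2.2.2.1
  have h4 := K'.ctr.ne
  have h5 := K'.t4.bc.ne
  have h6 := K'.t4.ca.ne
  have h7 := K'.t5.bc.ne
  have h8 := h.kl_ne K'
  grind [SimpleGraph.Adj.symm]

theorem kl_inner_ne_outer {b a c x z b' a' c' x' z' : V} {i j k o m i' j' k' o' m' : ι}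
    (K : Kl b a c x z i j k o m) (K' : Kl b' a' c' x' z' i' j' k' o' m') :
    s(c, x) ≠ s(c', z') := by
  intro he
  have hT : Tri o' a' c x := by
    rcases Sym2.eq_iff.1 he with ⟨rfl, rfl⟩ | ⟨rfl, rfl⟩
    exacts [K'.t4, K'.t4.rot.rot.swap]
  obtain ⟨-, hb⟩ := h.tri_eq K.ctr.t3 hT
    (h.kl_six Z K (by tauto) (by tauto) K.ctr.t3.bc.ne)
  subst hb
  have h1 := h.ctr_nbr K.ctr K'.adj.1
  have h2 := h.ctr_nbr K.ctr K'.adj.2.2.1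
  have h4 := K'.ctr.ne
  have h5 := K'.t4.bc.ne
  have h6 := K'.t4.ca.ne
  have h7 := K'.t5.bc.ne
  have h8 := h.kl_ne K'
  rcases Sym2.eq_iff.1 he with ⟨rfl, rfl⟩ | ⟨rfl, rfl⟩ <;> grind

theorem kl_unique {b a c x z b' a' c' x' z' : V} {i j k o m i' j' k' o' m' : ι}
    (K : Kl b a c x z i j k o m) (K' : Kl b' a' c' x' z' i' j' k' o' m') {e : Sym2 V}
    (he : e = s(c, x) ∨ e = s(c, z) ∨ e = s(x, z))
    (he' : e = s(c', x') ∨ e = s(c', z') ∨ e = s(x', z')) : a' = a ∧ b' = b := by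
  have cz : ∀ {c x i j o m c' x' i' j' o' m'}, Kl b a c x z i j k o m →
      Kl b' a' c' x' z' i' j' k' o' m' → s(c, z) = s(c', z') → a' = a ∧ b' = b := by
    intro c x i j o m c' x' i' j' o' m' K K' he
    rcases Sym2.eq_iff.1 he with ⟨rfl, rfl⟩ | ⟨rfl, rfl⟩
    exacts [h.kl_unique_outer Z K K', h.kl_unique_outer' Z K K']
  rcases he with rfl | rfl | rfl <;> rcases he' with he | he | he
  · rcases Sym2.eq_iff.1 he with ⟨rfl, rfl⟩ | ⟨rfl, rfl⟩
    exacts [h.kl_unique_inner Z K K', h.kl_unique_inner Z K K'.swap]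
  · exact absurd he (h.kl_inner_ne_outer Z K K')
  · exact absurd he (h.kl_inner_ne_outer Z K K'.swap)
  · exact absurd he.symm (h.kl_inner_ne_outer Z K' K)
  · exact cz K K' he
  · exact cz K K'.swap he
  · exact absurd he.symm (h.kl_inner_ne_outer Z K' K.swap)
  · exact cz K.swap K' he
  · exact cz K.swap K'.swap he

theorem card_inner_le : (Finset.univ.filter fun v => ∀ w, ¬ SixAdj G L v w).card * 3 ≤
    (sixEdges G L).card * 2 := by
  refine Finset.card_mul_le_card_mul (KlRel G L) ?_ ?_
  · intro v hv
    obtain ⟨b, a, c, x, z, i, j, k, o, m, K, hab⟩ :=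
      h.exists_kl_of_inner Z (Finset.mem_filter.1 hv).2
    have n1 := K.ctr.t3.bc.ne
    have n2 := K.t4.bc.ne
    have n3 := K.t5.bc.ne
    have hc : ({s(c, x), s(c, z), s(x, z)} : Finset (Sym2 V)).card = 3 := by
      refine Finset.card_eq_three.2 ⟨_, _, _, ?_, ?_, ?_, rfl⟩ <;>
        (simp only [ne_eq, Sym2.eq_iff]; grind)
    rw [← hc]
    refine Finset.card_le_card fun e => ?_
    simp only [Finset.mem_insert, Finset.mem_singleton, Finset.mem_bipartiteAbove]
    intro he
    refine ⟨?_, b, a, c, x, z, i, j, k, o, m, K, hab, he⟩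
    rcases he with rfl | rfl | rfl
    exacts [mem_sixEdges.2 (h.kl_six Z K (by tauto) (by tauto) n1),
      mem_sixEdges.2 (h.kl_six Z K (by tauto) (by tauto) n2),
      mem_sixEdges.2 (h.kl_six Z K (by tauto) (by tauto) n3)]
  · intro e _
    by_cases hne : ∃ v, KlRel G L v e
    · obtain ⟨v, b, a, c, x, z, i, j, k, o, m, K, hab, he⟩ := hne
      refine (Finset.card_le_card (t := {a, b}) fun w hw => ?_).trans Finset.card_le_two
      obtain ⟨-, b', a', c', x', z', i', j', k', o', m', K', hab', he'⟩ :=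
        (Finset.mem_bipartiteBelow _).1 hw
      obtain ⟨rfl, rfl⟩ := h.kl_unique Z K K' he he'
      simpa using hab'
    · push Not at hne
      rw [Finset.bipartiteBelow, Finset.filter_false_of_mem fun w _ => hne w]
      simp

theorem card_outer_le : (Finset.univ.filter fun v => ¬ ∀ w, ¬ SixAdj G L v w).card * 4 ≤
    (sixEdges G L).card * 2 := by
  refine Finset.card_mul_le_card_mul (fun (v : V) (e : Sym2 V) => v ∈ e) ?_ ?_
  · intro v hv
    obtain ⟨p, hp⟩ := not_forall_not.1 (Finset.mem_filter.1 hv).2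
    exact h.four_le_sixEdges Z hp
  · intro e _
    induction e with
    | _ a b =>
      refine (Finset.card_le_card (t := {a, b}) fun w hw => ?_).trans Finset.card_le_two
      simpa using ((Finset.mem_bipartiteBelow _).1 hw).2

theorem card_le_of_tight :
    Fintype.card V ≤ 7 * ((usedFaces G L).filter fun i => faceLen G L i = 6).card := by
  have h1 := h.card_inner_le Z
  have h2 := h.card_outer_le Z
  have h3 := card_sixEdges_le (G := G) (L := L)
  have h4 := Finset.card_filter_add_card_filter_not (s := (Finset.univ : Finset V))
    (fun v => ∀ w, ¬ SixAdj G L v w)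
  rw [Finset.card_univ] at h4
  omega

omit Z in
theorem seven_mul_lt [hV : Nonempty V] : 7 * Fintype.card G.edgeSet + 36 < 18 * Fintype.card V := by
  obtain ⟨v⟩ := hV
  obtain ⟨w, hw, -⟩ := h.deg3 v v v
  have h1 := card_edgeFinset_add_two_le h.faces ⟨v, w, hw, h.face_ne hw⟩
  obtain ⟨h2, h3⟩ := h.discharging
  rcases h2.lt_or_eq with h2 | h2
  · omega
  exfalso
  replace h3 := h3 h2
  have tri : ∀ i u v, Bd i u v → faceLen G L i = 3 → InKl G L i := by
    intro i u v hB hl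
    rcases hB.2.2 with rfl | rfl
    · have := (h3 u v hB.adj).2
      rwa [if_pos hl] at this
    · have := (h3 v u hB.adj.symm).2
      rwa [if_pos hl] at this
  have Z : Tight G L := by
    intro i u v hB
    by_cases hl : faceLen G L i = 3
    · exact Or.inl ⟨hl, tri i u v hB hl⟩
    have hi : faceLen G L i ≤ 6 ∧ AllTri G L i := by
      rcases hB.2.2 with rfl | rfl
      · have := h3 u v hB.adj
        rwa [if_neg hl] at this
      · have := h3 v u hB.adj.symm
        rwa [if_neg hl] at this
    obtain ⟨d, di, hd⟩ := hB.exists_other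
    have ld := hi.2 d ⟨di, _, _, hB, hd⟩
    obtain ⟨b, a, c, x, z, i, j, k, o, m, K, ht⟩ := tri d u v hd ld
    have := (h.kl_outer K ht hl hd hB).1
    exact Or.inr ⟨by omega, hi.2⟩
  have h4 := h.card_le_of_tight Z
  have h5 := sum_faceLen_le (G := G) (L := L)
  have h6 := Finset.card_filter_add_card_filter_not (s := usedFaces G L)
    (fun i => faceLen G L i = 6)
  have h7 : ∑ i ∈ usedFaces G L, faceLen G L i =
      6 * ((usedFaces G L).filter fun i => faceLen G L i = 6).card +
      3 * ((usedFaces G L).filter fun i => ¬ faceLen G L i = 6).card := by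
    rw [← Finset.sum_filter_add_sum_filter_not _ (fun i => faceLen G L i = 6)]
    congr 1
    · rw [Finset.sum_congr rfl fun i hi => (Finset.mem_filter.1 hi).2, Finset.sum_const,
        smul_eq_mul, mul_comm]
    · have : ∀ i ∈ (usedFaces G L).filter fun i => ¬ faceLen G L i = 6, faceLen G L i = 3 := by
        intro i hi
        obtain ⟨h8, h9⟩ := Finset.mem_filter.1 hi
        obtain ⟨u, v, hB⟩ := mem_usedFaces.1 h8
        rcases Z i u v hB with h10 | h10
        · exact h10.1
        · exact absurd h10.1 h9
      rw [Finset.sum_congr rfl this, Finset.sum_const, smul_eq_mul, mul_comm]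
  omega

end Nice

end tightend

section induced
open scoped Classical

variable {V : Type*} {G : SimpleGraph V}

theorem GridMinor.not_complete_five [Fintype V] (h : GridMinor G) (hc : Fintype.card V = 5)
    (hall : ∀ u v, u ≠ v → G.Adj u v) : False := by
  obtain ⟨ι, _, L, hF⟩ := h.exists_faceSystem
  have hE : (dartPairs G).card = 20 := by
    have : dartPairs G = Finset.univ.offDiag := by
      ext ⟨u, v⟩
      simp only [mem_dartPairs, Finset.mem_offDiag, Finset.mem_univ, true_and]
      exact ⟨fun h => h.ne, hall u v⟩
    rw [this, Finset.offDiag_card, Finset.card_univ, hc]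
  rw [card_dartPairs] at hE
  have hn : ∀ v, NoCut G v := by
    intro v a b ha hb
    by_cases hab : a = b
    · rw [hab]
    · exact Relation.ReflTransGen.single ⟨hall a b hab, ha, hb⟩
  have h2 : 2 < (Finset.univ : Finset V).card := by rw [Finset.card_univ, hc]; norm_num
  obtain ⟨u, v, w, -, -, -, huv, huw, hvw⟩ := Finset.two_lt_card_iff.1 h2
  have hne : L u v ≠ L v u := by
    intro he
    obtain ⟨z, hz1, hz2, hz3, hz4, -⟩ := (hn u).exists_cycle (hall u v huv) (hall u w huw) hvw
    obtain ⟨g, hg⟩ := hF.span z hz1 hz2 hz3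
    have := hg u v (hall u v huv)
    rw [he, hz4, ZMod.two_add_self] at this
    exact absurd this (by decide)
  have h3 := card_edgeFinset_add_two_le hF ⟨u, v, hall u v huv, hne⟩
  have h4 := sum_faceLen_le (G := G) (L := L)
  have h5 : (usedFaces G L).card * 3 ≤ ∑ i ∈ usedFaces G L, faceLen G L i := by
    rw [← smul_eq_mul]
    refine Finset.card_nsmul_le_sum _ _ _ fun i hi => ?_
    obtain ⟨a, b, hB⟩ := mem_usedFaces.1 hi
    exact hF.three_le_faceLen hB
  omega

variable (G) in
/-- The ordered pairs of adjacent vertices in `s`. -/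
noncomputable def dartsIn (s : Finset V) : Finset (V × V) :=
  (s ×ˢ s).filter fun p => G.Adj p.1 p.2

theorem mem_dartsIn {s : Finset V} {u v : V} :
    (u, v) ∈ dartsIn G s ↔ u ∈ s ∧ v ∈ s ∧ G.Adj u v := by
  simp [dartsIn, and_assoc]

theorem card_dartsIn (s : Finset V) : (dartsIn G s).card =
    2 * Fintype.card (G.comap (Subtype.val : {x // x ∈ s} → V)).edgeSet := by
  trans (dartPairs (G.comap (Subtype.val : {x // x ∈ s} → V))).card
  swap
  · rw [card_dartPairs]
    congr!
  symm
  refine Finset.card_bij (fun p _ => (p.1.1, p.2.1)) ?_ ?_ ?_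
  · rintro ⟨u, v⟩ h
    exact mem_dartsIn.2 ⟨u.2, v.2, SimpleGraph.comap_adj.1 (mem_dartPairs.1 h)⟩
  · rintro ⟨u, v⟩ _ ⟨u', v'⟩ _ h
    obtain ⟨h1, h2⟩ := Prod.mk.inj h
    exact Prod.ext (Subtype.ext h1) (Subtype.ext h2)
  · rintro ⟨u, v⟩ h
    obtain ⟨h1, h2, h3⟩ := mem_dartsIn.1 h
    exact ⟨(⟨u, h1⟩, ⟨v, h2⟩), mem_dartPairs.2 h3, rfl⟩

theorem card_dartsIn_erase {s : Finset V} {v : V} (hv : v ∈ s) :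
    (dartsIn G s).card = (dartsIn G (s.erase v)).card + 2 * (s.filter fun w => G.Adj v w).card := by
  have h : dartsIn G s = (dartsIn G (s.erase v) ∪ (s.filter fun w => G.Adj v w).image fun w =>
      (v, w)) ∪ (s.filter fun w => G.Adj v w).image fun w => (w, v) := by
    ext ⟨a, b⟩
    simp only [mem_dartsIn, Finset.mem_union, Finset.mem_image, Finset.mem_filter,
      Finset.mem_erase, Prod.mk.injEq]
    constructor
    · rintro ⟨h1, h2, h3⟩
      by_cases ha : a = v
      · subst ha; exact Or.inl (Or.inr ⟨b, ⟨h2, h3⟩, rfl, rfl⟩)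
      · by_cases hb : b = v
        · subst hb; exact Or.inr ⟨a, ⟨h1, h3.symm⟩, rfl, rfl⟩
        · exact Or.inl (Or.inl ⟨⟨ha, h1⟩, ⟨hb, h2⟩, h3⟩)
    · rintro ((⟨⟨_, h1⟩, ⟨_, h2⟩, h3⟩ | ⟨w, ⟨h1, h2⟩, rfl, rfl⟩) | ⟨w, ⟨h1, h2⟩, rfl, rfl⟩)
      exacts [⟨h1, h2, h3⟩, ⟨hv, h1, h2⟩, ⟨h1, hv, h2.symm⟩]
  rw [h, Finset.card_union_of_disjoint, Finset.card_union_of_disjoint,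
    Finset.card_image_of_injective _ fun a b h => (Prod.mk.inj h).2,
    Finset.card_image_of_injective _ fun a b h => (Prod.mk.inj h).1]
  · ring
  · rw [Finset.disjoint_left]
    rintro ⟨a, b⟩ h1 h2
    obtain ⟨w, -, h4⟩ := Finset.mem_image.1 h2
    rw [mem_dartsIn] at h1
    exact Finset.ne_of_mem_erase h1.1 (Prod.mk.inj h4).1.symm
  · rw [Finset.disjoint_left]
    rintro ⟨a, b⟩ h1 h2
    obtain ⟨w, hw, h4⟩ := Finset.mem_image.1 h2
    obtain ⟨rfl, rfl⟩ := Prod.mk.inj h4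
    rcases Finset.mem_union.1 h1 with h1 | h1
    · exact Finset.ne_of_mem_erase (mem_dartsIn.1 h1).2.1 rfl
    · obtain ⟨w', hw', h5⟩ := Finset.mem_image.1 h1
      obtain ⟨rfl, rfl⟩ := Prod.mk.inj h5
      exact (Finset.mem_filter.1 hw').2.ne rfl

theorem card_dartsIn_union {A B : Finset V} {v : V} (hAB : A ∩ B ⊆ {v})
    (hadj : ∀ a ∈ A, ∀ b ∈ B, a ∉ B → b ∉ A → ¬ G.Adj a b) :
    (dartsIn G (A ∪ B)).card = (dartsIn G A).card + (dartsIn G B).card := by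
  rw [← Finset.card_union_of_disjoint]
  · congr 1
    ext ⟨a, b⟩
    simp only [mem_dartsIn, Finset.mem_union]
    constructor
    · rintro ⟨h1, h2, h3⟩
      have := hadj a
      have := hadj b
      have := h3.symm
      grind
    · tauto
  · rw [Finset.disjoint_left]
    rintro ⟨a, b⟩ h1 h2
    rw [mem_dartsIn] at h1 h2
    have h3 := Finset.mem_singleton.1 (hAB (Finset.mem_inter.2 ⟨h1.1, h2.1⟩))
    have h4 := Finset.mem_singleton.1 (hAB (Finset.mem_inter.2 ⟨h1.2.1, h2.2.1⟩))
    exact h1.2.2.ne (h3.trans h4.symm)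

theorem card_dartsIn_add (s : Finset V) : (dartsIn G s).card +
    (s.offDiag.filter fun p => ¬ G.Adj p.1 p.2).card = s.card * s.card - s.card := by
  rw [← Finset.offDiag_card, ← Finset.card_filter_add_card_filter_not (s := s.offDiag)
    (fun p => G.Adj p.1 p.2)]
  congr 2
  ext ⟨a, b⟩
  simp only [mem_dartsIn, Finset.mem_filter, Finset.mem_offDiag]
  exact ⟨fun h => ⟨⟨h.1, h.2.1, h.2.2.ne⟩, h.2.2⟩, fun h => ⟨h.1.1, h.1.2.1, h.2⟩⟩

/-- Few missing edges can be listed. -/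
theorem exists_missing (s : Finset V) (k : ℕ)
    (hk : s.card * s.card - s.card < (dartsIn G s).card + 2 * (k + 1)) :
    ∃ N : Finset (Sym2 V), N.card ≤ k ∧
      ∀ x ∈ s, ∀ y ∈ s, x ≠ y → s(x, y) ∉ N → G.Adj x y := by
  set M := s.offDiag.filter fun p => ¬ G.Adj p.1 p.2 with hM
  have hm : ∀ {x y}, (x, y) ∈ M ↔ (x ∈ s ∧ y ∈ s ∧ x ≠ y) ∧ ¬ G.Adj x y := by
    simp [hM]
  refine ⟨M.image fun p => s(p.1, p.2), ?_, ?_⟩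
  · have h1 := card_dartsIn_add (G := G) s
    have h2 : 2 * (M.image fun p => s(p.1, p.2)).card ≤ M.card := by
      refine Finset.mul_card_image_le_card _ _ fun e he => ?_
      obtain ⟨⟨x, y⟩, hp, rfl⟩ := Finset.mem_image.1 he
      obtain ⟨⟨h1, h2, h3⟩, h4⟩ := hm.1 hp
      have h5 : ({(x, y), (y, x)} : Finset (V × V)).card = 2 :=
        Finset.card_pair fun h => h3 (Prod.mk.inj h).1
      rw [← h5]
      refine Finset.card_le_card fun q hq => ?_
      rw [Finset.mem_filter]
      rcases Finset.mem_insert.1 hq with rfl | hq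
      · exact ⟨hp, rfl⟩
      · rw [Finset.mem_singleton.1 hq]
        exact ⟨hm.2 ⟨⟨h2, h1, h3.symm⟩, fun h => h4 h.symm⟩, Sym2.eq_swap⟩
    rw [← hM] at h1
    omega
  · intro x hx y hy hxy hN
    by_contra hadj
    exact hN (Finset.mem_image.2 ⟨(x, y), hm.2 ⟨⟨hx, hy, hxy⟩, hadj⟩, rfl⟩)

end induced

section reductions
open scoped Classical

variable {V : Type*} {G : SimpleGraph V}

theorem Finset.exists_two_of_card_le_two {α : Type*} [Inhabited α] {N : Finset α}
    (h : N.card ≤ 2) : ∃ a b, ∀ e ∈ N, e = a ∨ e = b := by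
  rcases N.eq_empty_or_nonempty with rfl | ⟨a, ha⟩
  · exact ⟨default, default, by simp⟩
  · have h1 : (N.erase a).card ≤ 1 := by rw [Finset.card_erase_of_mem ha]; omega
    obtain ⟨b, hb⟩ := Finset.card_le_one_iff_subset_singleton.1 h1
    refine ⟨a, b, fun e he => ?_⟩
    by_cases hea : e = a
    · exact Or.inl hea
    · exact Or.inr (Finset.mem_singleton.1 (hb (Finset.mem_erase.2 ⟨hea, he⟩)))

theorem Finset.exists_ne_ne {α : Type*} {F : Finset α} (h : 3 ≤ F.card) (a b : α) :
    ∃ c ∈ F, c ≠ a ∧ c ≠ b := by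
  obtain ⟨c, h1, h2⟩ := Finset.exists_mem_notMem_of_card_lt_card
    (s := {a, b}) (t := F) (by have := Finset.card_le_two (a := a) (b := b); omega)
  exact ⟨c, h1, by simpa using h2⟩

/-- A vertex with two neighbours in `K₅` minus an edge. -/
theorem Theta6Free.no_near_clique_five (hG : Theta6Free G) {v p q r t w : V}
    (hn : [v, p, q, r, t, w].Nodup) (hp : G.Adj v p) (hq : G.Adj v q) (e : Sym2 V)
    (hadj : ∀ x ∈ [p, q, r, t, w], ∀ y ∈ [p, q, r, t, w], x ≠ y → s(x, y) ≠ e → G.Adj x y) :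
    False := by
  have key : ∀ x y z, [v, p, q, x, y, z].Nodup → x ∈ [p, q, r, t, w] → y ∈ [p, q, r, t, w] →
      z ∈ [p, q, r, t, w] →
      e = s(p, x) ∨ e = s(x, y) ∨ e = s(y, z) ∨ e = s(z, q) ∨ e = s(p, y) := by
    intro x y z hd hx hy hz
    by_contra! hne
    obtain ⟨n1, n2, n3, n4, n5⟩ := hne
    simp only [List.nodup_cons, List.mem_cons, List.not_mem_nil, or_false, not_or] at hd
    obtain ⟨⟨d1, d2, d3, d4, d5⟩, ⟨d6, d7, d8, d9⟩, ⟨d10, d11, d12⟩, ⟨d13, d14⟩, d15, -⟩ := hd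
    exact hG.short (hadj p (by simp) x hx d7 n1.symm) (hadj x hx y hy d13 n2.symm)
      (hadj y hy z hz d15 n3.symm) (hadj z hz q (by simp) (Ne.symm d12) n4.symm) hq.symm hp
      (hadj p (by simp) y hy d8 n5.symm) (by grind)
  simp only [List.nodup_cons, List.mem_cons, List.not_mem_nil, or_false, not_or] at hn
  have k1 := key r t w (by simp; grind) (by simp) (by simp) (by simp)
  have k2 := key t w r (by simp; grind) (by simp) (by simp) (by simp)
  have k3 := key w r t (by simp; grind) (by simp) (by simp) (by simp)
  clear key hadj
  rw [Sym2.eq_swap (a := w) (b := r)] at k2 k3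
  have hd : [s(p, r), s(p, t), s(p, w), s(r, q), s(t, q), s(w, q), s(r, t), s(t, w),
      s(r, w)].Nodup := by
    simp only [List.nodup_cons, List.mem_cons, List.not_mem_nil, or_false, not_or, Sym2.eq_iff]
    grind
  generalize s(p, r) = x1 at *
  generalize s(p, t) = x2 at *
  generalize s(p, w) = x3 at *
  generalize s(r, q) = x4 at *
  generalize s(t, q) = x5 at *
  generalize s(w, q) = x6 at *
  generalize s(r, t) = x7 at *
  generalize s(t, w) = x8 at *
  generalize s(r, w) = x9 at *
  simp only [List.nodup_cons, List.mem_cons, List.not_mem_nil, or_false, not_or] at hd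
  grind

/-- Two adjacent vertices attached to `K₅` minus two edges. -/
theorem Theta6Free.no_near_clique_five' (hG : Theta6Free G) {u v p q r t w : V}
    (hn : [u, v, p, q, r, t, w].Nodup) (huv : G.Adj u v) (hp : G.Adj u p) (hq : G.Adj v q)
    (e e' : Sym2 V)
    (hadj : ∀ x ∈ [p, q, r, t, w], ∀ y ∈ [p, q, r, t, w], x ≠ y → s(x, y) ≠ e → s(x, y) ≠ e' →
      G.Adj x y) : False := by
  have key : ∀ x y, [u, v, p, q, x, y].Nodup → x ∈ [p, q, r, t, w] → y ∈ [p, q, r, t, w] →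
      ((e = s(p, x) ∨ e = s(x, y) ∨ e = s(y, q) ∨ e = s(p, y)) ∨
        e' = s(p, x) ∨ e' = s(x, y) ∨ e' = s(y, q) ∨ e' = s(p, y)) ∧
      ((e = s(p, x) ∨ e = s(x, y) ∨ e = s(y, q) ∨ e = s(x, q)) ∨
        e' = s(p, x) ∨ e' = s(x, y) ∨ e' = s(y, q) ∨ e' = s(x, q)) := by
    intro x y hd hx hy
    simp only [List.nodup_cons, List.mem_cons, List.not_mem_nil, or_false, not_or] at hd
    obtain ⟨⟨d1, d2, d3, d4, d5⟩, ⟨d6, d7, d8, d9⟩, ⟨d10, d11, d12⟩, ⟨d13, d14⟩, d15, -⟩ := hd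
    constructor <;> by_contra! hne <;> obtain ⟨n1, n2⟩ := hne
    · exact hG.short (hadj p (by simp) x hx d11 n1.1.symm n2.1.symm)
        (hadj x hx y hy d15 n1.2.1.symm n2.2.1.symm)
        (hadj y hy q (by simp) (Ne.symm d14) n1.2.2.1.symm n2.2.2.1.symm) hq.symm huv.symm hp
        (hadj p (by simp) y hy d12 n1.2.2.2.symm n2.2.2.2.symm) (by grind)
    · exact hG.short (hadj x hx y hy d15 n1.2.1.symm n2.2.1.symm)
        (hadj y hy q (by simp) (Ne.symm d14) n1.2.2.1.symm n2.2.2.1.symm) hq.symm huv.symm hp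
        (hadj p (by simp) x hx d11 n1.1.symm n2.1.symm)
        (hadj x hx q (by simp) (Ne.symm d13) n1.2.2.2.symm n2.2.2.2.symm) (by grind)
  simp only [List.nodup_cons, List.mem_cons, List.not_mem_nil, or_false, not_or] at hn
  obtain ⟨⟨_, u1, u2, u3, u4, u5⟩, ⟨v1, v2, v3, v4, v5⟩, ⟨p1, p2, p3, p4⟩, ⟨q1, q2, q3⟩,
    ⟨r1, r2⟩, t1, -⟩ := hn
  have k1 := key r t (by simp; grind) (by simp) (by simp)
  have k2 := key t r (by simp; grind) (by simp) (by simp)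
  have k3 := key t w (by simp; grind) (by simp) (by simp)
  have k4 := key w t (by simp; grind) (by simp) (by simp)
  have k5 := key r w (by simp; grind) (by simp) (by simp)
  have k6 := key w r (by simp; grind) (by simp) (by simp)
  clear key hadj
  rw [Sym2.eq_swap (a := t) (b := r)] at k2
  rw [Sym2.eq_swap (a := w) (b := t)] at k4
  rw [Sym2.eq_swap (a := w) (b := r)] at k6
  have hd : [s(p, r), s(p, t), s(p, w), s(r, q), s(t, q), s(w, q), s(r, t), s(t, w),
      s(r, w)].Nodup := by
    simp only [List.nodup_cons, List.mem_cons, List.not_mem_nil, or_false, not_or, Sym2.eq_iff]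
    grind
  generalize s(p, r) = x1 at *
  generalize s(p, t) = x2 at *
  generalize s(p, w) = x3 at *
  generalize s(r, q) = x4 at *
  generalize s(t, q) = x5 at *
  generalize s(w, q) = x6 at *
  generalize s(r, t) = x7 at *
  generalize s(t, w) = x8 at *
  generalize s(r, w) = x9 at *
  simp only [List.nodup_cons, List.mem_cons, List.not_mem_nil, or_false, not_or] at hd
  obtain ⟨k1, k1'⟩ := k1
  obtain ⟨k2, k2'⟩ := k2
  obtain ⟨k3, k3'⟩ := k3
  obtain ⟨k4, k4'⟩ := k4
  obtain ⟨k5, k5'⟩ := k5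
  obtain ⟨k6, k6'⟩ := k6
  rcases k1 with (rfl | rfl | rfl | rfl) | rfl | rfl | rfl | rfl <;> grind

end reductions

section bound
open scoped Classical

variable {V : Type*} {G : SimpleGraph V}

theorem card_dartsIn_le (s : Finset V) : (dartsIn G s).card ≤ s.card * s.card - s.card := by
  have := card_dartsIn_add (G := G) s
  omega

theorem GridMinor.card_dartsIn_five (hG : GridMinor G) {s : Finset V} (hs : s.card = 5) :
    (dartsIn G s).card ≤ 18 := by
  have h1 := card_dartsIn_le (G := G) s
  have h2 := card_dartsIn (G := G) s
  rw [hs] at h1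
  by_contra hlt
  obtain ⟨N, hN, hadj⟩ := exists_missing (G := G) s 0 (by rw [hs]; omega)
  rw [Nat.le_zero, Finset.card_eq_zero] at hN
  subst hN
  refine (hG.comap (H := G.comap (Subtype.val : {x // x ∈ s} → V)) Subtype.val
    Subtype.val_injective fun _ _ h => h).not_complete_five (by simpa using hs) ?_
  intro u v huv
  exact hadj u u.2 v v.2 (fun h => huv (Subtype.ext h)) (Finset.notMem_empty _)

/-- The assertion of the main bound for the vertex set `s`. -/
def EdgeBound (G : SimpleGraph V) (s : Finset V) : Prop :=
  (6 ≤ s.card → 7 * (dartsIn G s).card + 72 ≤ 36 * s.card) ∧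
    (10 ≤ s.card → 7 * (dartsIn G s).card + 72 < 36 * s.card)

theorem EdgeBound.small (hG : GridMinor G) {s : Finset V} (hs : EdgeBound G s)
    (h2 : 2 ≤ s.card) : 7 * (dartsIn G s).card + 72 ≤ 36 * s.card + 18 ∧
      (s.card ≠ 5 → 7 * (dartsIn G s).card + 72 ≤ 36 * s.card + 14) := by
  by_cases h6 : 6 ≤ s.card
  · have := hs.1 h6
    omega
  have h1 := card_dartsIn_le (G := G) s
  by_cases h5 : s.card = 5
  · have := hG.card_dartsIn_five h5
    omega
  obtain h | h | h : s.card = 2 ∨ s.card = 3 ∨ s.card = 4 := by omega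
  all_goals rw [h] at h1 ⊢; omega

theorem EdgeBound.of_cut (hG : GridMinor G) {s : Finset V} (ih : ∀ t ⊂ s, EdgeBound G t)
    {v : V} (hv : v ∈ s)
    (hcut : ¬ NoCut (G.comap (Subtype.val : {x // x ∈ s} → V)) ⟨v, hv⟩) : EdgeBound G s := by
  unfold NoCut at hcut
  push Not at hcut
  obtain ⟨a, b, hav, hbv, hab⟩ := hcut
  set R := Relation.ReflTransGen (fun x y : {x // x ∈ s} =>
    (G.comap (Subtype.val : {x // x ∈ s} → V)).Adj x y ∧ x ≠ ⟨v, hv⟩ ∧ y ≠ ⟨v, hv⟩) with hR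
  set A := s.filter fun x => x = v ∨ ∃ hx : x ∈ s, R a ⟨x, hx⟩ with hA
  set B := s.filter fun x => x = v ∨ ¬ ∃ hx : x ∈ s, R a ⟨x, hx⟩ with hB
  have hRv : ¬ R a ⟨v, hv⟩ := by
    intro h
    rcases Relation.ReflTransGen.cases_tail h with h | ⟨c, -, h⟩
    · exact hav h.symm
    · exact h.2.2 rfl
  have hAB : A ∪ B = s := by
    ext x
    simp only [hA, hB, Finset.mem_union, Finset.mem_filter]
    tauto
  have hI : A ∩ B = {v} := by
    ext x
    simp only [hA, hB, Finset.mem_inter, Finset.mem_filter, Finset.mem_singleton]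
    constructor
    · tauto
    · rintro rfl
      exact ⟨⟨hv, Or.inl rfl⟩, hv, Or.inl rfl⟩
  have haA : a.1 ∈ A := Finset.mem_filter.2 ⟨a.2, Or.inr ⟨a.2, Relation.ReflTransGen.refl⟩⟩
  have hbB : b.1 ∈ B := Finset.mem_filter.2 ⟨b.2, Or.inr fun ⟨_, h⟩ => hab h⟩
  have hvA : v ∈ A := Finset.mem_filter.2 ⟨hv, Or.inl rfl⟩
  have hvB : v ∈ B := Finset.mem_filter.2 ⟨hv, Or.inl rfl⟩
  have hav' : a.1 ≠ v := fun h => hav (Subtype.ext h)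
  have hbv' : b.1 ≠ v := fun h => hbv (Subtype.ext h)
  have haB : a.1 ∉ B := fun h =>
    hav' (Finset.mem_singleton.1 (hI ▸ Finset.mem_inter.2 ⟨haA, h⟩))
  have hbA : b.1 ∉ A := fun h =>
    hbv' (Finset.mem_singleton.1 (hI ▸ Finset.mem_inter.2 ⟨h, hbB⟩))
  have hd : (dartsIn G (A ∪ B)).card = (dartsIn G A).card + (dartsIn G B).card := by
    refine card_dartsIn_union hI.subset ?_
    intro x hx y hy hxB hyA hadj
    obtain ⟨hxs, hx⟩ := Finset.mem_filter.1 hx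
    obtain ⟨hys, hy⟩ := Finset.mem_filter.1 hy
    have hxv : x ≠ v := by rintro rfl; exact hxB hvB
    have hyv : y ≠ v := by rintro rfl; exact hyA hvA
    obtain ⟨_, hRx⟩ := hx.resolve_left hxv
    refine hy.resolve_left hyv ⟨hys, hRx.tail ⟨hadj, ?_, ?_⟩⟩
    · exact fun h => hxv (congrArg Subtype.val h)
    · exact fun h => hyv (congrArg Subtype.val h)
  have hc := Finset.card_union_add_card_inter A B
  rw [hI, hAB, Finset.card_singleton] at hc
  rw [hAB] at hd
  have h1 := EdgeBound.small hG (ih A ⟨Finset.filter_subset _ _, fun h => hbA (h b.2)⟩)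
    (Finset.one_lt_card.2 ⟨a, haA, v, hvA, hav'⟩)
  have h2 := EdgeBound.small hG (ih B ⟨Finset.filter_subset _ _, fun h => haB (h a.2)⟩)
    (Finset.one_lt_card.2 ⟨b, hbB, v, hvB, hbv'⟩)
  unfold EdgeBound
  omega

theorem EdgeBound.of_degree_le_two (hG : GridMinor G) (hT : Theta6Free G) {s : Finset V}
    (ih : ∀ t ⊂ s, EdgeBound G t) {v : V} (hv : v ∈ s)
    (hd : (s.filter fun w => G.Adj v w).card ≤ 2) : EdgeBound G s := by
  have h1 := card_dartsIn_erase (G := G) hv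
  have h2 := ih _ (Finset.erase_ssubset hv)
  have h3 := Finset.card_erase_of_mem hv
  unfold EdgeBound at h2 ⊢
  by_cases h7 : s.card = 6
  swap
  · omega
  refine ⟨fun _ => ?_, by omega⟩
  by_contra hlt
  have h4 := hG.card_dartsIn_five (s := s.erase v) (by omega)
  obtain ⟨N, hN, hadj⟩ := exists_missing (G := G) (s.erase v) 1 (by rw [h3, h7]; omega)
  have : Nonempty (Sym2 V) := ⟨s(v, v)⟩
  obtain ⟨e, he⟩ := Finset.card_le_one_iff_subset_singleton.1 hN
  obtain ⟨p, q, hpq, hF⟩ := Finset.card_eq_two.1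
    (show (s.filter fun w => G.Adj v w).card = 2 by omega)
  have hp : p ∈ s ∧ G.Adj v p := by
    rw [← Finset.mem_filter, hF]; simp
  have hq : q ∈ s ∧ G.Adj v q := by
    rw [← Finset.mem_filter, hF]; simp
  have hc : (((s.erase v).erase p).erase q).card = 3 := by
    rw [Finset.card_erase_of_mem, Finset.card_erase_of_mem, h3, h7]
    · exact Finset.mem_erase.2 ⟨hp.2.ne', hp.1⟩
    · exact Finset.mem_erase.2 ⟨hpq.symm, Finset.mem_erase.2 ⟨hq.2.ne', hq.1⟩⟩
  obtain ⟨r, t, w, hrt, hrw, htw, hE⟩ := Finset.card_eq_three.1 hc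
  have hm : ∀ x, x ∈ ((s.erase v).erase p).erase q ↔ x = r ∨ x = t ∨ x = w := by
    rw [hE]; simp
  simp only [Finset.mem_erase] at hm
  have hr := (hm r).2 (by simp)
  have ht := (hm t).2 (by simp)
  have hw := (hm w).2 (by simp)
  refine hT.no_near_clique_five (v := v) (p := p) (q := q) (r := r) (t := t) (w := w) ?_ hp.2 hq.2
    e ?_
  · have := hp.2.ne
    have := hq.2.ne
    simp only [List.nodup_cons, List.mem_cons, List.not_mem_nil, or_false, not_or]
    grind
  · have hl : ∀ x ∈ [p, q, r, t, w], x ∈ s.erase v := by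
      have := hp.2.ne
      have := hq.2.ne
      intro x hx
      simp only [List.mem_cons, List.not_mem_nil, or_false] at hx
      rw [Finset.mem_erase]
      grind
    intro x hx y hy hxy hne
    exact hadj x (hl x hx) y (hl y hy) hxy fun h => hne (Finset.mem_singleton.1 (he h))

theorem EdgeBound.of_adj_degree_three (hT : Theta6Free G) {s : Finset V}
    (ih : ∀ t ⊂ s, EdgeBound G t) (hdeg : ∀ v ∈ s, 3 ≤ (s.filter fun w => G.Adj v w).card)
    {u v : V} (hu : u ∈ s) (hv : v ∈ s) (huv : G.Adj u v)
    (hu3 : (s.filter fun w => G.Adj u w).card ≤ 3) (hv3 : (s.filter fun w => G.Adj v w).card ≤ 3) :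
    EdgeBound G s := by
  have hvu : v ∈ s.erase u := Finset.mem_erase.2 ⟨huv.ne', hv⟩
  have h1 := card_dartsIn_erase (G := G) hu
  have h2 := card_dartsIn_erase (G := G) hvu
  have h3 : ((s.erase u).filter fun w => G.Adj v w) = (s.filter fun w => G.Adj v w).erase u := by
    ext x
    simp only [Finset.mem_filter, Finset.mem_erase]
    tauto
  have hcv : ((s.filter fun w => G.Adj v w).erase u).card =
      (s.filter fun w => G.Adj v w).card - 1 :=
    Finset.card_erase_of_mem (Finset.mem_filter.2 ⟨hu, huv.symm⟩)
  rw [h3, hcv] at h2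
  have hss : (s.erase u).erase v ⊂ s :=
    (Finset.erase_ssubset hvu).trans (Finset.erase_ssubset hu)
  have h4 := ih _ hss
  have h5 := Finset.card_erase_of_mem hvu
  rw [Finset.card_erase_of_mem hu] at h5
  set S := (s.erase u).erase v with hS
  have hSm : ∀ {x}, x ∈ S ↔ x ≠ v ∧ x ≠ u ∧ x ∈ s := by
    intro x
    simp only [hS, Finset.mem_erase]
  unfold EdgeBound at h4 ⊢
  by_cases h8 : 8 ≤ s.card
  · omega
  refine ⟨fun h6 => ?_, by omega⟩
  by_contra hlt
  obtain ⟨p, hp, hpv, -⟩ := Finset.exists_ne_ne (hdeg u hu) v v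
  obtain ⟨q, hq, hqu, hqp⟩ := Finset.exists_ne_ne (hdeg v hv) u p
  rw [Finset.mem_filter] at hp hq
  have hpS : p ∈ S := hSm.2 ⟨hpv, hp.2.ne', hp.1⟩
  have hqS : q ∈ S := hSm.2 ⟨hq.2.ne', hqu, hq.1⟩
  have hc : ((S.erase p).erase q).card = s.card - 4 := by
    rw [Finset.card_erase_of_mem (Finset.mem_erase.2 ⟨hqp, hqS⟩), Finset.card_erase_of_mem hpS, h5]
    omega
  have hmem : ∀ {x}, x ∈ (S.erase p).erase q ↔ x ≠ q ∧ x ≠ p ∧ x ∈ S := by simp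
  have hd6 := hdeg u hu
  have hd7 := hdeg v hv
  rcases h6.eq_or_lt with h6 | h6
  · obtain ⟨N, hN, hadj⟩ := exists_missing (G := G) S 0 (by rw [h5, ← h6]; omega)
    rw [Nat.le_zero, Finset.card_eq_zero] at hN
    subst hN
    obtain ⟨r, t, hrt, hE⟩ := Finset.card_eq_two.1 (hc.trans (by omega))
    have hr := hmem.1 (show r ∈ _ by rw [hE]; simp)
    have ht := hmem.1 (show t ∈ _ by rw [hE]; simp)
    have hr' := hSm.1 hr.2.2
    have ht' := hSm.1 ht.2.2
    have hall : ∀ x ∈ S, ∀ y ∈ S, x ≠ y → G.Adj x y := fun x hx y hy hxy =>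
      hadj x hx y hy hxy (Finset.notMem_empty _)
    exact hT.short (hall p hpS r hr.2.2 hr.2.1.symm) (hall r hr.2.2 t ht.2.2 hrt)
      (hall t ht.2.2 q hqS ht.1) hq.2.symm huv.symm hp.2 (hall p hpS t ht.2.2 ht.2.1.symm)
      ⟨hqp.symm, hpv, hr.1, hr'.1, hr'.2.1, ht'.1, ht'.2.1, hqu⟩
  · obtain ⟨N, hN, hadj⟩ := exists_missing (G := G) S 2 (by
      rw [h5, show s.card = 7 by omega]; omega)
    have : Inhabited (Sym2 V) := ⟨s(v, v)⟩
    obtain ⟨e, e', he⟩ := Finset.exists_two_of_card_le_two hN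
    obtain ⟨r, t, w, hrt, hrw, htw, hE⟩ := Finset.card_eq_three.1 (hc.trans (by omega))
    have hr := hmem.1 (show r ∈ _ by rw [hE]; simp)
    have ht := hmem.1 (show t ∈ _ by rw [hE]; simp)
    have hw := hmem.1 (show w ∈ _ by rw [hE]; simp)
    have hr' := hSm.1 hr.2.2
    have ht' := hSm.1 ht.2.2
    have hw' := hSm.1 hw.2.2
    refine hT.no_near_clique_five' (u := u) (v := v) (p := p) (q := q) (r := r) (t := t) (w := w)
      ?_ huv hp.2 hq.2 e e' ?_
    · have := hp.2.ne
      have := hq.2.ne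
      have := huv.ne
      simp only [List.nodup_cons, List.mem_cons, List.not_mem_nil, or_false, not_or]
      grind
    · have hl : ∀ x ∈ [p, q, r, t, w], x ∈ S := by
        intro x hx
        simp only [List.mem_cons, List.not_mem_nil, or_false] at hx
        grind
      intro x hx y hy hxy h1 h2
      refine hadj x (hl x hx) y (hl y hy) hxy fun h => ?_
      rcases he _ h with h | h
      exacts [h1 h, h2 h]

theorem edgeBound (hG : GridMinor G) (hT : Theta6Free G) (s : Finset V) : EdgeBound G s := by
  induction s using Finset.strongInduction with
  | H s ih =>
  by_cases hdeg : ∀ v ∈ s, 3 ≤ (s.filter fun w => G.Adj v w).card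
  swap
  · push Not at hdeg
    obtain ⟨v, hv, hd⟩ := hdeg
    exact EdgeBound.of_degree_le_two hG hT ih hv (by omega)
  by_cases hadj : ∃ u v, u ∈ s ∧ v ∈ s ∧ G.Adj u v ∧ (s.filter fun w => G.Adj u w).card ≤ 3 ∧
      (s.filter fun w => G.Adj v w).card ≤ 3
  · obtain ⟨u, v, hu, hv, huv, h1, h2⟩ := hadj
    exact EdgeBound.of_adj_degree_three hT ih hdeg hu hv huv h1 h2
  by_cases hcut : ∀ v : {x // x ∈ s}, NoCut (G.comap (Subtype.val : {x // x ∈ s} → V)) v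
  swap
  · push Not at hcut
    obtain ⟨v, hv⟩ := hcut
    exact EdgeBound.of_cut hG ih v.2 hv
  by_cases h6 : 6 ≤ s.card
  swap
  · exact ⟨fun h => absurd h h6, by omega⟩
  have hinj := Subtype.val_injective (p := fun x => x ∈ s)
  obtain ⟨ι, _, L, hF⟩ := (hG.comap (H := G.comap (Subtype.val : {x // x ∈ s} → V)) Subtype.val
    hinj fun _ _ h => h).exists_faceSystem
  have hdeg3 : ∀ u a b c : {x // x ∈ s}, (∀ w : {x // x ∈ s}, G.Adj u w → w = a ∨ w = b ∨ w = c) →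
      (s.filter fun w => G.Adj u w).card ≤ 3 := by
    intro u a b c hw
    refine (Finset.card_le_card (t := {a.1, b.1, c.1}) fun w hws => ?_).trans Finset.card_le_three
    obtain ⟨h1, h2⟩ := Finset.mem_filter.1 hws
    have := hw ⟨w, h1⟩ h2
    simp only [Finset.mem_insert, Finset.mem_singleton]
    exact this.imp (congrArg Subtype.val) (Or.imp (congrArg Subtype.val) (congrArg Subtype.val))
  have hN : Nice (G.comap (Subtype.val : {x // x ∈ s} → V)) L := by
    refine ⟨hF, hT.comap _ hinj fun _ _ h => h, hcut, ?_, ?_, ?_, ?_⟩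
    · intro v a b
      obtain ⟨c, hc, h1, h2⟩ := Finset.exists_ne_ne (hdeg v v.2) a b
      rw [Finset.mem_filter] at hc
      exact ⟨⟨c, hc.1⟩, hc.2, fun h => h1 (congrArg Subtype.val h),
        fun h => h2 (congrArg Subtype.val h)⟩
    · intro u v huv a b c d hu hv
      exact hadj ⟨u, v, u.2, v.2, huv, hdeg3 u v a b hu, hdeg3 v u c d hv⟩
    · intro p hp hall
      exact (hG.comap (H := G.comap fun i => (p i).1) (fun i => (p i).1) (hinj.comp hp)
        fun _ _ h => h).not_complete_five (by simp) fun i j hij => hall i j hij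
    · intro a b c d e
      obtain ⟨w, h1, h2⟩ := Finset.exists_mem_notMem_of_card_lt_card
        (s := {a.1, b.1, c.1, d.1, e.1}) (t := s) (by
          have := Finset.card_le_five (a := a.1) (b := b.1) (c := c.1) (d := d.1) (e := e.1)
          omega)
      simp only [Finset.mem_insert, Finset.mem_singleton, not_or] at h2
      obtain ⟨na, nb, nc, nd, ne⟩ := h2
      exact ⟨⟨w, h1⟩, fun h => na (congrArg Subtype.val h), fun h => nb (congrArg Subtype.val h),
        fun h => nc (congrArg Subtype.val h), fun h => nd (congrArg Subtype.val h),
        fun h => ne (congrArg Subtype.val h)⟩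
  have : Nonempty {x // x ∈ s} := by
    obtain ⟨x, hx⟩ := Finset.card_pos.1 (show 0 < s.card by omega)
    exact ⟨⟨x, hx⟩⟩
  have h1 : 7 * Fintype.card (G.comap (Subtype.val : {x // x ∈ s} → V)).edgeSet + 36 <
      18 * s.card := by
    have := hN.seven_mul_lt
    rw [Fintype.card_coe] at this
    convert this
  have h2 := card_dartsIn (G := G) s
  unfold EdgeBound
  omega

end bound

/-- For every `n ≥ 10`, every planar simple graph on `n` vertices containing no member of
`Θ₆` as a subgraph has strictly fewer than `18(n-2)/7` edges. -/
theorem planar_turan_theta6_strict (n : ℕ) (hn : 10 ≤ n)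
    (V : Type*) [Fintype V] (G : SimpleGraph V) (hcard : Fintype.card V = n)
    (hplanar : G.HasPlanarEmbedding) (hfree : Theta6Free G) :
    (G.edgeSet.ncard : ℝ) < 18 * ((n : ℝ) - 2) / 7 := by
  classical
  have h1 := (edgeBound hplanar.gridMinor hfree Finset.univ).2 (by rwa [Finset.card_univ, hcard])
  have h2 : (dartsIn G Finset.univ).card = 2 * G.edgeSet.ncard := by
    rw [← Nat.card_coe_set_eq, Nat.card_eq_fintype_card]
    trans (dartPairs G).card
    · congr 1
    · exact card_dartPairs
  rw [h2, Finset.card_univ, hcard] at h1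
  have h3 : 7 * (G.edgeSet.ncard : ℝ) + 36 < 18 * n := by
    have h4 : 7 * G.edgeSet.ncard + 36 < 18 * n := by omega
    exact_mod_cast h4
  linarith
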